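/- Two entire functions f, g on ℂ^n are algebraically dependent over ℂ (i.e., P(f,g) ≡ 0 for some non-zero polynomial P ∈ ℂ[x,y]) if and only if there exists an entire function h on ℂ^n such that either (i) f and g are both polynomials in h with complex coefficients, or (ii) f and g both belong to ℂ[e^h, e^{−h}], the algebra of Laurent polynomials in e^h. -/

import Mathlib

noncomputable section

section

theorem IsLocalMax.second_deriv_nonpos {V V' : ℝ → ℝ} {x₀ L : ℝ} (hmax : IsLocalMax V x₀)
    (h1 : ∀ᶠ x in nhds x₀, HasDerivAt V (V' x) x) (h2 : HasDerivAt V' L x₀) : L ≤ 0 := by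
  by_contra! hL
  have hd : deriv V =ᶠ[nhds x₀] V' := h1.mono fun x hx => hx.deriv
  have hdd : deriv (deriv V) x₀ = L := by rw [hd.deriv_eq, h2.deriv]
  have hmin : IsLocalMin V x₀ :=
    isLocalMin_of_deriv_deriv_pos (by rw [hdd]; exact hL) hmax.deriv_eq_zero
      h1.self_of_nhds.continuousAt
  have hconst : V =ᶠ[nhds x₀] fun _ => V x₀ := by
    filter_upwards [hmin, hmax] with x h h'
    exact le_antisymm h' h
  have : deriv (deriv V) x₀ = 0 := by
    have h3 : deriv V =ᶠ[nhds x₀] fun _ => 0 := by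
      filter_upwards [hconst.eventuallyEq_nhds] with x hx
      rw [hx.deriv_eq]; simp
    rw [h3.deriv_eq]; simp
  linarith

theorem hasDerivAt_normSq {a : ℝ → ℂ} {a' : ℂ} {x : ℝ} (h : HasDerivAt a a' x) :
    HasDerivAt (fun y => Complex.normSq (a y)) (2 * (starRingEnd ℂ (a x) * a').re) x := by
  have hr : HasDerivAt (fun y => (a y).re) a'.re x :=
    Complex.reCLM.hasFDerivAt.comp_hasDerivAt x h
  have hi : HasDerivAt (fun y => (a y).im) a'.im x :=
    Complex.imCLM.hasFDerivAt.comp_hasDerivAt x h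
  have := (hr.mul hr).add (hi.mul hi)
  refine this.congr_deriv ?_
  simp [Complex.mul_re]
  ring

/-- The second derivative at `0` of `log (c + ε |h|²)` along the line of direction `e`, where
`h₀, h₁, h₂` are the values of `h` and of its first two derivatives. -/
def secondDerivLog (h₀ h₁ h₂ : ℂ) (c ε : ℝ) (e : ℂ) : ℝ :=
  ε * (2 * Complex.normSq (e * h₁) + 2 * (starRingEnd ℂ h₀ * (e ^ 2 * h₂)).re) /
      (c + ε * Complex.normSq h₀) -
    4 * ε ^ 2 * (starRingEnd ℂ h₀ * (e * h₁)).re ^ 2 / (c + ε * Complex.normSq h₀) ^ 2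

/-- The logarithm of `c + ε |h|²` along a real line `x ↦ z₀ + x e`. -/
theorem hasDerivAt_log_normSq {h : ℂ → ℂ} {z₀ e : ℂ} {c ε : ℝ} (hh : AnalyticAt ℂ h z₀)
    (hN : 0 < c + ε * Complex.normSq (h z₀)) :
    ∃ V' : ℝ → ℝ,
      (∀ᶠ x : ℝ in nhds 0, HasDerivAt
        (fun y : ℝ => Real.log (c + ε * Complex.normSq (h (z₀ + y * e)))) (V' x) x) ∧
      HasDerivAt V'
        (secondDerivLog (h z₀) (deriv h z₀) (deriv (deriv h) z₀) c ε e) 0 := by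
  have hline : ∀ x : ℝ, HasDerivAt (fun y : ℝ => z₀ + y * e) e x := fun x => by
    simpa using ((Complex.ofRealCLM.hasDerivAt (x := x)).mul_const e).const_add z₀
  have hl0 : z₀ + ((0:ℝ):ℂ) * e = z₀ := by simp
  have hcont : ContinuousAt (fun y : ℝ => z₀ + y * e) 0 := (hline 0).continuousAt
  have hcont' : Filter.Tendsto (fun y : ℝ => z₀ + y * e) (nhds 0) (nhds z₀) := by
    simpa [ContinuousAt] using hcont
  have ev1 : ∀ᶠ x : ℝ in nhds 0, AnalyticAt ℂ h (z₀ + x * e) :=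
    hcont'.eventually hh.eventually_analyticAt
  have hNc : ContinuousAt (fun y : ℝ => c + ε * Complex.normSq (h (z₀ + y * e))) 0 := by
    have : ContinuousAt h (z₀ + ((0:ℝ):ℂ) * e) := by rw [hl0]; exact hh.continuousAt
    have := ContinuousAt.comp (f := fun y : ℝ => z₀ + y * e) (g := h) this hcont
    exact continuousAt_const.add (continuousAt_const.mul
      (Complex.continuous_normSq.continuousAt.comp this))
  have ev2 : ∀ᶠ x : ℝ in nhds 0, 0 < c + ε * Complex.normSq (h (z₀ + x * e)) :=
    hNc.eventually (lt_mem_nhds (by simpa using hN))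
  have hd : ∀ g : ℂ → ℂ, ∀ x : ℝ, AnalyticAt ℂ g (z₀ + x * e) →
      HasDerivAt (fun y : ℝ => g (z₀ + y * e)) (e * deriv g (z₀ + x * e)) x := by
    intro g x hx
    have := hx.differentiableAt.hasDerivAt.comp_of_eq x (hline x) rfl
    rw [mul_comm]
    exact this
  have hder : ∀ x : ℝ, AnalyticAt ℂ h (z₀ + x * e) →
      HasDerivAt (fun y : ℝ => c + ε * Complex.normSq (h (z₀ + y * e)))
        (ε * (2 * (starRingEnd ℂ (h (z₀ + x * e)) * (e * deriv h (z₀ + x * e))).re)) x := by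
    intro x hx
    exact ((hasDerivAt_normSq (hd h x hx)).const_mul ε).const_add c
  refine ⟨fun x => (ε * (2 * (starRingEnd ℂ (h (z₀ + x * e)) * (e * deriv h (z₀ + x * e))).re)) /
    (c + ε * Complex.normSq (h (z₀ + x * e))), ?_, ?_⟩
  · filter_upwards [ev1, ev2] with x h1 h2
    exact (hder x h1).log h2.ne'
  · have h0 : AnalyticAt ℂ h (z₀ + ((0:ℝ):ℂ) * e) := by rwa [hl0]
    have k1 := hder 0 h0
    have k2 := hd _ 0 h0
    have k3 := (hd _ 0 h0.deriv).const_mul e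
    have k4 : HasDerivAt (fun y : ℝ => starRingEnd ℂ (h (z₀ + y * e)))
        (starRingEnd ℂ (e * deriv h (z₀ + ((0:ℝ):ℂ) * e))) 0 :=
      Complex.conjCLE.toContinuousLinearMap.hasFDerivAt.comp_hasDerivAt (0:ℝ) k2
    have k5 := k4.mul k3
    have k6 : HasDerivAt (fun y : ℝ => (starRingEnd ℂ (h (z₀ + y * e)) *
        (e * deriv h (z₀ + y * e))).re) _ 0 :=
      Complex.reCLM.hasFDerivAt.comp_hasDerivAt (0:ℝ) k5
    have k7 := ((k6.const_mul 2).const_mul ε).div k1 (by simpa using hN.ne')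
    refine k7.congr_deriv ?_
    simp only [secondDerivLog, hl0, Complex.reCLM_apply, Complex.add_re]
    have hN' := hN.ne'
    have : Complex.normSq (e * deriv h z₀) =
      (starRingEnd ℂ (e * deriv h z₀) * (e * deriv h z₀)).re := by
      rw [← Complex.normSq_eq_conj_mul_self]; simp
    rw [this]
    field_simp
    ring_nf

end

section

/-- The Laplacian of `log (c + ε |h|²)`, as a sum of second derivatives along `1` and `I`. -/
theorem laplacian_log_normSq (h₀ h₁ h₂ : ℂ) {c ε : ℝ} (hN : 0 < c + ε * Complex.normSq h₀) :
    secondDerivLog h₀ h₁ h₂ c ε 1 + secondDerivLog h₀ h₁ h₂ c ε Complex.I =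
    4 * c * ε * Complex.normSq h₁ / (c + ε * Complex.normSq h₀) ^ 2 := by
  have := hN.ne'
  have h2 : Complex.I ^ 2 = -1 := Complex.I_sq
  rw [secondDerivLog, secondDerivLog, h2]
  field_simp
  simp only [Complex.normSq_apply, Complex.mul_re, Complex.mul_im, Complex.conj_re,
    Complex.conj_im, Complex.I_re, Complex.I_im, Complex.neg_re]
  ring

theorem sum_laplacian_le_of_isLocalMax {ι : Type*} (s : Finset ι) {ξ : ℂ → ℂ} {h : ι → ℂ → ℂ}
    {z₀ : ℂ} {R : ℝ} (hξ : AnalyticAt ℂ ξ z₀) (hξ0 : ξ z₀ ≠ 0)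
    (hh : ∀ i ∈ s, AnalyticAt ℂ (h i) z₀) (hR : Complex.normSq z₀ < R ^ 2)
    (hmax : IsLocalMax (fun z => Complex.normSq (ξ z) * (∏ i ∈ s, (1 + Complex.normSq (h i z))) *
      (R ^ 2 - Complex.normSq z) ^ 2) z₀) :
    ∑ i ∈ s, 4 * Complex.normSq (deriv (h i) z₀) / (1 + Complex.normSq (h i z₀)) ^ 2 ≤
      8 * R ^ 2 / (R ^ 2 - Complex.normSq z₀) ^ 2 := by
  classical
  have hξp : 0 < Complex.normSq (ξ z₀) := Complex.normSq_pos.2 hξ0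
  have hRp : 0 < R ^ 2 - Complex.normSq z₀ := by linarith
  have hhp : ∀ i z, 0 < 1 + Complex.normSq (h i z) := fun i z => by
    have := Complex.normSq_nonneg (h i z); linarith
  set W : ℂ → ℝ := fun z => Real.log (0 + 1 * Complex.normSq (ξ z)) +
    ∑ i ∈ s, Real.log (1 + 1 * Complex.normSq (h i z)) +
    2 * Real.log (R ^ 2 + (-1) * Complex.normSq z) with hW
  have evξ : ∀ᶠ z in nhds z₀, 0 < Complex.normSq (ξ z) :=
    (Complex.continuous_normSq.continuousAt.comp hξ.continuousAt).eventually (lt_mem_nhds hξp)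
  have evR : ∀ᶠ z in nhds z₀, 0 < R ^ 2 - Complex.normSq z :=
    (continuousAt_const.sub Complex.continuous_normSq.continuousAt).eventually (lt_mem_nhds hRp)
  have hWeq : ∀ z, 0 < Complex.normSq (ξ z) → 0 < R ^ 2 - Complex.normSq z →
      W z = Real.log (Complex.normSq (ξ z) * (∏ i ∈ s, (1 + Complex.normSq (h i z))) *
      (R ^ 2 - Complex.normSq z) ^ 2) := by
    intro z h1 h2
    have h3 : 0 < ∏ i ∈ s, (1 + Complex.normSq (h i z)) := Finset.prod_pos fun i _ => hhp i z
    rw [Real.log_mul (by positivity) (by positivity), Real.log_mul h1.ne' h3.ne',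
      Real.log_prod (fun i _ => (hhp i z).ne'), Real.log_pow]
    simp only [hW, one_mul, zero_add, neg_mul, Nat.cast_ofNat, sub_eq_add_neg]
  have hWmax : IsLocalMax W z₀ := by
    filter_upwards [hmax, evξ, evR] with z h1 h2 h3
    rw [hWeq z h2 h3, hWeq z₀ hξp hRp]
    have h4 : 0 < ∏ i ∈ s, (1 + Complex.normSq (h i z)) := Finset.prod_pos fun i _ => hhp i z
    exact Real.log_le_log (by positivity) h1
  have key : ∀ e : ℂ,
      secondDerivLog (ξ z₀) (deriv ξ z₀) (deriv (deriv ξ) z₀) 0 1 e +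
      ∑ i ∈ s, secondDerivLog (h i z₀) (deriv (h i) z₀) (deriv (deriv (h i)) z₀) 1 1 e +
      2 * secondDerivLog (id z₀) (deriv id z₀) (deriv (deriv id) z₀) (R ^ 2) (-1) e ≤ 0 := by
    intro e
    have p1 := hasDerivAt_log_normSq (e := e) hξ (c := 0) (ε := 1) (by simpa using hξp)
    have p2 := fun i (hi : i ∈ s) =>
      hasDerivAt_log_normSq (e := e) (hh i hi) (c := 1) (ε := 1) (by simpa using hhp i z₀)
    have p3 := hasDerivAt_log_normSq (e := e) (analyticAt_id (𝕜 := ℂ) (z := z₀)) (c := R ^ 2)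
      (ε := -1) (by simpa using hR)
    obtain ⟨V1, a1, b1⟩ := p1
    choose! V2 a2 b2 using p2
    obtain ⟨V3, a3, b3⟩ := p3
    have a2' : ∀ᶠ x : ℝ in nhds 0, ∀ i ∈ s, _ := (Filter.eventually_all_finset s).2 a2
    have hm : IsLocalMax (fun x : ℝ => W (z₀ + x * e)) 0 := by
      have : Filter.Tendsto (fun x : ℝ => z₀ + x * e) (nhds 0) (nhds z₀) := by
        have : Continuous (fun x : ℝ => z₀ + x * e) := by fun_prop
        simpa using this.tendsto 0
      have h2 := this.eventually hWmax
      filter_upwards [h2] with x hx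
      simpa using hx
    refine hm.second_deriv_nonpos (V' := fun x => V1 x + ∑ i ∈ s, V2 i x + 2 * V3 x) ?_
      ((b1.add (HasDerivAt.fun_sum b2)).add (b3.const_mul 2))
    filter_upwards [a1, a2', a3] with x c1 c2 c3
    exact (c1.add (HasDerivAt.fun_sum c2)).add (c3.const_mul 2)
  have k1 := key 1
  have kI := key Complex.I
  have l1 := laplacian_log_normSq (ξ z₀) (deriv ξ z₀) (deriv (deriv ξ) z₀) (c := 0) (ε := 1)
    (by simpa using hξp)
  have l2 := fun i => laplacian_log_normSq (h i z₀) (deriv (h i) z₀) (deriv (deriv (h i)) z₀)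
    (c := 1) (ε := 1) (by simpa using hhp i z₀)
  have l3 := laplacian_log_normSq (id z₀) (deriv id z₀) (deriv (deriv id) z₀) (c := R ^ 2)
    (ε := -1) (by simpa using hR)
  have l2' := Finset.sum_congr (rfl : s = s) fun i _ => l2 i
  rw [Finset.sum_add_distrib] at l2'
  have l3' : (4 * R ^ 2 * (-1) * Complex.normSq (deriv id z₀) /
      (R ^ 2 + (-1) * Complex.normSq (id z₀)) ^ 2) =
      - (4 * R ^ 2 / (R ^ 2 - Complex.normSq z₀) ^ 2) := by
    simp [← sub_eq_add_neg]; ring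
  have l2'' : ∑ i ∈ s, 4 * 1 * 1 * Complex.normSq (deriv (h i) z₀) /
      (1 + 1 * Complex.normSq (h i z₀)) ^ 2 =
      ∑ i ∈ s, 4 * Complex.normSq (deriv (h i) z₀) / (1 + Complex.normSq (h i z₀)) ^ 2 := by
    simp
  have l1' : 4 * 0 * 1 * Complex.normSq (deriv ξ z₀) / (0 + 1 * Complex.normSq (ξ z₀)) ^ 2 = 0 := by
    simp
  rw [l3'] at l3
  rw [l2''] at l2'
  rw [l1'] at l1
  have : 8 * R ^ 2 / (R ^ 2 - Complex.normSq z₀) ^ 2 =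
    2 * (4 * R ^ 2 / (R ^ 2 - Complex.normSq z₀) ^ 2) := by ring
  rw [this]
  linarith

end

section

/-- The curvature-type quantity dominating the metric. -/
def curvatureSum (S : Finset ℂ) (β : ℝ) (g : ℂ) : ℝ :=
  ∑ b ∈ S, ‖g - b‖ ^ (β - 2) / (1 + ‖g - b‖ ^ β) ^ 2

theorem exists_bound_off_finset {S : Finset ℂ} {F : ℂ → ℝ} (hcont : ContinuousOn F (↑S)ᶜ)
    (hS : ∀ b ∈ S, ∃ C : ℝ, ∀ᶠ g in nhdsWithin b {b}ᶜ, F g ≤ C)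
    (hinf : ∃ C : ℝ, ∀ᶠ g in Filter.cocompact ℂ, F g ≤ C) :
    ∃ C : ℝ, ∀ g ∉ S, F g ≤ C := by
  obtain ⟨C₀, h₀⟩ := hinf
  obtain ⟨K, hK, hKC⟩ := Filter.mem_cocompact.1 h₀
  have hloc : ∃ C : ℝ, ∀ g ∈ K, g ∉ S → F g ≤ C := by
    refine hK.induction_on (p := fun t => ∃ C : ℝ, ∀ g ∈ t, g ∉ S → F g ≤ C) ⟨0, by simp⟩ ?_ ?_ ?_
    · rintro s t hst ⟨C, hC⟩
      exact ⟨C, fun g hg => hC g (hst hg)⟩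
    · rintro s t ⟨C, hC⟩ ⟨D, hD⟩
      refine ⟨max C D, fun g hg hgS => ?_⟩
      rcases hg with hg | hg
      · exact (hC g hg hgS).trans (le_max_left _ _)
      · exact (hD g hg hgS).trans (le_max_right _ _)
    · intro x _
      by_cases hx : x ∈ S
      · obtain ⟨C, hC⟩ := hS x hx
        rw [eventually_nhdsWithin_iff] at hC
        exact ⟨_, mem_nhdsWithin_of_mem_nhds hC, C, fun g hg hgS =>
          hg (by rintro rfl; exact hgS hx)⟩
      · have hop : IsOpen ((↑S : Set ℂ)ᶜ) := S.finite_toSet.isClosed.isOpen_compl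
        have : ContinuousAt F x := hcont.continuousAt (hop.mem_nhds hx)
        have := this.eventually (gt_mem_nhds (lt_add_one (F x)))
        exact ⟨_, mem_nhdsWithin_of_mem_nhds this, F x + 1, fun g hg _ => le_of_lt hg⟩
  obtain ⟨C₁, h₁⟩ := hloc
  refine ⟨max C₀ C₁, fun g hg => ?_⟩
  by_cases hgK : g ∈ K
  · exact (h₁ g hgK hg).trans (le_max_right _ _)
  · exact (hKC hgK : F g ≤ C₀).trans (le_max_left _ _)

theorem curvatureSum_term_le {S : Finset ℂ} {β : ℝ} {b g : ℂ} (hb : b ∈ S) :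
    ‖g - b‖ ^ (β - 2) / (1 + ‖g - b‖ ^ β) ^ 2 ≤ curvatureSum S β g :=
  Finset.single_le_sum (f := fun b => ‖g - b‖ ^ (β - 2) / (1 + ‖g - b‖ ^ β) ^ 2)
    (fun i _ => by positivity) hb

theorem exists_mul_prod_le_curvatureSum {S : Finset ℂ} (hSne : S.Nonempty) {δ β : ℝ} (hβ : 0 < β)
    (hβδ : β * (S.card + 1) ≤ 2 * δ) {B : ℂ → ℝ} (hB0 : ∀ g, 0 ≤ B g)
    (hBc : ContinuousOn B (↑S)ᶜ)
    (hBS : ∀ b ∈ S, ∃ C : ℝ, ∀ᶠ g in nhdsWithin b {b}ᶜ, B g ≤ C * ‖g - b‖ ^ (δ - 1))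
    (hBinf : ∃ C : ℝ, ∀ᶠ g in Filter.cocompact ℂ, B g ≤ C * ‖g‖ ^ (-1 - δ)) :
    ∃ C : ℝ, 0 ≤ C ∧ ∀ g ∉ S, B g ^ 2 * ∏ b ∈ S, (1 + ‖g - b‖ ^ β) ≤ C * curvatureSum S β g := by
  have hpos : ∀ g ∉ S, ∀ b ∈ S, 0 < ‖g - b‖ := fun g hg b hb =>
    norm_pos_iff.2 (sub_ne_zero.2 (by rintro rfl; exact hg hb))
  have hsum : ∀ g ∉ S, 0 < curvatureSum S β g := fun g hg =>
    Finset.sum_pos (fun b hb => by have := hpos g hg b hb; positivity) hSne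
  have hle : ∀ g ∉ S, ∀ b ∈ S, B g ^ 2 * (∏ b ∈ S, (1 + ‖g - b‖ ^ β)) / curvatureSum S β g ≤
      B g ^ 2 * (∏ b ∈ S, (1 + ‖g - b‖ ^ β)) * (1 + ‖g - b‖ ^ β) ^ 2 * ‖g - b‖ ^ (2 - β) := by
    intro g hg b hb
    have hp := hpos g hg b hb
    have h1 : (1 + ‖g - b‖ ^ β) ^ 2 * ‖g - b‖ ^ (2 - β) =
        (‖g - b‖ ^ (β - 2) / (1 + ‖g - b‖ ^ β) ^ 2)⁻¹ := by
      rw [inv_div, div_eq_mul_inv, ← Real.rpow_neg hp.le]; congr 2; ring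
    rw [mul_assoc (B g ^ 2 * _), h1, div_eq_mul_inv]
    have h2 : 0 ≤ ∏ b ∈ S, (1 + ‖g - b‖ ^ β) := Finset.prod_nonneg fun i _ => by positivity
    gcongr
    exact curvatureSum_term_le hb
  have hrc : ∀ b : ℂ, ∀ γ : ℝ, 0 ≤ γ → Continuous fun g : ℂ => ‖g - b‖ ^ γ := fun b γ hγ =>
    (continuous_id.sub continuous_const).norm.rpow_const fun _ => Or.inr hγ
  have hpc : Continuous fun g : ℂ => ∏ b ∈ S, (1 + ‖g - b‖ ^ β) :=
    continuous_finsetProd _ fun b _ => continuous_const.add (hrc b β hβ.le)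
  have hδ : 0 < δ := by
    have : 0 < β * (S.card + 1) := by positivity
    linarith
  have hβδ' : β ≤ 2 * δ := by
    have : β * 1 ≤ β * (S.card + 1) := by gcongr; simp
    linarith
  suffices h : ∃ C : ℝ, ∀ g ∉ S,
      B g ^ 2 * (∏ b ∈ S, (1 + ‖g - b‖ ^ β)) / curvatureSum S β g ≤ C by
    obtain ⟨C, hC⟩ := h
    refine ⟨max C 0, le_max_right _ _, fun g hg => ?_⟩
    have := hC g hg
    rw [div_le_iff₀ (hsum g hg)] at this
    exact this.trans (mul_le_mul_of_nonneg_right (le_max_left _ _) (hsum g hg).le)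
  refine exists_bound_off_finset ?_ ?_ ?_
  · refine ContinuousOn.div ((hBc.pow 2).mul hpc.continuousOn) ?_ fun g hg => (hsum g hg).ne'
    refine continuousOn_finsetSum _ fun b hb => ?_
    refine ContinuousOn.div ?_ ((continuous_const.add (hrc b β hβ.le)).pow 2).continuousOn
      fun g _ => by positivity
    refine ContinuousOn.rpow_const (by fun_prop) fun g hg => Or.inl (hpos g hg b hb).ne'
  · intro b hb
    obtain ⟨C, hC⟩ := hBS b hb
    have hev : ∀ᶠ g in nhdsWithin b {b}ᶜ, g ∉ S := by
      have : ((↑(S.erase b) : Set ℂ)ᶜ) ∈ nhds b :=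
        (S.erase b).finite_toSet.isClosed.isOpen_compl.mem_nhds (by simp)
      filter_upwards [mem_nhdsWithin_of_mem_nhds this, self_mem_nhdsWithin] with g h1 h2 h3
      exact h1 (by simpa using ⟨h3, h2⟩)
    set H : ℂ → ℝ := fun g => (C ^ 2 * ‖g - b‖ ^ (2 * δ - β)) * (∏ b ∈ S, (1 + ‖g - b‖ ^ β)) *
      (1 + ‖g - b‖ ^ β) ^ 2 with hH
    have hHc : Continuous H := by
      exact ((continuous_const.mul (hrc b _ (by linarith))).mul hpc).mul
        ((continuous_const.add (hrc b β hβ.le)).pow 2)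
    refine ⟨H b + 1, ?_⟩
    have hHe : ∀ᶠ g in nhdsWithin b {b}ᶜ, H g < H b + 1 :=
      (hHc.continuousAt.eventually (gt_mem_nhds (lt_add_one _))).filter_mono nhdsWithin_le_nhds
    filter_upwards [hC, hev, hHe] with g h1 h2 h3
    refine (hle g h2 b hb).trans (le_trans ?_ h3.le)
    have hp := hpos g h2 b hb
    have e1 : ‖g - b‖ ^ (2 * δ - β) = (‖g - b‖ ^ (δ - 1)) ^ 2 * ‖g - b‖ ^ (2 - β) := by
      rw [← Real.rpow_natCast, ← Real.rpow_mul hp.le, ← Real.rpow_add hp]; congr 1; push_cast; ring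
    have e2 : H g = (C * ‖g - b‖ ^ (δ - 1)) ^ 2 * (∏ b ∈ S, (1 + ‖g - b‖ ^ β)) *
      (1 + ‖g - b‖ ^ β) ^ 2 * ‖g - b‖ ^ (2 - β) := by
      simp only [hH, e1]; ring
    rw [e2]
    have h2 : 0 ≤ ∏ b ∈ S, (1 + ‖g - b‖ ^ β) := Finset.prod_nonneg fun i _ => by positivity
    have := hB0 g
    gcongr
  · obtain ⟨C, hC⟩ := hBinf
    obtain ⟨b, hb⟩ := hSne
    have hev : ∀ᶠ g in Filter.cocompact ℂ, g ∉ S := S.finite_toSet.isCompact.compl_mem_cocompact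
    have hn : Filter.Tendsto (fun g : ℂ => ‖g‖) (Filter.cocompact ℂ) Filter.atTop :=
      tendsto_norm_cocompact_atTop
    have hbig : ∀ᶠ g in Filter.cocompact ℂ, ∀ b ∈ S, ‖b‖ ≤ ‖g‖ :=
      (Filter.eventually_all_finset S).2 fun b _ => hn.eventually_ge_atTop ‖b‖
    have hlow : ∀ᶠ g in Filter.cocompact ℂ, 2 * ‖b‖ ≤ ‖g‖ := hn.eventually_ge_atTop _
    have hone : ∀ᶠ g in Filter.cocompact ℂ, 1 ≤ ‖g‖ := hn.eventually_ge_atTop _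
    have hβ2 : β ≤ 2 ∨ 2 < β := le_or_gt _ _
    refine ⟨C ^ 2 * (2 * 2 ^ β) ^ (S.card + 2) * max (2 ^ (2 - β)) ((1 / 2) ^ (2 - β)), ?_⟩
    filter_upwards [hC, hev, hbig, hlow, hone] with g h1 h2 h3 h4 h5
    refine (hle g h2 b hb).trans ?_
    have hg0 : 0 < ‖g‖ := by linarith
    have hp := hpos g h2 b hb
    have t1 : ∀ b ∈ S, 1 + ‖g - b‖ ^ β ≤ 2 * 2 ^ β * ‖g‖ ^ β := by
      intro b hb
      have a1 : ‖g - b‖ ≤ 2 * ‖g‖ := (norm_sub_le _ _).trans (by linarith [h3 b hb])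
      have a2 : ‖g - b‖ ^ β ≤ 2 ^ β * ‖g‖ ^ β := by
        rw [← Real.mul_rpow (by norm_num) hg0.le]
        exact Real.rpow_le_rpow (norm_nonneg _) a1 hβ.le
      have a3 : (1:ℝ) ≤ 2 ^ β * ‖g‖ ^ β := by
        rw [← Real.mul_rpow (by norm_num) hg0.le]
        exact Real.one_le_rpow (by linarith) hβ.le
      linarith
    have t2 : ∏ b ∈ S, (1 + ‖g - b‖ ^ β) ≤ (2 * 2 ^ β * ‖g‖ ^ β) ^ S.card :=
      (Finset.prod_le_prod (fun i _ => by positivity) t1).trans_eq (by simp)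
    have t3 : ‖g - b‖ ^ (2 - β) ≤ max (2 ^ (2 - β)) ((1 / 2) ^ (2 - β)) * ‖g‖ ^ (2 - β) := by
      rcases hβ2 with h | h
      · have a1 : ‖g - b‖ ≤ 2 * ‖g‖ := (norm_sub_le _ _).trans (by linarith [h3 b hb])
        calc ‖g - b‖ ^ (2 - β) ≤ (2 * ‖g‖) ^ (2 - β) :=
              Real.rpow_le_rpow (norm_nonneg _) a1 (by linarith)
          _ = 2 ^ (2 - β) * ‖g‖ ^ (2 - β) := Real.mul_rpow (by norm_num) hg0.le
          _ ≤ _ := by gcongr; exact le_max_left _ _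
      · have a1 : 1 / 2 * ‖g‖ ≤ ‖g - b‖ := by
          have := norm_sub_norm_le g b
          linarith
        calc ‖g - b‖ ^ (2 - β) ≤ (1 / 2 * ‖g‖) ^ (2 - β) :=
              Real.rpow_le_rpow_of_nonpos (by positivity) a1 (by linarith)
          _ = (1 / 2) ^ (2 - β) * ‖g‖ ^ (2 - β) := Real.mul_rpow (by norm_num) hg0.le
          _ ≤ _ := by gcongr; exact le_max_right _ _
    have h2' : 0 ≤ ∏ b ∈ S, (1 + ‖g - b‖ ^ β) := Finset.prod_nonneg fun i _ => by positivity
    have hBg := hB0 g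
    have hmax : (0:ℝ) ≤ max (2 ^ (2 - β)) ((1 / 2) ^ (2 - β)) := le_max_of_le_left (by positivity)
    calc B g ^ 2 * (∏ b ∈ S, (1 + ‖g - b‖ ^ β)) * (1 + ‖g - b‖ ^ β) ^ 2 * ‖g - b‖ ^ (2 - β)
        ≤ (C * ‖g‖ ^ (-1 - δ)) ^ 2 * (2 * 2 ^ β * ‖g‖ ^ β) ^ S.card * (2 * 2 ^ β * ‖g‖ ^ β) ^ 2 *
          (max (2 ^ (2 - β)) ((1 / 2) ^ (2 - β)) * ‖g‖ ^ (2 - β)) := by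
          have := t1 b hb
          gcongr
      _ = C ^ 2 * (2 * 2 ^ β) ^ (S.card + 2) * max (2 ^ (2 - β)) ((1 / 2) ^ (2 - β)) *
          ((‖g‖ ^ (-1 - δ)) ^ 2 * (‖g‖ ^ β) ^ (S.card + 2) * ‖g‖ ^ (2 - β)) := by ring
      _ ≤ C ^ 2 * (2 * 2 ^ β) ^ (S.card + 2) * max (2 ^ (2 - β)) ((1 / 2) ^ (2 - β)) * 1 := by
          gcongr
          rw [← Real.rpow_natCast, ← Real.rpow_mul hg0.le, ← Real.rpow_natCast,
            ← Real.rpow_mul hg0.le, ← Real.rpow_add hg0, ← Real.rpow_add hg0]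
          refine Real.rpow_le_one_of_one_le_of_nonpos h5 ?_
          push_cast
          nlinarith
      _ = _ := mul_one _

end

section

theorem not_isLocalMax_mul_cusp {A q : ℂ → ℝ} {z₀ : ℂ} {c : ℝ} (hA : DifferentiableAt ℝ A z₀)
    (hA0 : 0 < A z₀) (hc : 0 < c) (hq0 : q z₀ = 0)
    (hq : ∀ᶠ z in nhds z₀, c * ‖z - z₀‖ ^ (1 / 2 : ℝ) ≤ q z) :
    ¬ IsLocalMax (fun z => A z * (1 + q z)) z₀ := by
  intro hmax
  obtain ⟨K, hK⟩ := hA.isBigO_sub.bound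
  have hApos : ∀ᶠ z in nhds z₀, 0 < A z := hA.continuousAt.eventually (lt_mem_nhds hA0)
  have hev : ∀ᶠ z in nhds z₀, A z₀ * c * ‖z - z₀‖ ^ (1 / 2 : ℝ) ≤
      K * ‖z - z₀‖ * (1 + c * ‖z - z₀‖ ^ (1 / 2 : ℝ)) := by
    filter_upwards [hmax, hK, hq, hApos] with z h1 h2 h3 h4
    have h5 : A z₀ - K * ‖z - z₀‖ ≤ A z := by
      have := (abs_le.1 (by simpa using h2 : |A z - A z₀| ≤ K * ‖z - z₀‖)).1
      linarith
    have h6 : A z * (1 + c * ‖z - z₀‖ ^ (1 / 2 : ℝ)) ≤ A z₀ := by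
      refine le_trans ?_ (h1.trans_eq (by simp [hq0]))
      gcongr
    have h7 : 0 ≤ 1 + c * ‖z - z₀‖ ^ (1 / 2 : ℝ) := by positivity
    nlinarith [mul_le_mul_of_nonneg_right h5 h7]
  have ht : Filter.Tendsto (fun x : ℝ => z₀ + (x : ℂ)) (nhdsWithin 0 (Set.Ioi 0)) (nhds z₀) := by
    have : Continuous (fun x : ℝ => z₀ + (x : ℂ)) := by fun_prop
    simpa using (this.tendsto 0).mono_left nhdsWithin_le_nhds
  have hev2 : ∀ᶠ x : ℝ in nhdsWithin 0 (Set.Ioi 0), A z₀ * c ≤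
      K * x ^ (1 / 2 : ℝ) * (1 + c * x ^ (1 / 2 : ℝ)) := by
    filter_upwards [ht.eventually hev, self_mem_nhdsWithin] with x hx hx0
    have hx0' : (0:ℝ) < x := hx0
    simp only [add_sub_cancel_left, Complex.norm_real, Real.norm_eq_abs, abs_of_pos hx0'] at hx
    have h1 : 0 < x ^ (1 / 2 : ℝ) := Real.rpow_pos_of_pos hx0' _
    have h2 : x ^ (1 / 2 : ℝ) * x ^ (1 / 2 : ℝ) = x := by
      rw [← Real.rpow_add hx0']; norm_num
    refine le_of_mul_le_mul_right ?_ h1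
    calc _ ≤ _ := hx
      _ = K * (x ^ (1 / 2 : ℝ) * x ^ (1 / 2 : ℝ)) * (1 + c * x ^ (1 / 2 : ℝ)) := by rw [h2]
      _ = _ := by ring
  have hlim : Filter.Tendsto (fun x : ℝ => K * x ^ (1 / 2 : ℝ) * (1 + c * x ^ (1 / 2 : ℝ)))
      (nhdsWithin 0 (Set.Ioi 0)) (nhds 0) := by
    have hr : Continuous fun x : ℝ => x ^ (1 / 2 : ℝ) :=
      Real.continuous_rpow_const (by norm_num)
    have : Continuous fun x : ℝ => K * x ^ (1 / 2 : ℝ) * (1 + c * x ^ (1 / 2 : ℝ)) := by fun_prop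
    have := (this.tendsto 0).mono_left (nhdsWithin_le_nhds (s := Set.Ioi 0))
    simpa using this
  have := ge_of_tendsto hlim hev2
  have : 0 < A z₀ * c := by positivity
  linarith

theorem AnalyticAt.exists_order_bounds {G : ℂ → ℂ} {z₀ : ℂ} (hG : AnalyticAt ℂ G z₀)
    (hnc : ¬ ∀ᶠ z in nhds z₀, G z = G z₀) :
    ∃ m : ℕ, 1 ≤ m ∧ ∃ c C : ℝ, 0 < c ∧ 0 < C ∧ ∀ᶠ z in nhds z₀,
      c * ‖z - z₀‖ ^ m ≤ ‖G z - G z₀‖ ∧ ‖G z - G z₀‖ ≤ C * ‖z - z₀‖ ^ m ∧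
      ‖deriv G z‖ ≤ C * ‖z - z₀‖ ^ (m - 1) := by
  have hF : AnalyticAt ℂ (fun z => G z - G z₀) z₀ := hG.sub analyticAt_const
  obtain ⟨m, η, hη, hη0, hev⟩ := hF.exists_eventuallyEq_pow_smul_nonzero_iff.2
    (by simpa [sub_eq_zero] using hnc)
  have hm : 1 ≤ m := by
    by_contra! h
    have : m = 0 := by omega
    subst this
    have := hev.self_of_nhds
    simp at this
    exact hη0 this.symm
  have hη0' : 0 < ‖η z₀‖ := norm_pos_iff.2 hη0
  have hc1 : ContinuousAt (fun z => ‖η z‖) z₀ := hη.continuousAt.norm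
  have hc2 : ContinuousAt (fun z => ‖m * η z + (z - z₀) * deriv η z‖) z₀ :=
    ((continuousAt_const.mul hη.continuousAt).add
      ((continuousAt_id.sub continuousAt_const).mul hη.deriv.continuousAt)).norm
  refine ⟨m, hm, ‖η z₀‖ / 2,
    max (‖η z₀‖ + 1) (‖m * η z₀ + (z₀ - z₀) * deriv η z₀‖ + 1), by positivity,
    lt_max_of_lt_left (by positivity), ?_⟩
  filter_upwards [hev, hev.eventually_nhds, hη.eventually_analyticAt,
    hc1.eventually (lt_mem_nhds (half_lt_self hη0')), hc1.eventually (gt_mem_nhds (lt_add_one _)),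
    hc2.eventually (gt_mem_nhds (lt_add_one _))] with z h1 h2 h3 h4 h5 h6
  have hd : deriv G z = (z - z₀) ^ (m - 1) * (m * η z + (z - z₀) * deriv η z) := by
    have e1 : G =ᶠ[nhds z] fun w => (w - z₀) ^ m * η w + G z₀ := by
      filter_upwards [h2] with w hw
      rw [← smul_eq_mul, ← hw]; ring
    rw [e1.deriv_eq]
    have d1 : HasDerivAt (fun w => (w - z₀) ^ m) (m * (z - z₀) ^ (m - 1) * 1) z :=
      ((hasDerivAt_id z).sub_const z₀).pow m
    have d2 := (d1.mul h3.differentiableAt.hasDerivAt).add_const (G z₀)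
    have d3 : deriv (fun w => (w - z₀) ^ m * η w + G z₀) z = _ := d2.deriv
    rw [d3]
    obtain ⟨k, rfl⟩ : ∃ k, m = k + 1 := ⟨m - 1, by omega⟩
    simp only [Nat.add_sub_cancel, pow_succ]
    ring
  rw [hd, h1, smul_eq_mul, norm_mul, norm_mul, norm_pow, norm_pow]
  refine ⟨?_, ?_, ?_⟩
  · rw [mul_comm]; gcongr
  · rw [mul_comm]; gcongr; exact h5.le.trans (le_max_left _ _)
  · rw [mul_comm]; gcongr; exact h6.le.trans (le_max_right _ _)

theorem exists_branch_rpow {G : ℂ → ℂ} {z₀ b : ℂ} {β : ℝ} (hG : AnalyticAt ℂ G z₀)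
    (hb : G z₀ ≠ b) : ∃ h : ℂ → ℂ, AnalyticAt ℂ h z₀ ∧
      (∀ z, G z ≠ b → Complex.normSq (h z) = ‖G z - b‖ ^ β) ∧
      Complex.normSq (deriv h z₀) = (β / 2) ^ 2 * ‖G z₀ - b‖ ^ (β - 2) * ‖deriv G z₀‖ ^ 2 := by
  set r := G z₀ - b with hr
  have hr0 : r ≠ 0 := sub_ne_zero.2 hb
  have hrp : 0 < ‖r‖ := norm_pos_iff.2 hr0
  have hq : AnalyticAt ℂ (fun z => (G z - b) / r) z₀ :=
    (hG.sub analyticAt_const).div analyticAt_const hr0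
  have hq1 : (G z₀ - b) / r = 1 := div_self hr0
  have han : AnalyticAt ℂ (fun z => ((G z - b) / r) ^ ((β / 2 : ℝ) : ℂ)) z₀ :=
    hq.cpow analyticAt_const (by rw [hq1]; simp)
  refine ⟨fun z => ((‖r‖ ^ (β / 2) : ℝ) : ℂ) * ((G z - b) / r) ^ ((β / 2 : ℝ) : ℂ),
    analyticAt_const.mul han, fun z _ => ?_, ?_⟩
  · rw [map_mul, Complex.normSq_ofReal, Complex.normSq_eq_norm_sq, Complex.norm_cpow_real,
      norm_div, ← pow_two, ← mul_pow, ← Real.mul_rpow (norm_nonneg _) (by positivity),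
      mul_div_cancel₀ _ hrp.ne', ← Real.rpow_natCast, ← Real.rpow_mul (norm_nonneg _)]
    congr 1; push_cast; ring
  · have d1 : HasDerivAt (fun z => (G z - b) / r) (deriv G z₀ / r) z₀ :=
      (hG.differentiableAt.hasDerivAt.sub_const b).div_const r
    have d2 := (d1.cpow_const (c := ((β / 2 : ℝ) : ℂ)) (by simp only [hq1]; simp)).const_mul
      (((‖r‖ ^ (β / 2) : ℝ) : ℂ))
    rw [d2.deriv, hq1]
    simp only [Complex.one_cpow, mul_one, map_mul, Complex.normSq_ofReal, map_div₀]
    rw [Complex.normSq_eq_norm_sq, Complex.normSq_eq_norm_sq]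
    have e1 : ‖r‖ ^ (β - 2) = ‖r‖ ^ (β / 2) * ‖r‖ ^ (β / 2) / ‖r‖ ^ 2 := by
      rw [← Real.rpow_add hrp, ← Real.rpow_natCast, ← Real.rpow_sub hrp]; congr 1; push_cast; ring
    rw [e1]
    ring

end

section

/-- Near a point where `G` takes the value `b`, a function dominated by `‖G - b‖ ^ (δ - 1) ‖G'‖`
is `O(‖z - z₀‖ ^ (m δ - 1))` with `m` the order of `G - b`. -/
theorem AnalyticAt.exists_bound_of_le_rpow {G : ℂ → ℂ} {z₀ : ℂ} {δ C : ℝ} {ξ : ℂ → ℂ}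
    (hδ : δ ≤ 1) (hG : AnalyticAt ℂ G z₀) (hnc : ¬ ∀ᶠ z in nhds z₀, G z = G z₀)
    (hξ : ∀ᶠ z in nhdsWithin z₀ {z₀}ᶜ, G z ≠ G z₀ →
      ‖ξ z‖ ≤ C * ‖G z - G z₀‖ ^ (δ - 1) * ‖deriv G z‖) :
    ∃ m : ℕ, 1 ≤ m ∧ ∃ c D : ℝ, 0 < c ∧
      (∀ᶠ z in nhds z₀, c * ‖z - z₀‖ ^ m ≤ ‖G z - G z₀‖) ∧
      ∀ᶠ z in nhdsWithin z₀ {z₀}ᶜ, ‖ξ z‖ ≤ D * ‖z - z₀‖ ^ (m * δ - 1) := by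
  obtain ⟨m, hm, c, C', hc, hC', hev⟩ := hG.exists_order_bounds hnc
  refine ⟨m, hm, c, max C 0 * c ^ (δ - 1) * C', hc, hev.mono fun z hz => hz.1, ?_⟩
  filter_upwards [hξ, hev.filter_mono nhdsWithin_le_nhds, self_mem_nhdsWithin] with z h1 h2 h3
  obtain ⟨h4, -, h6⟩ := h2
  have hz : 0 < ‖z - z₀‖ := norm_pos_iff.2 (sub_ne_zero.2 h3)
  have hp : 0 < c * ‖z - z₀‖ ^ m := by positivity
  have hne : G z ≠ G z₀ := sub_ne_zero.1 (norm_pos_iff.1 (hp.trans_le h4))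
  calc ‖ξ z‖ ≤ C * ‖G z - G z₀‖ ^ (δ - 1) * ‖deriv G z‖ := h1 hne
    _ ≤ max C 0 * (c * ‖z - z₀‖ ^ m) ^ (δ - 1) * (C' * ‖z - z₀‖ ^ (m - 1)) := by
      have : ‖G z - G z₀‖ ^ (δ - 1) ≤ (c * ‖z - z₀‖ ^ m) ^ (δ - 1) :=
        Real.rpow_le_rpow_of_nonpos hp h4 (by linarith)
      gcongr
      exact le_max_left _ _
    _ = max C 0 * c ^ (δ - 1) * C' * (((‖z - z₀‖ ^ m) ^ (δ - 1)) * ‖z - z₀‖ ^ (m - 1)) := by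
      rw [Real.mul_rpow hc.le (by positivity)]; ring
    _ = _ := by
      congr 1
      rw [← Real.rpow_natCast, ← Real.rpow_mul hz.le, ← Real.rpow_natCast, ← Real.rpow_add hz]
      congr 1
      push_cast [Nat.cast_sub hm]
      ring

variable {G ξ : ℂ → ℂ} {S : Finset ℂ} {β : ℝ}

/-- The conformal density used in the maximum principle. -/
def ahlforsDensity (G ξ : ℂ → ℂ) (S : Finset ℂ) (β : ℝ) (z : ℂ) : ℝ :=
  Complex.normSq (ξ z) * ∏ b ∈ S, (1 + ‖G z - b‖ ^ β)

theorem ahlforsDensity_nonneg (z : ℂ) : 0 ≤ ahlforsDensity G ξ S β z :=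
  mul_nonneg (Complex.normSq_nonneg _) (Finset.prod_nonneg fun _ _ => by positivity)

theorem continuous_ahlforsDensity (hG : Continuous G) (hξ : Continuous ξ) (hβ : 0 ≤ β) :
    Continuous (ahlforsDensity G ξ S β) :=
  (Complex.continuous_normSq.comp hξ).mul (continuous_finsetProd _ fun _ _ =>
    continuous_const.add ((hG.sub continuous_const).norm.rpow_const fun _ => Or.inr hβ))

theorem ahlforsDensity_not_isLocalMax_of_mem {δ C R : ℝ} {z₀ : ℂ} (hδ : δ ≤ 1)
    (hβ : 0 < β) (hβδ : 2 * β ≤ δ)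
    (hG : Differentiable ℂ G) (hξ : Differentiable ℂ ξ) (hb : G z₀ ∈ S)
    (hnc : ¬ ∀ᶠ z in nhds z₀, G z = G z₀)
    (hle : ∀ᶠ z in nhdsWithin z₀ {z₀}ᶜ, G z ≠ G z₀ →
      ‖ξ z‖ ≤ C * ‖G z - G z₀‖ ^ (δ - 1) * ‖deriv G z‖)
    (hR : Complex.normSq z₀ < R ^ 2) (hξ0 : ξ z₀ ≠ 0) :
    ¬ IsLocalMax (fun z => ahlforsDensity G ξ S β z * (R ^ 2 - Complex.normSq z) ^ 2) z₀ := by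
  classical
  obtain ⟨m, hm, c, D, hc, h1, h2⟩ := (hG.analyticAt z₀).exists_bound_of_le_rpow hδ hnc hle
  have hmδ : m * δ ≤ 1 := by
    by_contra! hlt
    have ht : Filter.Tendsto (fun z => D * ‖z - z₀‖ ^ (m * δ - 1))
        (nhdsWithin z₀ {z₀}ᶜ) (nhds 0) := by
      have hcn : Continuous fun z : ℂ => D * ‖z - z₀‖ ^ (m * δ - 1) :=
        continuous_const.mul ((continuous_id.sub continuous_const).norm.rpow_const
          fun _ => Or.inr (by linarith))
      have := (hcn.tendsto z₀).mono_left (nhdsWithin_le_nhds (s := {z₀}ᶜ))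
      simpa [Real.zero_rpow (sub_pos.2 hlt).ne'] using this
    have ht' : Filter.Tendsto ξ (nhdsWithin z₀ {z₀}ᶜ) (nhds 0) := squeeze_zero_norm' h2 ht
    exact hξ0 (tendsto_nhds_unique
      ((hξ.continuous.tendsto z₀).mono_left nhdsWithin_le_nhds) ht')
  set b := G z₀ with hbdef
  set A : ℂ → ℝ := fun z => (Complex.normSq (ξ z) * ∏ a ∈ S.erase b, (1 + ‖G z - a‖ ^ β)) *
    (R ^ 2 - Complex.normSq z) ^ 2 with hA
  have hdn : ∀ f : ℂ → ℂ, Differentiable ℂ f → Differentiable ℝ fun z => Complex.normSq (f z) := by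
    intro f hf
    have : (fun z => Complex.normSq (f z)) = fun z => ‖f z‖ ^ 2 := by
      ext z; exact Complex.normSq_eq_norm_sq _
    rw [this]
    exact (hf.restrictScalars ℝ : Differentiable ℝ f).norm_sq ℝ
  have hAd : DifferentiableAt ℝ A z₀ := by
    refine DifferentiableAt.mul (DifferentiableAt.mul (hdn ξ hξ z₀) ?_) ?_
    · refine (HasFDerivAt.finsetProd (𝕜 := ℝ) (g := fun a z => 1 + ‖G z - a‖ ^ β)
        fun a ha => DifferentiableAt.hasFDerivAt ?_).differentiableAt
      have hne : G z₀ - a ≠ 0 := sub_ne_zero.2 (Finset.ne_of_mem_erase ha).symm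
      have h3 : DifferentiableAt ℝ (fun z => ‖G z - a‖) z₀ :=
        ((hG.restrictScalars ℝ : Differentiable ℝ G) z₀ |>.sub_const a).norm ℝ hne
      exact (h3.rpow_const (Or.inl (norm_ne_zero_iff.2 hne))).const_add 1
    · exact ((hdn id differentiable_id z₀).const_sub (R ^ 2)).pow 2
  have hA0 : 0 < A z₀ := by
    have h3 := Complex.normSq_pos.2 hξ0
    have h4 : 0 < R ^ 2 - Complex.normSq z₀ := by linarith
    have h5 : 0 < ∏ a ∈ S.erase b, (1 + ‖G z₀ - a‖ ^ β) :=
      Finset.prod_pos fun a _ => by positivity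
    simp only [hA]; positivity
  have hcusp := not_isLocalMax_mul_cusp (q := fun z => ‖G z - b‖ ^ β) (c := c ^ β) hAd hA0
    (by positivity) (by simp [hbdef, hβ.ne']) ?_
  · have : (fun z => ahlforsDensity G ξ S β z * (R ^ 2 - Complex.normSq z) ^ 2) =
        fun z => A z * (1 + ‖G z - b‖ ^ β) := by
      ext z
      rw [ahlforsDensity, ← Finset.mul_prod_erase S _ hb]
      simp only [hA]; ring
    rw [this]
    exact hcusp
  · have hsmall : ∀ᶠ z in nhds z₀, ‖z - z₀‖ ≤ 1 := by
      filter_upwards [Metric.ball_mem_nhds z₀ one_pos] with z hz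
      exact (mem_ball_iff_norm.1 hz).le
    filter_upwards [h1, hsmall] with z hz hz1
    rcases eq_or_ne z z₀ with rfl | hne
    · simp [hbdef, hβ.ne']
    have hzp : 0 < ‖z - z₀‖ := norm_pos_iff.2 (sub_ne_zero.2 hne)
    calc c ^ β * ‖z - z₀‖ ^ (1 / 2 : ℝ) ≤ c ^ β * ‖z - z₀‖ ^ (m * β) := by
          gcongr ?_ * ?_
          refine Real.rpow_le_rpow_of_exponent_ge hzp hz1 ?_
          have : (m:ℝ) * (2 * β) ≤ m * δ := by gcongr
          linarith
      _ = (c * ‖z - z₀‖ ^ m) ^ β := by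
          rw [Real.mul_rpow hc.le (by positivity), ← Real.rpow_natCast,
            ← Real.rpow_mul hzp.le]
      _ ≤ ‖G z - b‖ ^ β := Real.rpow_le_rpow (by positivity) hz hβ.le

theorem ahlforsDensity_le_of_isLocalMax {R C Bz : ℝ} {z₀ : ℂ} (hβ : 0 < β)
    (hG : Differentiable ℂ G) (hξ : Differentiable ℂ ξ) (hb : G z₀ ∉ S)
    (hR : Complex.normSq z₀ < R ^ 2) (hξ0 : ξ z₀ ≠ 0) (hC : 0 ≤ C)
    (hle : ‖ξ z₀‖ ≤ Bz * ‖deriv G z₀‖)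
    (hB : Bz ^ 2 * ∏ b ∈ S, (1 + ‖G z₀ - b‖ ^ β) ≤ C * curvatureSum S β (G z₀))
    (hmax : IsLocalMax (fun z => ahlforsDensity G ξ S β z * (R ^ 2 - Complex.normSq z) ^ 2) z₀) :
    ahlforsDensity G ξ S β z₀ * (R ^ 2 - Complex.normSq z₀) ^ 2 ≤ C * (8 / β ^ 2) * R ^ 2 := by
  classical
  have hne : ∀ b ∈ S, G z₀ ≠ b := fun b hbS h => hb (h ▸ hbS)
  choose! h h1 h2 h3 using fun b (hbS : b ∈ S) =>
    exists_branch_rpow (β := β) (hG.analyticAt z₀) (hne b hbS)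
  have hev : ∀ᶠ z in nhds z₀, ∀ b ∈ S, G z ≠ b :=
    (Filter.eventually_all_finset S).2 fun b hbS =>
      hG.continuous.continuousAt.eventually_ne (hne b hbS)
  have hmax' : IsLocalMax (fun z => Complex.normSq (ξ z) *
      (∏ b ∈ S, (1 + Complex.normSq (h b z))) * (R ^ 2 - Complex.normSq z) ^ 2) z₀ := by
    refine hmax.congr ?_
    filter_upwards [hev] with z hz
    rw [ahlforsDensity, Finset.prod_congr rfl fun b hbS => by rw [← h2 b hbS z (hz b hbS)]]
  have key := sum_laplacian_le_of_isLocalMax S (hξ.analyticAt z₀) hξ0 h1 hR hmax'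
  have hsum : ∑ b ∈ S, 4 * Complex.normSq (deriv (h b) z₀) / (1 + Complex.normSq (h b z₀)) ^ 2 =
      β ^ 2 * ‖deriv G z₀‖ ^ 2 * curvatureSum S β (G z₀) := by
    rw [curvatureSum, Finset.mul_sum]
    refine Finset.sum_congr rfl fun b hbS => ?_
    rw [h3 b hbS, h2 b hbS z₀ (hne b hbS)]
    ring
  rw [hsum] at key
  have hRp : 0 < R ^ 2 - Complex.normSq z₀ := by linarith
  rw [le_div_iff₀ (by positivity)] at key
  have hprod : 0 ≤ ∏ b ∈ S, (1 + ‖G z₀ - b‖ ^ β) := Finset.prod_nonneg fun _ _ => by positivity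
  have hdens : ahlforsDensity G ξ S β z₀ ≤ ‖deriv G z₀‖ ^ 2 * (C * curvatureSum S β (G z₀)) := by
    rw [ahlforsDensity, Complex.normSq_eq_norm_sq]
    calc _ ≤ (Bz * ‖deriv G z₀‖) ^ 2 * ∏ b ∈ S, (1 + ‖G z₀ - b‖ ^ β) := by gcongr
      _ = ‖deriv G z₀‖ ^ 2 * (Bz ^ 2 * ∏ b ∈ S, (1 + ‖G z₀ - b‖ ^ β)) := by ring
      _ ≤ _ := by gcongr
  calc _ ≤ ‖deriv G z₀‖ ^ 2 * (C * curvatureSum S β (G z₀)) *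
        (R ^ 2 - Complex.normSq z₀) ^ 2 := by gcongr
    _ = C / β ^ 2 * (β ^ 2 * ‖deriv G z₀‖ ^ 2 * curvatureSum S β (G z₀) *
        (R ^ 2 - Complex.normSq z₀) ^ 2) := by field_simp
    _ ≤ C / β ^ 2 * (8 * R ^ 2) := by gcongr
    _ = _ := by ring

theorem eq_zero_of_dominated (hSne : S.Nonempty) {δ : ℝ} (hδ0 : 0 < δ) (hδ : δ ≤ 1)
    {B : ℂ → ℝ} (hB0 : ∀ g, 0 ≤ B g) (hBc : ContinuousOn B (↑S)ᶜ)
    (hBS : ∀ b ∈ S, ∃ C : ℝ, ∀ᶠ g in nhdsWithin b {b}ᶜ, B g ≤ C * ‖g - b‖ ^ (δ - 1))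
    (hBinf : ∃ C : ℝ, ∀ᶠ g in Filter.cocompact ℂ, B g ≤ C * ‖g‖ ^ (-1 - δ))
    (hG : Differentiable ℂ G) (hξ : Differentiable ℂ ξ)
    (hnc : ∀ z₀, ¬ ∀ᶠ z in nhds z₀, G z = G z₀)
    (hle : ∀ z, G z ∉ S → ‖ξ z‖ ≤ B (G z) * ‖deriv G z‖) (z : ℂ) : ξ z = 0 := by
  set β : ℝ := δ / (S.card + 1) with hβdef
  have hk : (1:ℝ) ≤ S.card := by exact_mod_cast hSne.card_pos
  have hβ : 0 < β := by positivity
  have hβk : β * (S.card + 1) = δ := by rw [hβdef]; field_simp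
  have hβδ : 2 * β ≤ δ := by nlinarith
  obtain ⟨C, hC0, hC⟩ := exists_mul_prod_le_curvatureSum hSne hβ (by linarith) hB0 hBc hBS hBinf
  have hcont := continuous_ahlforsDensity (S := S) hG.continuous hξ.continuous hβ.le
  have main : ∀ R : ℝ, ∀ w : ℂ, ‖w‖ < R →
      ahlforsDensity G ξ S β w * (R ^ 2 - Complex.normSq w) ^ 2 ≤ C * (8 / β ^ 2) * R ^ 2 := by
    intro R w hw
    set Φ : ℂ → ℝ := fun z => ahlforsDensity G ξ S β z * (R ^ 2 - Complex.normSq z) ^ 2 with hΦ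
    have hΦc : Continuous Φ :=
      hcont.mul ((continuous_const.sub Complex.continuous_normSq).pow 2)
    obtain ⟨z₀, hz₀, hz₀max⟩ := (isCompact_closedBall (0:ℂ) R).exists_isMaxOn
      ⟨w, by simpa using hw.le⟩ hΦc.continuousOn
    refine (hz₀max (by simpa using hw.le : w ∈ Metric.closedBall (0:ℂ) R)).trans ?_
    have hrhs : 0 ≤ C * (8 / β ^ 2) * R ^ 2 := by positivity
    by_cases hzero : Φ z₀ = 0
    · exact (le_of_eq hzero).trans hrhs
    have hξ0 : ξ z₀ ≠ 0 := by
      intro h; apply hzero; simp [hΦ, ahlforsDensity, h]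
    have hlt : ‖z₀‖ < R := by
      refine lt_of_le_of_ne (by simpa using hz₀) fun h => hzero ?_
      simp [hΦ, Complex.normSq_eq_norm_sq, h]
    have hR : Complex.normSq z₀ < R ^ 2 := by
      rw [Complex.normSq_eq_norm_sq]; gcongr
    have hmax : IsLocalMax Φ z₀ :=
      hz₀max.isLocalMax (Metric.closedBall_mem_nhds_of_mem (by simpa using hlt))
    by_cases hb : G z₀ ∈ S
    · exfalso
      obtain ⟨C', hC'⟩ := hBS _ hb
      have hGe : ∀ᶠ z in nhds z₀, G z ∈ ({G z₀} : Set ℂ)ᶜ →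
          B (G z) ≤ C' * ‖G z - G z₀‖ ^ (δ - 1) :=
        hG.continuous.continuousAt.eventually (eventually_nhdsWithin_iff.1 hC')
      have hGS : ∀ᶠ z in nhds z₀, G z ≠ G z₀ → G z ∉ S := by
        classical
        have : ((↑(S.erase (G z₀)) : Set ℂ)ᶜ) ∈ nhds (G z₀) :=
          (S.erase (G z₀)).finite_toSet.isClosed.isOpen_compl.mem_nhds (by simp)
        filter_upwards [hG.continuous.continuousAt.eventually this] with z h1 h2 h3
        exact h1 (by simpa using ⟨h3, h2⟩)
      refine ahlforsDensity_not_isLocalMax_of_mem (C := C') hδ hβ hβδ hG hξ hb (hnc z₀) ?_ hR hξ0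
        hmax
      filter_upwards [hGe.filter_mono nhdsWithin_le_nhds, hGS.filter_mono nhdsWithin_le_nhds]
        with z h1 h2 h3
      exact (hle z (h2 h3)).trans (by gcongr; exact h1 h3)
    · exact ahlforsDensity_le_of_isLocalMax hβ hG hξ hb hR hξ0 hC0 (hle z₀ hb) (hC _ hb) hmax
  have hzero : ahlforsDensity G ξ S β z = 0 := by
    refine le_antisymm ?_ (ahlforsDensity_nonneg z)
    by_contra! hpos
    set M := C * (8 / β ^ 2) with hM
    have hM0 : 0 ≤ M := by positivity
    set a := ahlforsDensity G ξ S β z with ha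
    set R : ℝ := 2 * ‖z‖ + 1 + 4 * M / a with hR
    have hq : 0 ≤ 4 * M / a := by positivity
    have hRz : ‖z‖ < R := by have := norm_nonneg z; linarith
    have hR1 : 1 ≤ R := by have := norm_nonneg z; linarith
    have h1 := main R z hRz
    rw [Complex.normSq_eq_norm_sq] at h1
    have h2 : R ^ 2 / 2 ≤ R ^ 2 - ‖z‖ ^ 2 := by
      have : 2 * ‖z‖ ≤ R := by linarith
      nlinarith [norm_nonneg z]
    have h3 : a * (R ^ 2 / 2) ^ 2 ≤ M * R ^ 2 := le_trans (by gcongr) h1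
    have h4 : a * R ^ 2 ≤ 4 * M := by
      have : 0 < R ^ 2 := by positivity
      nlinarith
    have h5 : a * R ≤ 4 * M := le_trans (by gcongr; nlinarith) h4
    have h6 : a * R = a * (2 * ‖z‖ + 1) + 4 * M := by rw [hR]; field_simp
    have h7 : 0 < a * (2 * ‖z‖ + 1) := by positivity
    linarith
  rcases mul_eq_zero.1 hzero with h | h
  · exact Complex.normSq_eq_zero.1 h
  · exact absurd h (Finset.prod_pos fun b _ => by positivity).ne'

end

section
open Filter Polynomial

theorem exists_entire_quotient {P Q : ℂ → ℂ} (hP : Differentiable ℂ P) (hQ : Differentiable ℂ Q)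
    (hQ0 : ∀ z₀, ∀ᶠ z in nhdsWithin z₀ {z₀}ᶜ, Q z ≠ 0)
    (h : ∀ z₀, Tendsto (fun z => (z - z₀) * (P z / Q z)) (nhdsWithin z₀ {z₀}ᶜ) (nhds 0)) :
    ∃ ξ : ℂ → ℂ, Differentiable ℂ ξ ∧ ∀ z, ξ z * Q z = P z := by
  set F : ℂ → ℂ := fun z => P z / Q z with hF
  have hFd : ∀ z, Q z ≠ 0 → DifferentiableAt ℂ F z := fun z hz => (hP z).div (hQ z) hz
  set ξ : ℂ → ℂ := fun z => limUnder (nhdsWithin z {z}ᶜ) F with hξ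
  have hξF : ∀ z, Q z ≠ 0 → ξ z = F z := fun z hz =>
    ((hFd z hz).continuousAt.tendsto.mono_left nhdsWithin_le_nhds).limUnder_eq
  have hd : Differentiable ℂ ξ := by
    intro z₀
    obtain ⟨s, hs, hsQ⟩ := mem_nhdsWithin_iff_exists_mem_nhds_inter.1 (hQ0 z₀)
    have hdo : DifferentiableOn ℂ F (s \ {z₀}) := fun z hz =>
      (hFd z (hsQ ⟨hz.1, hz.2⟩)).differentiableWithinAt
    have hlo : (fun z => F z - F z₀) =o[nhdsWithin z₀ {z₀}ᶜ] fun z => (z - z₀)⁻¹ := by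
      refine (Asymptotics.isLittleO_iff_tendsto' ?_).2 ?_
      · filter_upwards [self_mem_nhdsWithin] with z hz h0
        exact absurd (inv_eq_zero.1 h0) (sub_ne_zero.2 hz)
      · have h2 : Tendsto (fun z : ℂ => (z - z₀) * F z₀) (nhdsWithin z₀ {z₀}ᶜ) (nhds 0) := by
          have : Continuous fun z : ℂ => (z - z₀) * F z₀ := by fun_prop
          simpa using (this.tendsto z₀).mono_left (nhdsWithin_le_nhds (s := {z₀}ᶜ))
        have h3 := (h z₀).sub h2
        rw [sub_zero] at h3
        refine h3.congr fun z => ?_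
        rw [div_inv_eq_mul]; ring
    have := Complex.differentiableOn_update_limUnder_of_isLittleO hs hdo hlo
    refine (this.differentiableAt hs).congr_of_eventuallyEq ?_
    filter_upwards [hs] with z hz
    rcases eq_or_ne z z₀ with rfl | hne
    · simp [hξ]
    · rw [Function.update_of_ne hne, hξF z (hsQ ⟨hz, hne⟩)]
  refine ⟨ξ, hd, fun z₀ => ?_⟩
  have h1 : Tendsto (fun z => ξ z * Q z) (nhdsWithin z₀ {z₀}ᶜ) (nhds (ξ z₀ * Q z₀)) :=
    ((hd.continuous.mul hQ.continuous).tendsto z₀).mono_left nhdsWithin_le_nhds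
  have h2 : Tendsto P (nhdsWithin z₀ {z₀}ᶜ) (nhds (P z₀)) :=
    (hP.continuous.tendsto z₀).mono_left nhdsWithin_le_nhds
  refine tendsto_nhds_unique (h1.congr' ?_) h2
  filter_upwards [hQ0 z₀] with z hz
  rw [hξF z hz, hF]
  field_simp

theorem Polynomial.exists_norm_eval_bounds {p : ℂ[X]} (hp : p ≠ 0) :
    ∃ c C : ℝ, 0 < c ∧ 0 < C ∧ ∀ᶠ g in cocompact ℂ,
      c * ‖g‖ ^ p.natDegree ≤ ‖p.eval g‖ ∧ ‖p.eval g‖ ≤ C * ‖g‖ ^ p.natDegree := by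
  have hl : 0 < ‖p.leadingCoeff‖ := norm_pos_iff.2 (leadingCoeff_ne_zero.2 hp)
  have hinv : Tendsto (fun g : ℂ => g⁻¹) (cocompact ℂ) (nhds 0) := by
    rw [← Metric.cobounded_eq_cocompact]; exact tendsto_inv₀_cobounded
  have ht : Tendsto (fun g : ℂ => ‖p.reverse.eval g⁻¹‖) (cocompact ℂ) (nhds ‖p.leadingCoeff‖) := by
    have := ((p.reverse.continuous.tendsto 0).comp hinv).norm
    rwa [← coeff_zero_eq_eval_zero, coeff_zero_reverse] at this
  refine ⟨‖p.leadingCoeff‖ / 2, ‖p.leadingCoeff‖ + 1, by positivity, by positivity, ?_⟩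
  filter_upwards [ht.eventually (lt_mem_nhds (half_lt_self hl)),
    ht.eventually (gt_mem_nhds (lt_add_one _)),
    (tendsto_norm_cocompact_atTop (E := ℂ)).eventually_gt_atTop 0] with g h1 h2 h3
  have hg : g ≠ 0 := norm_pos_iff.1 h3
  have e : ‖p.eval g‖ = ‖p.reverse.eval g⁻¹‖ * ‖g‖ ^ p.natDegree := by
    let u : Invertible g := invertibleOfNonzero hg
    have := eval₂_reverse_mul_pow (RingHom.id ℂ) g p
    rw [← norm_pow, ← norm_mul]
    congr 1
    simpa [eval₂_id, invOf_eq_inv] using this.symm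
  rw [e]
  constructor <;> gcongr

/-- The Cauchy-type bound for the roots of `x ^ d + ∑ c_j x ^ (d - j)`. -/
theorem norm_le_sum_rpow_of_root {d : ℕ} (hd : 1 ≤ d) {c : ℕ → ℂ} {x : ℂ}
    (h : x ^ d + ∑ j ∈ Finset.Icc 1 d, c j * x ^ (d - j) = 0) :
    ‖x‖ ≤ ∑ j ∈ Finset.Icc 1 d, (d * ‖c j‖) ^ (1 / (j : ℝ)) := by
  by_contra! hlt
  have hx : 0 < ‖x‖ := lt_of_le_of_lt (Finset.sum_nonneg fun _ _ => by positivity) hlt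
  have hj : ∀ j ∈ Finset.Icc 1 d, ‖c j * x ^ (d - j)‖ < ‖x‖ ^ d / d := by
    intro j hj
    have hj1 := (Finset.mem_Icc.1 hj).1
    have hj2 := (Finset.mem_Icc.1 hj).2
    have h1 : (d * ‖c j‖) ^ (1 / (j : ℝ)) < ‖x‖ := lt_of_le_of_lt
      (Finset.single_le_sum (f := fun j : ℕ => (d * ‖c j‖) ^ (1 / (j : ℝ)))
        (fun _ _ => by positivity) hj) hlt
    have hj0 : (0:ℝ) < j := by exact_mod_cast hj1
    have h2 : d * ‖c j‖ < ‖x‖ ^ j := by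
      have := Real.rpow_lt_rpow (by positivity) h1 hj0
      rwa [← Real.rpow_mul (by positivity), one_div, inv_mul_cancel₀ hj0.ne', Real.rpow_one,
        Real.rpow_natCast] at this
    have hd0 : (0:ℝ) < d := by exact_mod_cast hd
    rw [norm_mul, norm_pow, lt_div_iff₀ hd0]
    calc ‖c j‖ * ‖x‖ ^ (d - j) * d = d * ‖c j‖ * ‖x‖ ^ (d - j) := by ring
      _ < ‖x‖ ^ j * ‖x‖ ^ (d - j) := by gcongr
      _ = ‖x‖ ^ d := by rw [← pow_add]; congr 1; omega
  have h1 : ‖x‖ ^ d ≤ ∑ j ∈ Finset.Icc 1 d, ‖c j * x ^ (d - j)‖ := by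
    rw [← norm_pow, eq_neg_of_add_eq_zero_left h, norm_neg]
    exact norm_sum_le _ _
  have h2 := Finset.sum_lt_sum_of_nonempty ⟨1, by simpa using hd⟩ hj
  rw [Finset.sum_const, Nat.card_Icc, Nat.add_sub_cancel, nsmul_eq_mul,
    mul_div_cancel₀ _ (by positivity)] at h2
  linarith

end

section
open Filter Polynomial

/-- The Cauchy bound of the polynomial `D x ^ d + ∑ N_j x ^ (d - j)`. -/
def rootBound (d : ℕ) (D : ℂ[X]) (N : ℕ → ℂ[X]) (g : ℂ) : ℝ :=
  ∑ j ∈ Finset.Icc 1 d, (d * ‖(N j).eval g / D.eval g‖) ^ (1 / (j : ℝ))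

variable {d : ℕ} {D : ℂ[X]} {N : ℕ → ℂ[X]}

theorem rootBound_nonneg (g : ℂ) : 0 ≤ rootBound d D N g :=
  Finset.sum_nonneg fun _ _ => by positivity

theorem rootBound_continuousOn {s : Set ℂ} (hs : ∀ g ∈ s, D.eval g ≠ 0) :
    ContinuousOn (rootBound d D N) s := by
  refine continuousOn_finsetSum _ fun j _ => ContinuousOn.rpow_const ?_
    fun _ _ => Or.inr (by positivity)
  exact continuousOn_const.mul
    (((N j).continuous.continuousOn.div D.continuous.continuousOn hs).norm)

theorem Polynomial.eventually_eval_ne_zero {p : ℂ[X]} (hp : p ≠ 0) (b : ℂ) :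
    ∀ᶠ g in nhdsWithin b {b}ᶜ, p.eval g ≠ 0 := by
  have : (↑(p.roots.toFinset.erase b) : Set ℂ)ᶜ ∈ nhds b :=
    (p.roots.toFinset.erase b).finite_toSet.isClosed.isOpen_compl.mem_nhds (by simp)
  filter_upwards [mem_nhdsWithin_of_mem_nhds this, self_mem_nhdsWithin] with g h1 h2 h3
  exact h1 (by simpa using ⟨⟨hp, h3⟩, h2⟩)

theorem rootBound_le_near {b : ℂ} (hd : 1 ≤ d) (hD : D ≠ 0)
    (hfin : ∃ (q : ℂ[X]) (a : ℕ → ℂ[X]), q.eval b ≠ 0 ∧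
      ∀ j ∈ Finset.Icc 1 d, q ^ j * (X - C b) ^ (j - 1) * N j = a j * D) :
    ∃ K : ℝ, ∀ᶠ g in nhdsWithin b {b}ᶜ,
      rootBound d D N g ≤ K * ‖g - b‖ ^ ((1 / d : ℝ) - 1) := by
  obtain ⟨q, a, hq, hqa⟩ := hfin
  have hd0 : (0:ℝ) < d := by exact_mod_cast hd
  set M : ℕ → ℝ := fun j => ‖(a j).eval b / q.eval b ^ j‖ + 1 with hM
  refine ⟨∑ j ∈ Finset.Icc 1 d, (d * M j) ^ (1 / (j : ℝ)), ?_⟩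
  have h1 : ∀ᶠ g in nhdsWithin b {b}ᶜ, ∀ j ∈ Finset.Icc 1 d,
      ‖(a j).eval g / q.eval g ^ j‖ < M j := by
    refine (eventually_all_finset _).2 fun j _ => ?_
    have : ContinuousAt (fun g => ‖(a j).eval g / q.eval g ^ j‖) b :=
      ((a j).continuous.continuousAt.div (q.continuous.continuousAt.pow j) (pow_ne_zero _ hq)).norm
    exact (this.eventually (gt_mem_nhds (lt_add_one _))).filter_mono nhdsWithin_le_nhds
  have h2 : ∀ᶠ g in nhdsWithin b {b}ᶜ, q.eval g ≠ 0 :=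
    (q.continuous.continuousAt.eventually_ne hq).filter_mono nhdsWithin_le_nhds
  have h3 : ∀ᶠ g in nhdsWithin b {b}ᶜ, ‖g - b‖ ≤ 1 := by
    filter_upwards [mem_nhdsWithin_of_mem_nhds (Metric.ball_mem_nhds b one_pos)] with g hg
    exact (mem_ball_iff_norm.1 hg).le
  filter_upwards [h1, h2, h3, eventually_eval_ne_zero hD b, self_mem_nhdsWithin]
    with g h1 h2 h3 h4 h5
  have hgb : g - b ≠ 0 := sub_ne_zero.2 h5
  have hp : 0 < ‖g - b‖ := norm_pos_iff.2 hgb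
  rw [rootBound, Finset.sum_mul]
  refine Finset.sum_le_sum fun j hj => ?_
  have hj1 := (Finset.mem_Icc.1 hj).1
  have hj2 := (Finset.mem_Icc.1 hj).2
  have hj0 : (0:ℝ) < j := by exact_mod_cast hj1
  have hN : (N j).eval g / D.eval g = (a j).eval g / q.eval g ^ j / (g - b) ^ (j - 1) := by
    have := congrArg (eval g) (hqa j hj)
    simp only [eval_mul, eval_pow, eval_sub, eval_X, eval_C] at this
    rw [div_div, div_eq_div_iff h4 (by positivity), ← this]; ring
  have hn : ‖(N j).eval g / D.eval g‖ ≤ M j * ‖g - b‖ ^ (1 - (j:ℝ)) := by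
    rw [hN, norm_div, norm_pow, div_eq_mul_inv]
    have : (‖g - b‖ ^ (j - 1))⁻¹ = ‖g - b‖ ^ (1 - (j:ℝ)) := by
      rw [← Real.rpow_natCast, ← Real.rpow_neg hp.le]; congr 1; push_cast [Nat.cast_sub hj1]; ring
    rw [this]
    gcongr
    exact (h1 j hj).le
  have hM0 : 0 ≤ M j := by positivity
  calc (d * ‖(N j).eval g / D.eval g‖) ^ (1 / (j : ℝ))
      ≤ (d * (M j * ‖g - b‖ ^ (1 - (j:ℝ)))) ^ (1 / (j : ℝ)) := by gcongr
    _ = (d * M j) ^ (1 / (j : ℝ)) * ‖g - b‖ ^ ((1 / j : ℝ) - 1) := by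
      rw [← mul_assoc, Real.mul_rpow (by positivity) (by positivity), ← Real.rpow_mul hp.le]
      congr 2; field_simp
    _ ≤ _ := by
      gcongr ?_ * ?_
      refine Real.rpow_le_rpow_of_exponent_ge hp h3 ?_
      gcongr

theorem rootBound_le_cocompact (hd : 1 ≤ d) (hD : D ≠ 0)
    (hinf : ∀ j ∈ Finset.Icc 1 d, N j = 0 ∨ (N j).natDegree + j + 1 ≤ D.natDegree) :
    ∃ K : ℝ, ∀ᶠ g in cocompact ℂ, rootBound d D N g ≤ K * ‖g‖ ^ (-1 - (1 / d : ℝ)) := by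
  have hd0 : (0:ℝ) < d := by exact_mod_cast hd
  obtain ⟨c, c', hc, _, hDev⟩ := exists_norm_eval_bounds hD
  have hK : ∀ j ∈ Finset.Icc 1 d, ∃ K : ℝ, 0 ≤ K ∧ ∀ᶠ g in cocompact ℂ,
      ‖(N j).eval g / D.eval g‖ ≤ K * ‖g‖ ^ (-(j:ℝ) - 1) := by
    intro j hj
    rcases hinf j hj with h0 | hdeg
    · exact ⟨0, le_rfl, by simp [h0]⟩
    by_cases h0 : N j = 0
    · exact ⟨0, le_rfl, by simp [h0]⟩
    obtain ⟨C', C, _, hC, hNev⟩ := exists_norm_eval_bounds h0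
    refine ⟨C / c, by positivity, ?_⟩
    filter_upwards [hDev, hNev, (tendsto_norm_cocompact_atTop (E := ℂ)).eventually_ge_atTop 1]
      with g h1 h2 h3
    have hg : 0 < ‖g‖ := by linarith
    rw [norm_div]
    calc _ ≤ (C * ‖g‖ ^ (N j).natDegree) / (c * ‖g‖ ^ D.natDegree) := by
            gcongr
            exacts [h2.2, h1.1]
      _ = C / c * ‖g‖ ^ (((N j).natDegree : ℝ) - D.natDegree) := by
            rw [Real.rpow_sub hg, Real.rpow_natCast, Real.rpow_natCast]; field_simp
      _ ≤ _ := by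
            gcongr ?_ * ?_
            refine Real.rpow_le_rpow_of_exponent_le h3 ?_
            have : (((N j).natDegree + j + 1 : ℕ) : ℝ) ≤ D.natDegree := by exact_mod_cast hdeg
            push_cast at this
            linarith
  choose! K hK0 hKev using hK
  refine ⟨∑ j ∈ Finset.Icc 1 d, (d * K j) ^ (1 / (j : ℝ)), ?_⟩
  filter_upwards [(eventually_all_finset _).2 hKev,
    (tendsto_norm_cocompact_atTop (E := ℂ)).eventually_ge_atTop 1] with g h1 h3
  have hg : 0 < ‖g‖ := by linarith
  rw [rootBound, Finset.sum_mul]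
  refine Finset.sum_le_sum fun j hj => ?_
  have hj1 := (Finset.mem_Icc.1 hj).1
  have hj2 := (Finset.mem_Icc.1 hj).2
  have hj0 : (0:ℝ) < j := by exact_mod_cast hj1
  have hKj := hK0 j hj
  calc (d * ‖(N j).eval g / D.eval g‖) ^ (1 / (j : ℝ))
      ≤ (d * (K j * ‖g‖ ^ (-(j:ℝ) - 1))) ^ (1 / (j : ℝ)) := by gcongr; exact h1 j hj
    _ = (d * K j) ^ (1 / (j : ℝ)) * ‖g‖ ^ (-1 - (1 / j : ℝ)) := by
      rw [← mul_assoc, Real.mul_rpow (by positivity) (by positivity), ← Real.rpow_mul hg.le]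
      congr 2; field_simp
    _ ≤ _ := by
      gcongr ?_ * ?_
      refine Real.rpow_le_rpow_of_exponent_le h3 ?_
      gcongr

/-- An entire function `P` such that `P / D(G)` is integral over the entire function `G`, with the
growth of a holomorphic differential, vanishes identically unless `G` is constant. -/
theorem mul_deriv_eq_zero_of_algebraic {G P : ℂ → ℂ} (hd : 1 ≤ d) (hD : D ≠ 0)
    (hG : Differentiable ℂ G) (hP : Differentiable ℂ P)
    (hnc : ∀ z₀, ¬ ∀ᶠ z in nhds z₀, G z = G z₀)
    (hrel : ∀ z, P z ^ d + ∑ j ∈ Finset.Icc 1 d,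
      (N j).eval (G z) * D.eval (G z) ^ (j - 1) * P z ^ (d - j) = 0)
    (hfin : ∀ b : ℂ, ∃ (q : ℂ[X]) (a : ℕ → ℂ[X]), q.eval b ≠ 0 ∧
      ∀ j ∈ Finset.Icc 1 d, q ^ j * (X - C b) ^ (j - 1) * N j = a j * D)
    (hinf : ∀ j ∈ Finset.Icc 1 d, N j = 0 ∨ (N j).natDegree + j + 1 ≤ D.natDegree) (z : ℂ) :
    P z * deriv G z = 0 := by
  classical
  have hd0 : (0:ℝ) < d := by exact_mod_cast hd
  have hδ0 : (0:ℝ) < 1 / d := by positivity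
  have hδ1 : (1 / d : ℝ) ≤ 1 := by rw [div_le_one hd0]; exact_mod_cast hd
  have hbound : ∀ z, D.eval (G z) ≠ 0 →
      ‖P z * deriv G z / D.eval (G z)‖ ≤ rootBound d D N (G z) * ‖deriv G z‖ := by
    intro z hz
    have h1 : (P z / D.eval (G z)) ^ d + ∑ j ∈ Finset.Icc 1 d,
        ((N j).eval (G z) / D.eval (G z)) * (P z / D.eval (G z)) ^ (d - j) = 0 := by
      have h2 := hrel z
      rw [← zero_div (D.eval (G z) ^ d), ← h2, add_div, Finset.sum_div, div_pow]
      congr 1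
      refine Finset.sum_congr rfl fun j hj => ?_
      obtain ⟨i, rfl⟩ : ∃ i, j = i + 1 := ⟨j - 1, by have := (Finset.mem_Icc.1 hj).1; omega⟩
      obtain ⟨k, rfl⟩ : ∃ k, d = i + 1 + k :=
        ⟨d - (i + 1), by have := (Finset.mem_Icc.1 hj).2; omega⟩
      rw [Nat.add_sub_cancel, Nat.add_sub_cancel_left, div_pow]
      field_simp
      ring
    have h3 := norm_le_sum_rpow_of_root hd h1
    have h4 : P z * deriv G z / D.eval (G z) = P z / D.eval (G z) * deriv G z := by ring
    rw [h4, norm_mul]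
    gcongr
    exact h3
  have hDG0 : ∀ z₀, ∀ᶠ z in nhdsWithin z₀ {z₀}ᶜ, G z ≠ G z₀ := by
    intro z₀
    rcases (hG.analyticAt z₀).eventually_eq_or_eventually_ne
      (analyticAt_const (v := G z₀)) with h | h
    · exact absurd h (hnc z₀)
    · exact h
  have hDG1 : ∀ z₀, ∀ᶠ z in nhdsWithin z₀ {z₀}ᶜ, D.eval (G z) ≠ 0 := by
    intro z₀
    have h1 := eventually_nhdsWithin_iff.1 (eventually_eval_ne_zero hD (G z₀))
    filter_upwards [hDG0 z₀,
      (hG.continuous.continuousAt.eventually h1).filter_mono nhdsWithin_le_nhds] with z h2 h3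
    exact h3 h2
  have hDGd : Differentiable ℂ fun z => D.eval (G z) := D.differentiable.comp hG
  obtain ⟨ξ, hξd, hξ⟩ := exists_entire_quotient (P := fun z => P z * deriv G z)
    (Q := fun z => D.eval (G z)) (hP.mul hG.deriv) hDGd hDG1 (by
      intro z₀
      obtain ⟨K, hK⟩ := rootBound_le_near hd hD (hfin (G z₀))
      have hK' := hG.continuous.continuousAt.eventually (eventually_nhdsWithin_iff.1 hK)
      obtain ⟨m, hm, -, K', -, -, h2⟩ := (hG.analyticAt z₀).exists_bound_of_le_rpow
        (δ := 1 / d) (C := K) (ξ := fun z => P z * deriv G z / D.eval (G z)) hδ1 (hnc z₀) (by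
          filter_upwards [hK'.filter_mono nhdsWithin_le_nhds, hDG1 z₀] with z h1 h2 h3
          refine (hbound z h2).trans ?_
          gcongr
          exact h1 h3)
      have hmp : (0:ℝ) < m * (1 / d) := by
        have : (0:ℝ) < m := by exact_mod_cast hm
        positivity
      have ht : Tendsto (fun z => K' * ‖z - z₀‖ ^ (m * (1 / d : ℝ)))
          (nhdsWithin z₀ {z₀}ᶜ) (nhds 0) := by
        have hcn : Continuous fun z : ℂ => K' * ‖z - z₀‖ ^ (m * (1 / d : ℝ)) :=
          continuous_const.mul ((continuous_id.sub continuous_const).norm.rpow_const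
            fun _ => Or.inr hmp.le)
        have := (hcn.tendsto z₀).mono_left (nhdsWithin_le_nhds (s := {z₀}ᶜ))
        simpa only [sub_self, norm_zero, Real.zero_rpow hmp.ne', mul_zero] using this
      refine squeeze_zero_norm' ?_ ht
      filter_upwards [h2, self_mem_nhdsWithin] with z hz hne
      have hp : 0 < ‖z - z₀‖ := norm_pos_iff.2 (sub_ne_zero.2 hne)
      rw [norm_mul]
      calc _ ≤ ‖z - z₀‖ * (K' * ‖z - z₀‖ ^ (m * (1 / d : ℝ) - 1)) := by gcongr
        _ = _ := by rw [Real.rpow_sub_one hp.ne']; field_simp)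
  set S : Finset ℂ := insert 0 D.roots.toFinset with hS
  have hSD : ∀ g ∉ S, D.eval g ≠ 0 := by
    intro g hg h0
    exact hg (Finset.mem_insert_of_mem (by simpa using ⟨hD, h0⟩))
  have hzero := eq_zero_of_dominated (S := S) ⟨0, by simp [hS]⟩ hδ0 hδ1
    (B := rootBound d D N) rootBound_nonneg
    (rootBound_continuousOn fun g hg => hSD g hg)
    (fun b _ => rootBound_le_near hd hD (hfin b)) (rootBound_le_cocompact hd hD hinf) hG hξd hnc
    (fun z hz => by
      have := hbound z (hSD _ hz)
      rwa [← hξ z, mul_div_cancel_right₀ _ (hSD _ hz)] at this) z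
  rw [← hξ z, hzero, zero_mul]

end

section
open Polynomial

/-- The elementary symmetric functions of the conjugates of an element of a finite extension. -/
def conjEsymm (k E : Type*) {K : Type*} [Field k] [Field E] [Field K] [Algebra k K] [Algebra k E]
    [FiniteDimensional k K] (w : K) (j : ℕ) : E :=
  ∑ s ∈ (Finset.univ : Finset (K →ₐ[k] E)).powersetCard j, ∏ σ ∈ s, σ w

section
variable {k K E : Type*} [Field k] [Field E] [Field K] [Algebra k K] [Algebra k E]
    [FiniteDimensional k K]

theorem conjEsymm_zero (w : K) : conjEsymm k E w 0 = 1 := by simp [conjEsymm]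

theorem aeval_esymm_eq_conjEsymm (w : K) (j : ℕ) :
    MvPolynomial.aeval (fun σ : K →ₐ[k] E => σ w) (MvPolynomial.esymm (K →ₐ[k] E) k j) =
      conjEsymm k E w j := by
  simp [MvPolynomial.esymm, conjEsymm, map_sum, map_prod]

theorem conjEsymm_smul (a : k) (w : K) (j : ℕ) :
    conjEsymm k E (a • w) j = algebraMap k E a ^ j * conjEsymm k E w j := by
  rw [conjEsymm, conjEsymm, Finset.mul_sum]
  refine Finset.sum_congr rfl fun s hs => ?_
  simp only [Algebra.smul_def, map_mul, AlgHom.commutes, Finset.prod_mul_distrib,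
    Finset.prod_const, (Finset.mem_powersetCard.1 hs).2]

theorem mul_conjEsymm_eq_sum [IsAlgClosed E] [Algebra.IsSeparable k K] (w : K) (j : ℕ) :
    (j : E) * conjEsymm k E w j = (-1) ^ (j + 1) *
      ∑ a ∈ Finset.HasAntidiagonal.antidiagonal j with a.1 < j, (-1) ^ a.1 * conjEsymm k E w a.1 *
        algebraMap k E (Algebra.trace k K (w ^ a.2)) := by
  have h := congrArg (MvPolynomial.aeval (fun σ : K →ₐ[k] E => σ w))
    (MvPolynomial.mul_esymm_eq_sum (K →ₐ[k] E) k j)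
  simp only [map_mul, map_sum, map_pow, map_neg, map_one, map_natCast,
    aeval_esymm_eq_conjEsymm, MvPolynomial.psum, MvPolynomial.aeval_X] at h
  rw [h]
  simp only [trace_eq_sum_embeddings E, map_pow]

theorem pow_finrank_add_sum_conjEsymm [IsAlgClosed E] [Algebra.IsSeparable k K] (w : K)
    (τ : K →ₐ[k] E) :
    τ w ^ Module.finrank k K + ∑ j ∈ Finset.Icc 1 (Module.finrank k K),
      (-1) ^ j * conjEsymm k E w j * τ w ^ (Module.finrank k K - j) = 0 := by
  set s : Multiset E := (Finset.univ : Finset (K →ₐ[k] E)).val.map fun σ => σ w with hs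
  have hcard : Multiset.card s = Module.finrank k K := by
    rw [hs, Multiset.card_map, Finset.card_val, Finset.card_univ, AlgHom.card]
  have h := congrArg (eval (τ w)) (Multiset.prod_X_sub_X_eq_sum_esymm s)
  have he : ∀ j, s.esymm j = conjEsymm k E w j := fun j => by
    rw [hs, Finset.esymm_map_val, conjEsymm]
  rw [eval_multiset_prod, Multiset.prod_eq_zero] at h
  · rw [hcard, eval_finsetSum, Finset.sum_range_eq_add_Ico _ (Nat.succ_pos _)] at h
    rw [h, Nat.succ_eq_add_one]
    simp [he, conjEsymm_zero, mul_assoc, Finset.Ico_add_one_right_eq_Icc]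
  · simp only [Multiset.map_map, Multiset.mem_map]
    exact ⟨τ w, Multiset.mem_map.2 ⟨τ, Finset.mem_univ _, rfl⟩, by simp⟩

theorem exists_mem_ideal_conjEsymm {A : Type*} [CommRing A] [Algebra A k] [IsAlgClosed E]
    [Algebra.IsSeparable k K] [CharZero E] (hA : ∀ n : ℕ, n ≠ 0 → IsUnit (n : A)) (I : Ideal A) {w : K}
    (hw : ∀ i, 1 ≤ i → ∃ a ∈ I, algebraMap A k a = Algebra.trace k K (w ^ i)) {j : ℕ} (hj : 1 ≤ j) :
    ∃ a ∈ I, algebraMap k E (algebraMap A k a) = conjEsymm k E w j := by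
  induction j using Nat.strong_induction_on with
  | _ j ih =>
  obtain ⟨u, hu⟩ := hA j (by omega)
  have key : ∀ a ∈ (Finset.HasAntidiagonal.antidiagonal j).filter (fun a => a.1 < j), ∃ b ∈ I,
      algebraMap k E (algebraMap A k b) = (-1) ^ a.1 * conjEsymm k E w a.1 *
        algebraMap k E (Algebra.trace k K (w ^ a.2)) := by
    intro a ha
    rw [Finset.mem_filter, Finset.HasAntidiagonal.mem_antidiagonal] at ha
    obtain ⟨b, hb, hb'⟩ := hw a.2 (by omega)
    rcases Nat.eq_zero_or_pos a.1 with h0 | h0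
    · exact ⟨b, hb, by rw [h0, conjEsymm_zero, hb']; simp⟩
    · obtain ⟨c, hc, hc'⟩ := ih a.1 ha.2 h0
      exact ⟨(-1) ^ a.1 * c * b, I.mul_mem_left _ hb, by simp [hc', hb']⟩
  choose! b hbI hb using key
  refine ⟨↑u⁻¹ * ((-1) ^ (j + 1) * ∑ a ∈ (Finset.HasAntidiagonal.antidiagonal j).filter (fun a => a.1 < j), b a),
    I.mul_mem_left _ (I.mul_mem_left _ (I.sum_mem hbI)), ?_⟩
  have hj0 : (j : E) ≠ 0 := by exact_mod_cast (by omega : j ≠ 0)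
  have h1 := mul_conjEsymm_eq_sum (k := k) (E := E) w j
  rw [← Finset.sum_congr rfl hb] at h1
  have hu' : algebraMap k E (algebraMap A k (↑u⁻¹ : A)) * j = 1 := by
    have := congrArg (fun a => algebraMap k E (algebraMap A k a)) (Units.inv_mul u)
    simpa [hu] using this
  refine mul_left_cancel₀ hj0 ?_
  rw [h1, map_mul, map_mul, ← mul_assoc, mul_comm (j : E), hu', one_mul]
  simp

theorem exists_algebraMap_eq_conjEsymm [IsAlgClosed E] [Algebra.IsSeparable k K] [CharZero E]
    (w : K) (j : ℕ) : ∃ a : k, algebraMap k E a = conjEsymm k E w j := by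
  rcases Nat.eq_zero_or_pos j with rfl | hj
  · exact ⟨1, by rw [conjEsymm_zero, map_one]⟩
  have : CharZero k := (algebraMap k E).charZero
  obtain ⟨a, -, ha⟩ := exists_mem_ideal_conjEsymm (k := k) (A := k) (E := E) (w := w)
    (fun n hn => (Nat.cast_ne_zero.2 hn).isUnit) ⊤
    (fun i _ => ⟨Algebra.trace k K (w ^ i), trivial, rfl⟩) hj
  exact ⟨a, ha⟩
end
end

section
open Polynomial

theorem exists_mul_add_mul_eq_one {S K : Type*} [CommRing S] [IsDedekindDomain S] [Field K]
    [Algebra S K] [IsFractionRing S K] (w : K) :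
    ∃ x y : S, algebraMap S K x + algebraMap S K y * w = 1 ∧
      (∃ x' : S, algebraMap S K x' = algebraMap S K x * w) ∧
      ∃ y' : S, algebraMap S K y' = algebraMap S K y * w := by
  set I : FractionalIdeal (nonZeroDivisors S) K := 1 + FractionalIdeal.spanSingleton _ w with hI
  have h1 : (1 : K) ∈ I :=
    (FractionalIdeal.mem_add _ _ _).2 ⟨1, FractionalIdeal.one_mem_one _, 0,
      FractionalIdeal.zero_mem _, by simp⟩
  have hw : w ∈ I :=
    (FractionalIdeal.mem_add _ _ _).2 ⟨0, FractionalIdeal.zero_mem _, w,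
      FractionalIdeal.mem_spanSingleton_self _ _, by simp⟩
  have hI0 : I ≠ 0 := fun h => by rw [h, FractionalIdeal.mem_zero_iff] at h1; exact one_ne_zero h1
  have h : (1 : K) ∈ I * I⁻¹ := by
    rw [mul_inv_cancel₀ hI0]; exact FractionalIdeal.one_mem_one _
  rw [hI, add_mul, one_mul, FractionalIdeal.mem_add] at h
  obtain ⟨x, hx, z, hz, hxz⟩ := h
  obtain ⟨y, hy, rfl⟩ := FractionalIdeal.mem_singleton_mul.1 hz
  rw [← hI, FractionalIdeal.mem_inv_iff hI0] at hx hy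
  obtain ⟨x₁, hx₁⟩ := (FractionalIdeal.mem_one_iff _).1 (hx 1 h1)
  obtain ⟨y₁, hy₁⟩ := (FractionalIdeal.mem_one_iff _).1 (hy 1 h1)
  rw [mul_one] at hx₁ hy₁
  refine ⟨x₁, y₁, by rw [hx₁, hy₁, ← hxz]; ring, ?_, ?_⟩
  · rw [hx₁]; exact (FractionalIdeal.mem_one_iff _).1 (hx w hw)
  · rw [hy₁]; exact (FractionalIdeal.mem_one_iff _).1 (hy w hw)

theorem exists_one_sub_mul_eq {A S : Type*} [CommRing A] [CommRing S] [Algebra A S] {r : S}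
    (hr : IsIntegral A r) (s : A) :
    ∃ (c : A) (y : S), algebraMap A S (1 - s * c) = (1 - algebraMap A S s * r) * y := by
  obtain ⟨p, hp, hpr⟩ := hr
  set I := Ideal.span {1 - algebraMap A S s * r}
  let π := Ideal.Quotient.mk I
  have hsr : π (algebraMap A S s) * π r = 1 := by
    rw [← map_mul, ← map_one π, eq_comm]
    exact Ideal.Quotient.eq.2 (Ideal.mem_span_singleton_self _)
  let _ : Invertible (π r) := ⟨π (algebraMap A S s), hsr, by rw [mul_comm, hsr]⟩
  have h := eval₂_reverse_mul_pow (π.comp (algebraMap A S)) (π r) p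
  rw [← hom_eval₂, hpr, map_zero] at h
  have h' : π (algebraMap A S (p.reverse.eval s)) = 0 := by
    have : eval₂ (π.comp (algebraMap A S)) (⅟(π r)) p.reverse =
        π (algebraMap A S (p.reverse.eval s)) := by
      rw [← eval₂_hom, hom_eval₂]
      rfl
    rw [this] at h
    have := congrArg (· * π (algebraMap A S s) ^ p.natDegree) h
    simpa [mul_assoc, ← mul_pow, mul_comm (π r), hsr] using this
  obtain ⟨y, hy⟩ := Ideal.mem_span_singleton'.1 (Ideal.Quotient.eq_zero_iff_mem.1 h')
  refine ⟨-p.reverse.divX.eval s, y, ?_⟩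
  have h1 := congrArg (eval s) (divX_mul_X_add p.reverse)
  rw [coeff_zero_reverse, hp.leadingCoeff, eval_add, eval_mul, eval_X, eval_C] at h1
  rw [mul_comm _ y, hy, ← h1]
  congr 1
  ring

variable {A k K : Type*} (E : Type*) [CommRing A] [IsDedekindDomain A] [Field k] [Field K] [Field E]
  [Algebra A k] [IsFractionRing A k] [Algebra k K] [Algebra A K] [IsScalarTower A k K]
  [FiniteDimensional k K]

variable [Algebra.IsSeparable k K] [Algebra k E] [IsAlgClosed E] [CharZero E]

theorem exists_conjEsymm_mul_mem (hA : ∀ n : ℕ, n ≠ 0 → IsUnit (n : A)) {s : A} (hs : s ≠ 0) {φ : K}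
    (hφ : ∀ x : K, IsIntegral A x → ∃ a : A, algebraMap A k a = Algebra.trace k K (φ * x)) :
    ∃ c : A, ∀ j, 1 ≤ j → ∀ e : k, algebraMap k E e = conjEsymm k E φ j →
      ∃ a : A, algebraMap A k a = algebraMap A k ((1 - s * c) ^ j * s ^ (j - 1)) * e := by
  have : IsDedekindDomain (integralClosure A K) := integralClosure.isDedekindDomain A k K
  have : IsFractionRing (integralClosure A K) K :=
    integralClosure.isFractionRing_of_finite_extension k K
  set w : K := algebraMap A K s * φ with hw
  -- traces of powers of an integral multiple of `w` are divisible by `s`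
  have htr : ∀ u : K, IsIntegral A u → IsIntegral A (u * w) → ∀ i, 1 ≤ i →
      ∃ a ∈ Ideal.span {s}, algebraMap A k a = Algebra.trace k K ((u * w) ^ i) := by
    intro u hu huw i hi
    obtain ⟨b, hb⟩ := hφ (u * (u * w) ^ (i - 1)) (hu.mul (huw.pow _))
    refine ⟨s * b, Ideal.mul_mem_right _ _ (Ideal.mem_span_singleton_self s), ?_⟩
    obtain ⟨i, rfl⟩ := Nat.exists_eq_add_of_le' hi
    have : (u * w) ^ (i + 1) = algebraMap A k s • (φ * (u * (u * w) ^ (i + 1 - 1))) := by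
      rw [Algebra.smul_def, ← IsScalarTower.algebraMap_apply, Nat.add_sub_cancel, pow_succ]
      simp only [hw]; ring
    rw [this, map_smul, ← hb, smul_eq_mul, map_mul]
  obtain ⟨x, y, hxy, ⟨x', hx'⟩, y', hy'⟩ :=
    exists_mul_add_mul_eq_one (S := integralClosure A K) w
  have hv : ∃ r : integralClosure A K, y' ^ Module.finrank k K = algebraMap A _ s * r := by
    have hesymm := fun j hj => exists_mem_ideal_conjEsymm (E := E) hA (Ideal.span {s})
      (htr _ y.2 (by rw [show (y : K) * w = y' from hy'.symm]; exact y'.2)) (j := j) hj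
    simp only [Ideal.mem_span_singleton] at hesymm
    choose! b hb hb' using hesymm
    choose! b₁ hb₁ using hb
    obtain ⟨τ⟩ : Nonempty (K →ₐ[k] E) := ⟨IsAlgClosed.lift⟩
    have h := pow_finrank_add_sum_conjEsymm (y * w) τ
    refine ⟨-∑ j ∈ Finset.Icc 1 (Module.finrank k K),
      (-1) ^ j * algebraMap A _ (b₁ j) * y' ^ (Module.finrank k K - j), ?_⟩
    have hy'' : (y' : K) = y * w := hy'
    refine Subtype.ext ((τ : K →+* E).injective ?_)
    rw [← hy''] at h
    rw [RingHom.coe_coe, SubmonoidClass.coe_pow, map_pow, eq_neg_of_add_eq_zero_left h, mul_neg, Finset.mul_sum]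
    have hτ : ∀ a : A, τ (algebraMap A K a) = algebraMap k E (algebraMap A k a) := fun a => by
      rw [IsScalarTower.algebraMap_apply A k K, AlgHom.commutes]
    push_cast
    rw [map_neg, map_sum]
    congr 1
    refine Finset.sum_congr rfl fun j hj => ?_
    have hj1 := (Finset.mem_Icc.1 hj).1
    rw [hy'', ← hb' j hj1, hb₁ j hj1]
    simp only [map_mul, map_pow, hτ]
    simp only [map_neg, map_one]
    ring
  obtain ⟨r, hr⟩ := hv
  obtain ⟨c, z, hcz⟩ := exists_one_sub_mul_eq (A := A) (Algebra.IsIntegral.isIntegral r) s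
  have hint : IsIntegral A (algebraMap A K (1 - s * c) * w) := by
    have h1 : algebraMap A K (1 - s * c) * w =
        ((x' * (∑ i ∈ Finset.range (Module.finrank k K), y' ^ i) * z : integralClosure A K) : K) := by
      have : algebraMap A K (1 - s * c) = (algebraMap A (integralClosure A K) (1 - s * c) : K) := rfl
      rw [this, hcz, ← hr, ← mul_neg_geom_sum]
      have h2 : (x' : K) = x * w := hx'
      have h3 : (y' : K) = y * w := hy'
      have h4 : (1 - y' : K) = x := by rw [h3, ← hxy]; exact add_sub_cancel_right _ _
      push_cast
      rw [h2, h4]; ring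
    rw [h1]
    exact Subtype.prop _
  refine ⟨c, fun j hj e he => ?_⟩
  obtain ⟨a, ha, ha'⟩ := exists_mem_ideal_conjEsymm (E := E) hA (Ideal.span {s})
    (htr _ isIntegral_algebraMap hint) hj
  obtain ⟨a, rfl⟩ := Ideal.mem_span_singleton.1 ha
  refine ⟨a, ?_⟩
  have hsk : algebraMap A k s ≠ 0 := by simpa using hs
  have h1 : algebraMap A K (1 - s * c) * w = algebraMap A k ((1 - s * c) * s) • φ := by
    rw [Algebra.smul_def, ← IsScalarTower.algebraMap_apply, hw, map_mul, mul_assoc]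
  rw [h1, conjEsymm_smul, ← he, ← map_pow, ← map_mul] at ha'
  refine mul_left_cancel₀ hsk ?_
  rw [← map_mul, (algebraMap k E).injective ha', ← mul_assoc]
  congr 1
  obtain ⟨j, rfl⟩ := Nat.exists_eq_add_of_le' hj
  rw [← map_mul, ← map_pow, Nat.add_sub_cancel, mul_pow]
  congr 1
  ring
end

section
open Polynomial

section
variable {F K : Type*} [Field F] [Field K] [Algebra F K]

theorem aeval_inv_reflect {t : K} (ht : t ≠ 0) {M : ℕ} {p : F[X]} (hp : p.natDegree ≤ M) :
    aeval t⁻¹ (reflect M p) * t ^ M = aeval t p := by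
  let _ : Invertible t := invertibleOfNonzero ht
  have := eval₂_reflect_mul_pow (algebraMap F K) t M p hp
  rwa [invOf_eq_inv] at this

theorem natDegree_le_of_aeval_eq_aeval_inv {t : K} (ht : Transcendental F t) {p q : F[X]} {m : ℕ}
    (h : aeval t p = aeval t⁻¹ q * t ^ m) : p.natDegree ≤ m := by
  have ht0 : t ≠ 0 := by rintro rfl; exact ht isAlgebraic_zero
  have h1 : aeval t (X ^ q.natDegree * p) = aeval t (X ^ m * reflect q.natDegree q) := by
    have := aeval_inv_reflect (inv_ne_zero ht0) (le_refl q.natDegree)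
    rw [inv_inv] at this
    simp only [map_mul, map_pow, aeval_X]
    rw [h, ← this, inv_pow]
    field_simp
  have h2 := congrArg natDegree (transcendental_iff_injective.1 ht h1)
  by_cases hp : p = 0
  · simp [hp]
  have hr : reflect q.natDegree q ≠ 0 := by
    rintro h0
    rw [h0, mul_zero, natDegree_zero, natDegree_X_pow_mul _ hp] at h2
    have : p = 0 := by
      have h3 := transcendental_iff_injective.1 ht h1
      rw [h0, mul_zero] at h3
      exact (mul_eq_zero.1 h3).resolve_left (pow_ne_zero _ X_ne_zero)
    exact hp this
  rw [natDegree_X_pow_mul _ hp, natDegree_X_pow_mul _ hr] at h2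
  have := natDegree_reflect_le (N := q.natDegree) (p := q)
  rw [max_self] at this
  omega

variable (F) in
/-- The integral closure of `F[t]` in `K`. -/
def integralOver (t : K) : Subalgebra F K where
  carrier := {x | ((aeval t : F[X] →ₐ[F] K) : F[X] →+* K).IsIntegralElem x}
  mul_mem' hx hy := hx.mul _ hy
  add_mem' hx hy := hx.add _ hy
  algebraMap_mem' r := by
    have := RingHom.isIntegralElem_map ((aeval t : F[X] →ₐ[F] K) : F[X] →+* K) (x := C r)
    simpa using this

theorem mem_integralOver {t x : K} : x ∈ integralOver F t ↔
    ((aeval t : F[X] →ₐ[F] K) : F[X] →+* K).IsIntegralElem x := Iff.rfl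

theorem aeval_mem_integralOver (t : K) (p : F[X]) : aeval t p ∈ integralOver F t :=
  RingHom.isIntegralElem_map ((aeval t : F[X] →ₐ[F] K) : F[X] →+* K)

theorem self_mem_integralOver (t : K) : t ∈ integralOver F t := by
  simpa using aeval_mem_integralOver (F := F) t X

theorem mem_integralOver_of_coeff {t x : K} {p : K[X]} (hp : p.Monic) (hx : p.eval x = 0)
    (h : ∀ i < p.natDegree, ∃ a : F[X], aeval t a = p.coeff i) : x ∈ integralOver F t := by
  have hl : p ∈ lifts ((aeval t : F[X] →ₐ[F] K) : F[X] →+* K) := by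
    rw [lifts_iff_coeff_lifts]
    intro i
    rcases lt_trichotomy i p.natDegree with hi | rfl | hi
    · exact h i hi
    · exact ⟨1, by simp [hp.leadingCoeff]⟩
    · exact ⟨0, by simp [coeff_eq_zero_of_natDegree_lt hi]⟩
  obtain ⟨q, hq, -, hqm⟩ := lifts_and_natDegree_eq_and_monic hl hp
  exact ⟨q, hqm, by rw [← eval_map, hq, hx]⟩

theorem exists_inv_pow_mul_mem_integralOver_inv {t x : K} (ht : t ≠ 0) (hx : x ∈ integralOver F t) :
    ∃ N : ℕ, ∀ n ≥ N, t⁻¹ ^ n * x ∈ integralOver F t⁻¹ := by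
  obtain ⟨p, hp, hpx⟩ := hx
  refine ⟨p.support.sup fun i => (p.coeff i).natDegree, fun n hn => ?_⟩
  set q := p.map ((aeval t : F[X] →ₐ[F] K) : F[X] →+* K) with hq
  have hqm : q.Monic := hp.map _
  have hdeg : q.natDegree = p.natDegree := hp.natDegree_map _
  refine mem_integralOver_of_coeff (p := q.scaleRoots (t⁻¹ ^ n))
    ((monic_scaleRoots_iff _).2 hqm) ?_ fun i hi => ?_
  · rw [← eval_map] at hpx
    simpa [eval₂_id] using scaleRoots_eval₂_eq_zero (RingHom.id K) (p := q) (s := t⁻¹ ^ n)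
      (r := x) (by simpa [eval₂_id] using hpx)
  · rw [natDegree_scaleRoots] at hi
    have hdi : (p.coeff i).natDegree ≤ n * (q.natDegree - i) := by
      by_cases h0 : i ∈ p.support
      · calc _ ≤ n := (Finset.le_sup (f := fun i => (p.coeff i).natDegree) h0).trans hn
          _ ≤ _ := Nat.le_mul_of_pos_right _ (by omega)
      · rw [notMem_support_iff.1 h0]; simp
    refine ⟨reflect (n * (q.natDegree - i)) (p.coeff i), ?_⟩
    rw [coeff_scaleRoots, hq, coeff_map, RingHom.coe_coe, ← aeval_inv_reflect ht hdi, ← hq, mul_assoc,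
      ← pow_mul, ← mul_pow, mul_inv_cancel₀ ht, one_pow, mul_one]
end
end

section
open Polynomial

theorem exists_trace_mul_eq {A k K : Type*} [CommRing A] [IsDomain A] [Field k] [Field K]
    [Algebra A k] [IsFractionRing A k] [Algebra k K] [Algebra A K] [IsScalarTower A k K]
    [FiniteDimensional k K] [Algebra.IsSeparable k K] (l : integralClosure A K →ₗ[A] k) :
    ∃ φ : K, ∀ y : integralClosure A K, Algebra.trace k K (φ * y) = l y := by
  have := IsIntegralClosure.isLocalization A k K (integralClosure A K)
  let f := (IsScalarTower.toAlgHom A (integralClosure A K) K).toLinearMap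
  have hf : IsLocalizedModule (nonZeroDivisors A) f := inferInstance
  have hu : ∀ x : nonZeroDivisors A, IsUnit ((algebraMap A (Module.End A k)) x) := fun x =>
    IsLocalizedModule.map_units (Algebra.linearMap A k) x
  let l₁ : K →ₗ[A] k := IsLocalizedModule.lift (nonZeroDivisors A) f l hu
  let l₂ : K →ₗ[k] k := LinearMap.extendScalarsOfIsLocalization (nonZeroDivisors A) k l₁
  refine ⟨((Algebra.traceForm k K).toDual (traceForm_nondegenerate k K)).symm l₂, fun y => ?_⟩
  rw [← Algebra.traceForm_apply, LinearMap.BilinForm.apply_toDual_symm_apply]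
  exact IsLocalizedModule.lift_apply (nonZeroDivisors A) f l hu y

theorem isFractionRing_of_transcendental {F k : Type*} [Field F] [Field k] [Algebra F k] {t : k}
    (ht : Transcendental F t) (hgen : ∀ y : k, ∃ p q : F[X], y = aeval t p / aeval t q) :
    @IsFractionRing F[X] _ k _ (aeval t : F[X] →ₐ[F] k).toRingHom.toAlgebra := by
  let _ : Algebra F[X] k := (aeval t : F[X] →ₐ[F] k).toRingHom.toAlgebra
  have : FaithfulSMul F[X] k :=
    (faithfulSMul_iff_algebraMap_injective _ _).2 (transcendental_iff_injective.1 ht)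
  exact IsFractionRing.of_field _ _ hgen

section
variable {F k K : Type*} [Field F] [Field k] [Field K] [Algebra F k] [Algebra F K] [Algebra k K]
  [IsScalarTower F k K] [FiniteDimensional k K] [Algebra.IsSeparable k K]

theorem exists_principal_parts {t : K} (ht : t ≠ 0) (lam : K →ₗ[F] F)
    (h0 : ∀ x ∈ integralOver F t, lam x = 0) (h1 : ∀ x ∈ integralOver F t⁻¹, lam x = 0) :
    ∃ P : K → F[X], ∀ y ∈ integralOver F t,
      (∀ i, (P y).coeff i = lam (t⁻¹ ^ (i + 1) * y)) ∧ ∀ p : F[X], P (aeval t p * y) = p * P y := by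
  have hex : ∀ y ∈ integralOver F t, ∃ P : F[X], ∀ i, P.coeff i = lam (t⁻¹ ^ (i + 1) * y) := by
    intro y hy
    obtain ⟨N, hN⟩ := exists_inv_pow_mul_mem_integralOver_inv ht hy
    refine ⟨∑ i ∈ Finset.range N, monomial i (lam (t⁻¹ ^ (i + 1) * y)), fun i => ?_⟩
    simp only [finsetSum_coeff, coeff_monomial, Finset.sum_ite_eq', Finset.mem_range]
    split_ifs with hi
    · rfl
    · exact (h1 _ (hN _ (by omega))).symm
  choose! P hP using hex
  refine ⟨P, fun y hy => ⟨hP y hy, fun p => ?_⟩⟩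
  have hm : ∀ p : F[X], aeval t p * y ∈ integralOver F t := fun p =>
    mul_mem (aeval_mem_integralOver t p) hy
  induction p using Polynomial.induction_on with
  | C a =>
    ext i
    rw [hP _ (hm _), coeff_C_mul, hP y hy, aeval_C, mul_left_comm, ← Algebra.smul_def, map_smul,
      smul_eq_mul]
  | add p q hp hq =>
    ext i
    rw [hP _ (hm _), add_mul, coeff_add, ← hp, ← hq, hP _ (hm _), hP _ (hm _), map_add, add_mul,
      mul_add, map_add]
  | monomial n a ih =>
    have : (C a * X ^ (n + 1) : F[X]) * P y = X * P (aeval t (C a * X ^ n) * y) := by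
      rw [ih]; ring
    rw [this]
    ext i
    rw [hP _ (hm _)]
    rcases i with - | i
    · rw [coeff_X_mul_zero, ← h0 _ (hm (C a * X ^ n))]
      congr 1
      simp only [map_mul, map_pow, aeval_X, pow_succ]
      field_simp
    · rw [coeff_X_mul, hP _ (hm _)]
      congr 1
      simp only [map_mul, map_pow, aeval_X, pow_succ]
      field_simp

theorem exists_trace_mul_mem {t : k} (ht : Transcendental F t)
    (hgen : ∀ y : k, ∃ p q : F[X], y = aeval t p / aeval t q) {x₀ : K} {n : ℕ}
    (hx₀ : algebraMap k K t ^ n * x₀ ∈ integralOver F (algebraMap k K t))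
    (hx₀' : x₀ ∉ Subalgebra.toSubmodule (integralOver F (algebraMap k K t)) ⊔
      Subalgebra.toSubmodule (integralOver F (algebraMap k K t)⁻¹)) :
    ∃ φ : K, φ ≠ 0 ∧
      (∀ x ∈ integralOver F (algebraMap k K t), ∃ p : F[X],
        aeval t p = Algebra.trace k K (φ * x)) ∧
      ∀ x ∈ integralOver F (algebraMap k K t)⁻¹, ∃ p : F[X],
        aeval t⁻¹ p = Algebra.trace k K (algebraMap k K (t ^ 2) * φ * x) := by
  have ht0 : t ≠ 0 := by rintro rfl; exact ht isAlgebraic_zero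
  set T := algebraMap k K t with hT
  have hT0 : T ≠ 0 := by simpa [hT] using ht0
  obtain ⟨lam, hlam, hker⟩ := Submodule.exists_le_ker_of_notMem hx₀'
  have h0 : ∀ x ∈ integralOver F T, lam x = 0 := fun x hx => hker (Submodule.mem_sup_left hx)
  have h1 : ∀ x ∈ integralOver F T⁻¹, lam x = 0 := fun x hx => hker (Submodule.mem_sup_right hx)
  obtain ⟨P, hP⟩ := exists_principal_parts hT0 lam h0 h1
  let _ : Algebra F[X] k := (aeval t : F[X] →ₐ[F] k).toRingHom.toAlgebra
  let _ : Algebra F[X] K := (aeval T : F[X] →ₐ[F] K).toRingHom.toAlgebra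
  have : IsFractionRing F[X] k := isFractionRing_of_transcendental ht hgen
  have : IsScalarTower F[X] k K := .of_algebraMap_eq fun p => aeval_algebraMap_apply K t p
  let l : integralClosure F[X] K →ₗ[F[X]] k :=
    { toFun := fun y => aeval t (P y)
      map_add' := fun x y => by
        rw [← map_add]
        congr 1
        ext i
        rw [coeff_add, (hP _ x.2).1, (hP _ y.2).1, (hP _ (x + y).2).1, ← map_add, ← mul_add]
        rfl
      map_smul' := fun p y => by
        have : ((p • y : integralClosure F[X] K) : K) = aeval T p * y := Algebra.smul_def p (y : K)
        rw [this, (hP _ y.2).2, map_mul, RingHom.id_apply, Algebra.smul_def]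
        rfl }
  obtain ⟨φ, hφ⟩ := exists_trace_mul_eq l
  have hφ' : ∀ y ∈ integralOver F T, Algebra.trace k K (φ * y) = aeval t (P y) :=
    fun y hy => hφ ⟨y, hy⟩
  refine ⟨φ, ?_, fun x hx => ⟨P x, (hφ' x hx).symm⟩, fun x hx => ?_⟩
  · rintro rfl
    have h2 := hφ' _ hx₀
    rw [zero_mul, map_zero, eq_comm, ← map_zero (aeval t : F[X] →ₐ[F] k)] at h2
    have h3 := transcendental_iff_injective.1 ht h2
    rcases n with - | n
    · rw [pow_zero, one_mul] at hx₀
      exact hlam (h0 _ hx₀)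
    · refine hlam ?_
      have := (hP _ hx₀).1 n
      rw [h3, coeff_zero] at this
      rw [this]
      congr 1
      rw [← mul_assoc, ← mul_pow, inv_mul_cancel₀ hT0, one_pow, one_mul]
  · obtain ⟨N, hN⟩ := exists_inv_pow_mul_mem_integralOver_inv (inv_ne_zero hT0) hx
    rw [inv_inv] at hN
    have hy := hN (N + 2) (by omega)
    have hdeg : (P (T ^ (N + 2) * x)).natDegree ≤ N := by
      rw [natDegree_le_iff_coeff_eq_zero]
      intro i hi
      rw [(hP _ hy).1]
      refine h1 _ ?_
      have : T⁻¹ ^ (i + 1) * (T ^ (N + 2) * x) = T⁻¹ ^ (i - (N + 1)) * x := by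
        obtain ⟨j, rfl⟩ := Nat.exists_eq_add_of_lt hi
        rw [show N + j + 1 - (N + 1) = j by omega]
        rw [show N + j + 1 + 1 = j + (N + 2) by ring, pow_add, mul_assoc, ← mul_assoc (T⁻¹ ^ (N + 2)),
          ← mul_pow, inv_mul_cancel₀ hT0, one_pow, one_mul]
      rw [this]
      exact mul_mem (pow_mem (self_mem_integralOver _) _) hx
    refine ⟨reflect N (P (T ^ (N + 2) * x)), ?_⟩
    have h4 := hφ' _ hy
    have h5 : φ * (T ^ (N + 2) * x) = t ^ (N + 2) • (φ * x) := by
      rw [Algebra.smul_def, map_pow]; ring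
    rw [← aeval_inv_reflect ht0 hdeg, h5, map_smul, smul_eq_mul] at h4
    rw [mul_assoc, ← Algebra.smul_def, map_smul, smul_eq_mul]
    refine mul_right_cancel₀ (pow_ne_zero N ht0) ?_
    rw [← h4]
    ring
end
end

section
open Polynomial

section
variable {F k : Type*} [Field F] [Field k] [Algebra F k]

theorem exists_aeval_inv_div_aeval_inv {t : k} (ht0 : t ≠ 0) (hgen : ∀ y : k, ∃ p q : F[X], y = aeval t p / aeval t q)
    (y : k) : ∃ p q : F[X], y = aeval t⁻¹ p / aeval t⁻¹ q := by
  obtain ⟨p, q, rfl⟩ := hgen y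
  have h1 := aeval_inv_reflect ht0 (le_max_left p.natDegree q.natDegree)
  have h2 := aeval_inv_reflect ht0 (le_max_right p.natDegree q.natDegree)
  exact ⟨_, _, by rw [← h1, ← h2, mul_div_mul_right _ _ (pow_ne_zero _ ht0)]⟩

end

section
variable {F k K : Type*} [Field F] [Field k] [Field K] [Algebra F k] [Algebra F K] [Algebra k K]
  [IsScalarTower F k K] [FiniteDimensional k K] [CharZero F]

theorem exists_conjEsymm_mul_aeval (E : Type*) [Field E] [Algebra k E] [IsAlgClosed E] [CharZero E]
    [Algebra.IsSeparable k K] {t : k} (ht : Transcendental F t)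
    (hgen : ∀ y : k, ∃ p q : F[X], y = aeval t p / aeval t q) {φ : K}
    (hφ : ∀ x ∈ integralOver F (algebraMap k K t), ∃ p : F[X],
      aeval t p = Algebra.trace k K (φ * x)) {s : F[X]} (hs : s ≠ 0) :
    ∃ c : F[X], ∀ j, 1 ≤ j → ∀ e : k, algebraMap k E e = conjEsymm k E φ j →
      ∃ a : F[X], aeval t a = aeval t ((1 - s * c) ^ j * s ^ (j - 1)) * e := by
  let _ : Algebra F[X] k := (aeval t : F[X] →ₐ[F] k).toRingHom.toAlgebra
  let _ : Algebra F[X] K := (aeval (algebraMap k K t) : F[X] →ₐ[F] K).toRingHom.toAlgebra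
  have : IsFractionRing F[X] k := isFractionRing_of_transcendental ht hgen
  have : IsScalarTower F[X] k K := .of_algebraMap_eq fun p => aeval_algebraMap_apply K t p
  refine exists_conjEsymm_mul_mem E (A := F[X]) (fun n hn => ?_) hs hφ
  rw [← map_natCast (C : F →+* F[X])]
  exact (isUnit_iff_ne_zero.2 (Nat.cast_ne_zero.2 hn)).map C

theorem exists_relation_of_trace {t : k} (ht : Transcendental F t)
    (hgen : ∀ y : k, ∃ p q : F[X], y = aeval t p / aeval t q) {φ : K} (hφ0 : φ ≠ 0)
    (hφ : ∀ x ∈ integralOver F (algebraMap k K t), ∃ p : F[X],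
      aeval t p = Algebra.trace k K (φ * x))
    (hφ' : ∀ x ∈ integralOver F (algebraMap k K t)⁻¹, ∃ p : F[X],
        aeval t⁻¹ p = Algebra.trace k K (algebraMap k K (t ^ 2) * φ * x)) :
    ∃ (D : F[X]) (N : ℕ → F[X]) (p : K), D ≠ 0 ∧ p ≠ 0 ∧
      p ^ Module.finrank k K + ∑ j ∈ Finset.Icc 1 (Module.finrank k K),
        aeval (algebraMap k K t) (N j * D ^ (j - 1)) * p ^ (Module.finrank k K - j) = 0 ∧
      (∀ b : F, ∃ (q : F[X]) (a : ℕ → F[X]), q.eval b ≠ 0 ∧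
        ∀ j ∈ Finset.Icc 1 (Module.finrank k K), q ^ j * (X - C b) ^ (j - 1) * N j = a j * D) ∧
      ∀ j ∈ Finset.Icc 1 (Module.finrank k K),
        N j = 0 ∨ (N j).natDegree + j + 1 ≤ D.natDegree := by
  have hk : CharZero k := charZero_of_injective_algebraMap (algebraMap F k).injective
  have ht0 : t ≠ 0 := by rintro rfl; exact ht isAlgebraic_zero
  let E := AlgebraicClosure k
  have hE : CharZero E := charZero_of_injective_algebraMap (algebraMap k E).injective
  have hinj := transcendental_iff_injective.1 ht
  choose c hc using exists_algebraMap_eq_conjEsymm (k := k) (E := E) φ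
  have ht' : Transcendental F t⁻¹ := fun h => ht (by simpa using h.inv)
  have hgen' := exists_aeval_inv_div_aeval_inv ht0 hgen
  have hden : ∃ (D : F[X]) (N : ℕ → F[X]), D ≠ 0 ∧ ∀ j ∈ Finset.Icc 1 (Module.finrank k K),
      aeval t (N j) = (-1) ^ j * c j * aeval t D := by
    let _ : Algebra F[X] k := (aeval t : F[X] →ₐ[F] k).toRingHom.toAlgebra
    have : IsFractionRing F[X] k := isFractionRing_of_transcendental ht hgen
    obtain ⟨D, hD⟩ := IsLocalization.exist_integer_multiples (nonZeroDivisors F[X])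
      (Finset.Icc 1 (Module.finrank k K)) fun j => (-1) ^ j * c j
    choose! N hN using hD
    refine ⟨D, N, nonZeroDivisors.ne_zero D.2, fun j hj => (hN j hj).trans ?_⟩
    exact (Algebra.smul_def (D : F[X]) ((-1) ^ j * c j)).trans (mul_comm _ _)
  obtain ⟨D, N, hD, hN⟩ := hden
  have hDt : aeval t D ≠ 0 := fun h => hD (hinj (by rw [h, map_zero]))
  have hDT : aeval (algebraMap k K t) D ≠ 0 := by
    rw [aeval_algebraMap_apply]; simpa using hDt
  refine ⟨D, N, aeval (algebraMap k K t) D * φ, hD, mul_ne_zero hDT hφ0, ?_, fun b => ?_,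
    fun j hj => ?_⟩
  · let τ : K →ₐ[k] E := IsAlgClosed.lift
    have h := pow_finrank_add_sum_conjEsymm φ τ
    have h2 : φ ^ Module.finrank k K + ∑ j ∈ Finset.Icc 1 (Module.finrank k K),
        algebraMap k K ((-1) ^ j * c j) * φ ^ (Module.finrank k K - j) = 0 := by
      apply (τ : K →+* E).injective
      rw [map_zero, ← h, map_add, map_pow, map_sum]
      congr 1
      refine Finset.sum_congr rfl fun j _ => ?_
      rw [map_mul, RingHom.coe_coe, AlgHom.commutes, map_mul, hc, map_pow, map_pow, map_neg, map_one]
    rw [mul_pow, ← mul_zero (aeval (algebraMap k K t) D ^ Module.finrank k K), ← h2, mul_add,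
      Finset.mul_sum]
    congr 1
    refine Finset.sum_congr rfl fun j hj => ?_
    rw [map_mul, aeval_algebraMap_apply K t (N j), hN j hj, map_mul, ← aeval_algebraMap_apply,
      map_pow, mul_pow]
    obtain ⟨h1, h2⟩ := Finset.mem_Icc.1 hj
    obtain ⟨i, rfl⟩ := Nat.exists_eq_add_of_le h1
    rw [show Module.finrank k K = (Module.finrank k K - (1 + i)) + (1 + i) by omega]
    rw [show 1 + i - 1 = i by omega, show Module.finrank k K - (1 + i) + (1 + i) - (1 + i)
      = Module.finrank k K - (1 + i) by omega]
    ring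
  · obtain ⟨q, hq⟩ := exists_conjEsymm_mul_aeval E ht hgen hφ (X_sub_C_ne_zero b)
    choose! a ha using fun j hj => hq j hj (c j) (hc j)
    refine ⟨1 - (X - C b) * q, fun j => (-1) ^ j * a j, by simp, fun j hj => hinj ?_⟩
    have h1 := (Finset.mem_Icc.1 hj).1
    rw [map_mul, hN j hj, mul_assoc, map_mul _ _ D, map_mul _ _ (a j), ha j h1]
    simp only [map_pow, map_neg, map_one]
    ring
  · obtain ⟨u, hu⟩ := exists_conjEsymm_mul_aeval E ht' hgen' (φ := t ^ 2 • φ)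
      (by simpa only [map_inv₀, Algebra.smul_def] using hφ') X_ne_zero
    obtain ⟨a, ha⟩ := hu j (Finset.mem_Icc.1 hj).1 ((t ^ 2) ^ j * c j)
      (by rw [conjEsymm_smul, map_mul, map_pow, hc])
    refine or_iff_not_imp_left.2 fun hNj => ?_
    set U : F[X] := (1 - X * u) ^ j with hU
    have hU0 : U.coeff 0 = 1 := by
      rw [coeff_zero_eq_eval_zero, hU]; simp
    have hV := aeval_inv_reflect (F := F) ht0 (le_refl U.natDegree)
    set V := reflect U.natDegree U with hVdef
    have hVU : V.coeff U.natDegree = 1 := by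
      rw [hVdef, coeff_reflect, revAt_le le_rfl, Nat.sub_self, hU0]
    have hV0 : V ≠ 0 := fun h => by simp [h] at hVU
    have hVd : U.natDegree ≤ V.natDegree := le_natDegree_of_ne_zero (by simp [hVU])
    have hDr := aeval_inv_reflect (F := F) ht0 (le_refl D.natDegree)
    have key : aeval t (V * X ^ (j + 1) * N j) =
        aeval t⁻¹ ((-1) ^ j * a * reflect D.natDegree D) * t ^ (U.natDegree + D.natDegree) := by
      have hVt : aeval t V = aeval t⁻¹ U * t ^ U.natDegree := by
        have := aeval_inv_reflect (F := F) (inv_ne_zero ht0) (le_refl U.natDegree)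
        rw [inv_inv] at this
        rw [← this, inv_pow, mul_assoc, inv_mul_cancel₀ (pow_ne_zero _ ht0), mul_one]
      have hj1 := (Finset.mem_Icc.1 hj).1
      have hpow : t⁻¹ ^ (j - 1) * (t ^ 2) ^ j = t ^ (j + 1) := by
        obtain ⟨i, rfl⟩ := Nat.exists_eq_add_of_le hj1
        rw [show 1 + i - 1 = i by omega, ← pow_mul, show 2 * (1 + i) = i + (1 + i + 1) by ring,
          pow_add, ← mul_assoc, ← mul_pow, inv_mul_cancel₀ ht0, one_pow, one_mul]
      simp only [map_mul, map_pow, map_neg, map_one, aeval_X] at ha ⊢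
      rw [ha, hN j hj, hVt, ← hDr, ← hpow, pow_add, hU]
      simp only [map_mul, map_pow, map_sub, map_one, aeval_X]
      ring
    have hdeg := natDegree_le_of_aeval_eq_aeval_inv ht key
    rw [natDegree_mul (mul_ne_zero hV0 (pow_ne_zero _ X_ne_zero)) hNj,
      natDegree_mul hV0 (pow_ne_zero _ X_ne_zero), natDegree_X_pow] at hdeg
    omega
end
end

section
open Polynomial

section
variable {F K : Type*} [Field F] [Field K] [Algebra F K]

theorem exists_inv_mul_mem_integralOver_inv {T : K} (hT : T ≠ 0) {y : K} (hy : y ∈ integralOver F T)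
    (hyp : ∀ p : F[X], aeval T p ≠ y)
    (hall : ∀ x n, T ^ n * x ∈ integralOver F T →
      x ∈ Subalgebra.toSubmodule (integralOver F T) ⊔ Subalgebra.toSubmodule (integralOver F T⁻¹)) :
    ∃ e ∈ integralOver F T, (∀ p : F[X], aeval T p ≠ e) ∧ T⁻¹ * e ∈ integralOver F T⁻¹ := by
  classical
  have hex : ∃ N, ∃ y ∈ integralOver F T, (∀ p : F[X], aeval T p ≠ y) ∧
      T⁻¹ ^ N * y ∈ integralOver F T⁻¹ := by
    obtain ⟨N, hN⟩ := exists_inv_pow_mul_mem_integralOver_inv hT hy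
    exact ⟨N, y, hy, hyp, hN N le_rfl⟩
  obtain ⟨y, hy, hyp, hyN⟩ := Nat.find_spec hex
  have hmin := fun m => Nat.find_min hex (m := m)
  generalize Nat.find hex = N at hyN hmin
  rcases N with - | - | m
  · rw [pow_zero, one_mul] at hyN
    exact ⟨y, hy, hyp, mul_mem (self_mem_integralOver _) hyN⟩
  · rw [zero_add, pow_one] at hyN
    exact ⟨y, hy, hyp, hyN⟩
  · have hx : T ^ (m + 1) * (T⁻¹ ^ (m + 1) * y) = y := by
      rw [← mul_assoc, ← mul_pow, mul_inv_cancel₀ hT, one_pow, one_mul]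
    obtain ⟨r, hr, r', hr', hrr⟩ := Submodule.mem_sup.1 (hall (T⁻¹ ^ (m + 1) * y) (m + 1)
      (by rwa [hx]))
    rw [Subalgebra.mem_toSubmodule] at hr hr'
    by_cases hrp : ∃ p : F[X], aeval T p = r
    · obtain ⟨p, rfl⟩ := hrp
      refine absurd ⟨y - T ^ (m + 1) * aeval T p, sub_mem hy (mul_mem (pow_mem
        (self_mem_integralOver _) _) (aeval_mem_integralOver _ _)), fun q hq => ?_, ?_⟩
        (hmin (m + 1) (by omega))
      · refine hyp (q + X ^ (m + 1) * p) ?_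
        rw [map_add, hq, map_mul, map_pow, aeval_X]; ring
      · rw [mul_sub, ← mul_assoc _ (T ^ (m + 1)), ← mul_pow, inv_mul_cancel₀ hT, one_pow, one_mul,
          ← hrr, add_sub_cancel_left]
        exact hr'
    · push Not at hrp
      refine ⟨r, hr, hrp, ?_⟩
      have : T⁻¹ * r = T⁻¹ ^ (m + 1 + 1) * y - T⁻¹ * r' := by
        rw [eq_sub_iff_add_eq, ← mul_add, hrr]; ring
      rw [this]
      exact sub_mem hyN (mul_mem (self_mem_integralOver _) hr')
end
end

section
open Polynomial IntermediateField

section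
variable {F k K : Type*} [Field F] [Field k] [Field K] [Algebra F k] [Algebra F K] [Algebra k K]
  [IsScalarTower F k K]

theorem exists_aeval_eq_coeff_minpoly {t : k} (ht : Transcendental F t)
    (hgen : ∀ y : k, ∃ p q : F[X], y = aeval t p / aeval t q) {e : K}
    (he : e ∈ integralOver F (algebraMap k K t)) :
    ∃ A : F[X][X], A.Monic ∧ A.map ((aeval t : F[X] →ₐ[F] k) : F[X] →+* k) = minpoly k e := by
  let _ : Algebra F[X] k := (aeval t : F[X] →ₐ[F] k).toRingHom.toAlgebra
  let _ : Algebra F[X] K := (aeval (algebraMap k K t) : F[X] →ₐ[F] K).toRingHom.toAlgebra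
  have : IsFractionRing F[X] k := isFractionRing_of_transcendental ht hgen
  have : IsScalarTower F[X] k K := .of_algebraMap_eq fun p => aeval_algebraMap_apply K t p
  have he' : IsIntegral F[X] e := he
  exact ⟨minpoly F[X] e, minpoly.monic he', (minpoly.isIntegrallyClosed_eq_field_fractions' k he').symm⟩

theorem exists_monic_coeff_natDegree_le [FiniteDimensional k K] {t : k} (ht : Transcendental F t)
    (hgen : ∀ y : k, ∃ p q : F[X], y = aeval t p / aeval t q) {e : K}
    (he : e ∈ integralOver F (algebraMap k K t))
    (he' : (algebraMap k K t)⁻¹ * e ∈ integralOver F (algebraMap k K t)⁻¹) :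
    ∃ A : F[X][X], A.Monic ∧ A.map ((aeval t : F[X] →ₐ[F] k) : F[X] →+* k) = minpoly k e ∧
      ∀ i ≤ A.natDegree, (A.coeff i).natDegree ≤ A.natDegree - i := by
  have ht0 : t ≠ 0 := by rintro rfl; exact ht isAlgebraic_zero
  obtain ⟨A, hA, hAe⟩ := exists_aeval_eq_coeff_minpoly ht hgen he
  refine ⟨A, hA, hAe, fun i hi => ?_⟩
  have ht' : Transcendental F t⁻¹ := fun h => ht (by simpa using h.inv)
  rw [← map_inv₀] at he'
  obtain ⟨B, hB, hBe⟩ := exists_aeval_eq_coeff_minpoly ht' (exists_aeval_inv_div_aeval_inv ht0 hgen) he'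
  rw [← Algebra.smul_def, IsIntegrallyClosed.minpoly_smul (inv_ne_zero ht0) (.of_finite k e), ← hAe] at hBe
  have h := congrArg (fun p => p.coeff i) hBe
  simp only [coeff_scaleRoots, coeff_map, hA.natDegree_map, RingHom.coe_coe] at h
  refine natDegree_le_of_aeval_eq_aeval_inv ht (q := B.coeff i) ?_
  rw [h, mul_assoc, ← mul_pow, inv_mul_cancel₀ ht0, one_pow, mul_one]
end

section
variable {F K : Type*} [Field F] [Field K] [Algebra F K]

theorem adjoin_simple_generated (t : K) (y : F⟮t⟯) : ∃ p q : F[X],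
    y = aeval (AdjoinSimple.gen F t) p / aeval (AdjoinSimple.gen F t) q := by
  obtain ⟨p, q, h⟩ := (mem_adjoin_simple_iff F (y : K)).1 y.2
  refine ⟨p, q, Subtype.ext ?_⟩
  rw [h, IntermediateField.coe_div]
  congr 1
  · exact (aeval_algebraMap_apply K (AdjoinSimple.gen F t) p)
  · exact (aeval_algebraMap_apply K (AdjoinSimple.gen F t) q)

theorem transcendental_gen {t : K} (ht : Transcendental F t) :
    Transcendental F (AdjoinSimple.gen F t) := fun h =>
  ht (h.algebraMap (A := K))

theorem transcendental_of_not_mem_range [IsAlgClosed F] {x : K} (hx : ∀ a : F, algebraMap F K a ≠ x) :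
    Transcendental F x := fun h => by
  obtain ⟨a, ha⟩ := minpoly.mem_range_of_degree_eq_one F x
    (IsAlgClosed.degree_eq_one_of_irreducible F (minpoly.irreducible h.isIntegral))
  exact hx a ha

theorem exists_finrank_lt [IsAlgClosed F] {t e : K} (ht : Transcendental F t)
    [FiniteDimensional F⟮t⟯ K] (he : e ∈ integralOver F t) (he' : t⁻¹ * e ∈ integralOver F t⁻¹)
    (hep : ∀ p : F[X], aeval t p ≠ e) :
    ∃ x ∈ integralOver F t, Transcendental F x ∧ FiniteDimensional F⟮x⟯ K ∧
      Module.finrank F⟮x⟯ K < Module.finrank F⟮t⟯ K := by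
  obtain ⟨A, hA, hAe, hdeg⟩ := exists_monic_coeff_natDegree_le (K := K) (transcendental_gen ht)
    (adjoin_simple_generated t) (e := e) he he'
  set d := A.natDegree with hd
  have hAd : (minpoly F⟮t⟯ e).natDegree = d := by rw [← hAe, hA.natDegree_map]
  have hd0 : 0 < d := by rw [← hAd]; exact minpoly.natDegree_pos (.of_finite _ e)
  -- the leading form of the relation between `t` and `e`
  let S : F[X] := ∑ i ∈ Finset.range (d + 1), C ((A.coeff i).coeff (d - i)) * X ^ i
  have hS : S.coeff d = 1 := by
    simp [S, hd, hA.coeff_natDegree]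
  obtain ⟨c, hc⟩ := IsAlgClosed.exists_root S fun h => by
    have := le_natDegree_of_ne_zero (p := S) (n := d) (by simp [hS])
    exact hd0.not_ge (this.trans (natDegree_eq_of_degree_eq_some h).le)
  set x := e - algebraMap F K c * t with hx
  have hxt : Transcendental F x := transcendental_of_not_mem_range fun a ha =>
    hep (C a + C c * X) (by simp [ha, hx])
  have hxR : x ∈ integralOver F t :=
    sub_mem he (mul_mem (Subalgebra.algebraMap_mem _ c) (self_mem_integralOver t))
  let x' := AdjoinSimple.gen F x
  let Q : F⟮x⟯[X] := ∑ i ∈ Finset.range (d + 1), (A.coeff i).map (algebraMap F F⟮x⟯) *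
    (C x' + C (algebraMap F F⟮x⟯ c) * X) ^ i
  have hlin : (C x' + C (algebraMap F F⟮x⟯ c) * X).natDegree ≤ 1 := by
    compute_degree
  have hQt : aeval t Q = 0 := by
    have h1 : aeval t (C x' + C (algebraMap F F⟮x⟯ c) * X) = e := by
      rw [map_add, map_mul, aeval_C, aeval_C, aeval_X, ← IsScalarTower.algebraMap_apply]
      change x + _ = e
      rw [hx]; ring
    have h2 := minpoly.aeval F⟮t⟯ e
    rw [← hAe, aeval_eq_sum_range, hA.natDegree_map] at h2
    rw [← h2, map_sum]
    refine Finset.sum_congr rfl fun i _ => ?_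
    rw [map_mul, map_pow, h1, coeff_map, Algebra.smul_def, aeval_map_algebraMap]
    congr 1
    exact aeval_algebraMap_apply K (AdjoinSimple.gen F t) (A.coeff i)
  have hQ0 : Q ≠ 0 := by
    intro h
    let S₀ : F[X] := ∑ i ∈ Finset.range (d + 1), C ((A.coeff i).coeff 0) * X ^ i
    have hS₀ : S₀.coeff d = 1 := by simp [S₀, hd, hA.coeff_natDegree]
    have h0 : aeval x' S₀ = 0 := by
      rw [← coeff_zero (R := F⟮x⟯) 0, ← h, coeff_zero_eq_eval_zero, eval_finsetSum, map_sum]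
      refine Finset.sum_congr rfl fun i _ => ?_
      rw [eval_mul, ← coeff_zero_eq_eval_zero, coeff_map]
      simp
    rw [(transcendental_iff.1 (transcendental_gen hxt)) S₀ h0, coeff_zero] at hS₀
    exact zero_ne_one hS₀
  have hle : ∀ i, ((C x' + C (algebraMap F F⟮x⟯ c) * X) ^ i).natDegree ≤ i := fun i => by
    simpa using natDegree_pow_le_of_le i hlin
  have hA' : ∀ i ∈ Finset.range (d + 1),
      ((A.coeff i).map (algebraMap F F⟮x⟯)).natDegree ≤ d - i := fun i hi =>
    natDegree_map_le.trans (hdeg i (Finset.mem_range_succ_iff.1 hi))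
  have hQle : Q.natDegree ≤ d := natDegree_sum_le_of_forall_le _ _ fun i hi =>
    (natDegree_mul_le_of_le (hA' i hi) (hle i)).trans
      (Nat.sub_add_cancel (Finset.mem_range_succ_iff.1 hi)).le
  have hQc : Q.coeff d = 0 := by
    have : Q.coeff d = algebraMap F F⟮x⟯ (S.eval c) := by
      rw [finsetSum_coeff, eval_finsetSum, map_sum]
      refine Finset.sum_congr rfl fun i hi => ?_
      conv_lhs => rw [← Nat.sub_add_cancel (Finset.mem_range_succ_iff.1 hi)]
      rw [coeff_mul_add_eq_of_natDegree_le (hA' i hi) (hle i), coeff_map]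
      have := coeff_pow_of_natDegree_le (m := i) hlin
      rw [mul_one] at this
      simp [this]
    rw [this, hc, map_zero]
  have hQd : Q.natDegree < d := lt_of_le_of_ne hQle fun h =>
    hQ0 (leadingCoeff_eq_zero.1 (by rw [leadingCoeff, h, hQc]))
  have hint : IsIntegral F⟮x⟯ t := IsAlgebraic.isIntegral ⟨Q, hQ0, hQt⟩
  have hlt : Module.finrank F⟮x⟯ F⟮x⟯⟮t⟯ < Module.finrank F⟮t⟯ F⟮t⟯⟮e⟯ := by
    rw [adjoin.finrank hint, adjoin.finrank (.of_finite _ e), hAd]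
    exact (natDegree_le_of_dvd (minpoly.dvd _ _ hQt) hQ0).trans_lt hQd
  have hM : F⟮x⟯⟮t⟯.restrictScalars F = F⟮t⟯⟮e⟯.restrictScalars F := by
    rw [adjoin_simple_adjoin_simple, adjoin_simple_adjoin_simple]
    apply le_antisymm <;> rw [adjoin_le_iff, Set.insert_subset_iff, Set.singleton_subset_iff]
    · have h1 := subset_adjoin F {t, e} (Set.mem_insert t _)
      exact ⟨sub_mem (subset_adjoin F {t, e} (by simp))
        (mul_mem (_root_.algebraMap_mem _ c) h1), h1⟩
    · have h1 := subset_adjoin F {x, t} (Set.mem_insert_of_mem x rfl)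
      refine ⟨h1, ?_⟩
      have : e = x + algebraMap F K c * t := by rw [hx]; ring
      rw [this]
      exact add_mem (subset_adjoin F {x, t} (by simp)) (mul_mem (_root_.algebraMap_mem _ c) h1)
  have hfin : Module.finrank F⟮x⟯⟮t⟯ K = Module.finrank F⟮t⟯⟮e⟯ K := by
    change Module.finrank (F⟮x⟯⟮t⟯.restrictScalars F) K = Module.finrank (F⟮t⟯⟮e⟯.restrictScalars F) K
    rw [hM]
  have h1 := Module.finrank_mul_finrank F⟮x⟯ F⟮x⟯⟮t⟯ K
  have h2 := Module.finrank_mul_finrank F⟮t⟯ F⟮t⟯⟮e⟯ K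
  have h3 : 0 < Module.finrank F⟮t⟯⟮e⟯ K := Module.finrank_pos
  have h4 : 0 < Module.finrank F⟮x⟯ F⟮x⟯⟮t⟯ := by
    rw [adjoin.finrank hint]; exact minpoly.natDegree_pos hint
  rw [hfin] at h1
  refine ⟨x, hxR, hxt, .of_finrank_pos (by rw [← h1]; positivity), ?_⟩
  rw [← h1, ← h2]
  exact Nat.mul_lt_mul_of_pos_right hlt h3
end
end

section
open Polynomial IntermediateField

section
variable {F K : Type*} [Field F] [Field K] [Algebra F K]

theorem exists_mem_integralOver_ne_aeval {t : K} (ht : Transcendental F t)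
    [FiniteDimensional F⟮t⟯ K] (hd : 1 < Module.finrank F⟮t⟯ K) :
    ∃ y ∈ integralOver F t, ∀ p : F[X], aeval t p ≠ y := by
  let _ : Algebra F[X] F⟮t⟯ := (aeval (AdjoinSimple.gen F t) : F[X] →ₐ[F] F⟮t⟯).toRingHom.toAlgebra
  let _ : Algebra F[X] K := (aeval t : F[X] →ₐ[F] K).toRingHom.toAlgebra
  have : IsFractionRing F[X] F⟮t⟯ :=
    isFractionRing_of_transcendental (transcendental_gen ht) (adjoin_simple_generated t)
  have : IsScalarTower F[X] F⟮t⟯ K :=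
    .of_algebraMap_eq fun p => aeval_algebraMap_apply K (AdjoinSimple.gen F t) p
  obtain ⟨y, hy⟩ : ∃ y : K, y ∉ F⟮t⟯ := by
    by_contra! h
    have h1 : F⟮t⟯ = ⊤ := eq_top_iff.2 fun y _ => h y
    rw [h1, IntermediateField.finrank_top] at hd
    exact lt_irrefl _ hd
  have hy' : IsAlgebraic F[X] y :=
    (IsFractionRing.isAlgebraic_iff F[X] F⟮t⟯ K).2 (.of_finite F⟮t⟯ y)
  obtain ⟨z, hz, hzy⟩ := hy'.exists_integral_multiple
  rw [Algebra.smul_def] at hzy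
  refine ⟨aeval t z * y, hzy, fun p hp => hy ?_⟩
  have hz0 : aeval t z ≠ 0 := fun h => hz (transcendental_iff.1 ht z h)
  rw [mem_adjoin_simple_iff]
  exact ⟨p, z, by rw [hp, mul_div_cancel_left₀ _ hz0]⟩

theorem exists_finrank_lt_or_relation [IsAlgClosed F] [CharZero F] {t : K} (ht : Transcendental F t)
    [FiniteDimensional F⟮t⟯ K] (hd : 1 < Module.finrank F⟮t⟯ K) :
    (∃ x ∈ integralOver F t, Transcendental F x ∧ FiniteDimensional F⟮x⟯ K ∧
      Module.finrank F⟮x⟯ K < Module.finrank F⟮t⟯ K) ∨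
    ∃ (D : F[X]) (N : ℕ → F[X]) (p : K), D ≠ 0 ∧ p ≠ 0 ∧
      p ^ Module.finrank F⟮t⟯ K + ∑ j ∈ Finset.Icc 1 (Module.finrank F⟮t⟯ K),
        aeval t (N j * D ^ (j - 1)) * p ^ (Module.finrank F⟮t⟯ K - j) = 0 ∧
      (∀ b : F, ∃ (q : F[X]) (a : ℕ → F[X]), q.eval b ≠ 0 ∧
        ∀ j ∈ Finset.Icc 1 (Module.finrank F⟮t⟯ K),
          q ^ j * (X - C b) ^ (j - 1) * N j = a j * D) ∧
      ∀ j ∈ Finset.Icc 1 (Module.finrank F⟮t⟯ K),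
        N j = 0 ∨ (N j).natDegree + j + 1 ≤ D.natDegree := by
  have ht0 : t ≠ 0 := by rintro rfl; exact ht isAlgebraic_zero
  by_cases hall : ∀ x n, t ^ n * x ∈ integralOver F t →
      x ∈ Subalgebra.toSubmodule (integralOver F t) ⊔ Subalgebra.toSubmodule (integralOver F t⁻¹)
  · obtain ⟨y, hy, hyp⟩ := exists_mem_integralOver_ne_aeval ht hd
    obtain ⟨e, he, hep, he'⟩ := exists_inv_mul_mem_integralOver_inv ht0 hy hyp hall
    exact .inl (exists_finrank_lt ht he he' hep)
  · push Not at hall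
    obtain ⟨x₀, n, hx₀, hx₀'⟩ := hall
    have : CharZero F⟮t⟯ := charZero_of_injective_algebraMap (algebraMap F F⟮t⟯).injective
    obtain ⟨φ, hφ0, hφ, hφ'⟩ := exists_trace_mul_mem (K := K) (transcendental_gen ht)
      (adjoin_simple_generated t) (x₀ := x₀) (n := n) hx₀ hx₀'
    exact .inr (exists_relation_of_trace (transcendental_gen ht) (adjoin_simple_generated t)
      hφ0 hφ hφ')
end
end

section
open Filter Metric Topology

section
variable {E : Type*} [NormedAddCommGroup E] [NormedSpace ℂ E]

theorem dist_add_smul_sub_add_smul_sub (b x y : E) (s : ℂ) :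
    dist (x + s • (b - x)) (y + s • (b - y)) = ‖1 - s‖ * dist x y := by
  rw [dist_eq_norm, dist_eq_norm, ← norm_smul]
  congr 1
  module

theorem differentiableAt_circleAverage_comp_line [FiniteDimensional ℂ E] {w : E → ℂ} {b z₀ : E}
    {r : ℝ} (hr : 0 ≤ r) {U : Set E} (hU : IsOpen U) (hw : DifferentiableOn ℂ w U)
    (hK : ∀ s ∈ sphere (0 : ℂ) r, z₀ + s • (b - z₀) ∈ U) :
    DifferentiableAt ℂ (fun z => Real.circleAverage (fun s : ℂ => w (z + s • (b - z))) 0 r) z₀ := by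
  borelize E
  have : ProperSpace E := FiniteDimensional.proper ℂ E
  set L : E → ℝ → E := fun z θ => z + circleMap 0 r θ • (b - z) with hL
  have hLc : ∀ z, Continuous (L z) := fun z =>
    continuous_const.add ((continuous_circleMap 0 r).smul continuous_const)
  have hs : ∀ θ, circleMap 0 r θ ∈ sphere (0 : ℂ) r := circleMap_mem_sphere 0 hr
  have hLd : ∀ x y θ, dist (L x θ) (L y θ) ≤ (1 + r) * dist x y := fun x y θ => by
    rw [dist_add_smul_sub_add_smul_sub]
    gcongr
    refine (norm_sub_le _ _).trans ?_
    rw [norm_one, mem_sphere_zero_iff_norm.1 (hs θ)]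
  set K : Set E := (fun s : ℂ => z₀ + s • (b - z₀)) '' sphere (0 : ℂ) r with hKdef
  have hKc : IsCompact K := (isCompact_sphere _ _).image (by fun_prop)
  have hKU : K ⊆ U := by rintro _ ⟨s, hs, rfl⟩; exact hK s hs
  have hLK : ∀ θ, L z₀ θ ∈ K := fun θ => ⟨_, hs θ, rfl⟩
  obtain ⟨C, hC⟩ := hKc.exists_bound_of_continuousOn (hw.continuousOn.mono hKU)
  set V : Set E := U ∩ w ⁻¹' ball 0 (C + 1) with hV
  have hVo : IsOpen V := hw.continuousOn.isOpen_inter_preimage hU isOpen_ball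
  have hKV : K ⊆ V := fun x hx => ⟨hKU hx, by
    rw [Set.mem_preimage, mem_ball_zero_iff]; linarith [hC x hx]⟩
  obtain ⟨δ, hδ, hδV⟩ := hKc.exists_cthickening_subset_open hVo hKV
  have hball : ∀ θ, ball (L z₀ θ) δ ⊆ V := fun θ =>
    (ball_subset_thickening (hLK θ) δ).trans ((thickening_subset_cthickening _ _).trans hδV)
  set η : ℝ := δ / 4 / (1 + r) with hη
  have hη0 : 0 < η := by positivity
  have hLη : ∀ x ∈ ball z₀ η, ∀ θ, dist (L x θ) (L z₀ θ) < δ / 4 := fun x hx θ =>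
    (hLd x z₀ θ).trans_lt (by
      have : (1 + r) * dist x z₀ < (1 + r) * η := by gcongr; exact hx
      rwa [hη, mul_div_cancel₀ _ (by positivity)] at this)
  have hcont : ∀ x ∈ ball z₀ η, Continuous fun θ => w (L x θ) := fun x hx =>
    hw.continuousOn.comp_continuous (hLc x) fun θ =>
      (hball θ ((hLη x hx θ).trans (by linarith))).1
  have hmeas : Measurable fun θ : ℝ => (1 - circleMap 0 r θ) • fderiv ℂ w (L z₀ θ) :=
    (measurable_const.sub (continuous_circleMap 0 r).measurable).smul
      ((measurable_fderiv ℂ w).comp (hLc z₀).measurable)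
  have key := (intervalIntegral.hasFDerivAt_integral_of_dominated_loc_of_lip
    (μ := MeasureTheory.volume) (a := 0) (b := 2 * Real.pi) (𝕜 := ℂ) (x₀ := z₀)
    (F := fun z θ => w (L z θ)) (F' := fun θ => (1 - circleMap 0 r θ) • fderiv ℂ w (L z₀ θ))
    (bound := fun _ => 2 * (C + 1) / (δ / 2) * (1 + r))
    (ball_mem_nhds z₀ hη0)
    (by filter_upwards [ball_mem_nhds z₀ hη0] with x hx using (hcont x hx).aestronglyMeasurable)
    ((hcont z₀ (mem_ball_self hη0)).intervalIntegrable _ _)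
    hmeas.aestronglyMeasurable ?_ intervalIntegrable_const ?_).2.differentiableAt
  · exact key.const_smul (2 * Real.pi)⁻¹
  · refine .of_forall fun θ _ => LipschitzOnWith.of_dist_le_mul fun x hx y hy => ?_
    have hsub : ball (L y θ) (δ / 2) ⊆ V := fun u hu => hball θ <| by
      have := dist_triangle u (L y θ) (L z₀ θ)
      rw [mem_ball] at hu ⊢
      linarith [hLη y hy θ]
    have hC0 : 0 < C + 1 := by
      have := (hKV (hLK 0)).2
      rw [Set.mem_preimage, mem_ball_zero_iff] at this
      exact (norm_nonneg _).trans_lt this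
    have hxy : L x θ ∈ ball (L y θ) (δ / 2) := by
      have := dist_triangle_right (L x θ) (L y θ) (L z₀ θ)
      rw [mem_ball]
      linarith [hLη y hy θ, hLη x hx θ]
    refine (Complex.dist_le_div_mul_dist_of_mapsTo_ball (R₂ := 2 * (C + 1))
      (hw.mono fun u hu => (hsub hu).1) (fun u hu => ?_) hxy).trans ?_
    · have h1 := (hsub hu).2
      have h2 := (hsub (mem_ball_self (by positivity))).2
      rw [Set.mem_preimage, mem_ball] at h1 h2
      rw [mem_closedBall]
      linarith [dist_triangle_right (w u) (w (L y θ)) 0]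
    · rw [Real.coe_nnabs, abs_of_nonneg (by positivity), mul_assoc]
      gcongr
      exact hLd x y θ
  · refine .of_forall fun θ _ => ?_
    have h1 : HasFDerivAt (fun z => L z θ) ((1 - circleMap 0 r θ) • ContinuousLinearMap.id ℂ E) z₀ := by
      have h : (fun z => L z θ) = fun z => ((1 - circleMap 0 r θ) • ContinuousLinearMap.id ℂ E) z
          + circleMap 0 r θ • b := by
        ext z
        simp only [hL, smul_apply, ContinuousLinearMap.id_apply]
        module
      rw [h]
      exact (ContinuousLinearMap.hasFDerivAt _).add_const _
    have h2 := (hw.differentiableAt (hU.mem_nhds (hKU (hLK θ)))).hasFDerivAt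
    have h3 := h2.comp z₀ h1
    rw [ContinuousLinearMap.comp_smul, ContinuousLinearMap.comp_id] at h3
    exact h3
end
end

section
open Filter Metric Topology

theorem eventually_ne_zero_of_differentiable {Q : ℂ → ℂ} (hQ : Differentiable ℂ Q) {s₁ : ℂ}
    (h : Q s₁ ≠ 0) (s₀ : ℂ) : ∀ᶠ s in 𝓝[≠] s₀, Q s ≠ 0 := by
  refine (hQ.analyticAt s₀).eventually_eq_zero_or_eventually_ne_zero.resolve_left fun h0 => h ?_
  have := AnalyticOnNhd.eq_of_eventuallyEq (f := Q) (g := 0) (fun z _ => hQ.analyticAt z)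
    (fun z _ => analyticAt_const) h0
  rw [this, Pi.zero_apply]

section
variable {E : Type*} [NormedAddCommGroup E] [NormedSpace ℂ E]

theorem Differentiable.comp_line {p : E → ℂ} (hp : Differentiable ℂ p) (b z : E) :
    Differentiable ℂ fun s : ℂ => p (z + s • (b - z)) := by
  fun_prop

theorem exists_differentiable_quotient [FiniteDimensional ℂ E] {p q : E → ℂ}
    (hp : Differentiable ℂ p) (hq : Differentiable ℂ q) {b : E} (hb : q b ≠ 0)
    (hpq : ∀ z, ∃ C, ∀ᶠ x in 𝓝 z, ‖p x‖ ≤ C * ‖q x‖) :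
    ∃ h : E → ℂ, Differentiable ℂ h ∧ ∀ z, h z * q z = p z := by
  have hQ0 : ∀ z s₀, ∀ᶠ s in 𝓝[≠] s₀, q (z + s • (b - z)) ≠ 0 := fun z =>
    eventually_ne_zero_of_differentiable (hq.comp_line b z) (s₁ := 1) (by simpa using hb)
  have hex : ∀ z, ∃ ξ : ℂ → ℂ, Differentiable ℂ ξ ∧
      ∀ s, ξ s * q (z + s • (b - z)) = p (z + s • (b - z)) := by
    intro z
    refine exists_entire_quotient (hp.comp_line b z) (hq.comp_line b z) (hQ0 z) fun s₀ => ?_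
    obtain ⟨C, hC⟩ := hpq (z + s₀ • (b - z))
    have hl : Tendsto (fun s : ℂ => z + s • (b - z)) (𝓝[≠] s₀) (𝓝 (z + s₀ • (b - z))) :=
      (Continuous.tendsto (by fun_prop) s₀).mono_left nhdsWithin_le_nhds
    refine squeeze_zero_norm' (a := fun s => ‖s - s₀‖ * C) ?_ ?_
    · filter_upwards [hl.eventually hC, hQ0 z s₀] with s hs hs0
      rw [norm_mul, norm_div]
      gcongr
      exact div_le_of_le_mul₀ (norm_nonneg _) (nonneg_of_mul_nonneg_left
        ((norm_nonneg _).trans hs) (norm_pos_iff.2 hs0)) hs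
    · have : Tendsto (fun s => ‖s - s₀‖ * C) (𝓝 s₀) (𝓝 (‖s₀ - s₀‖ * C)) :=
        Continuous.tendsto (by fun_prop) s₀
      rw [sub_self, norm_zero, zero_mul] at this
      exact this.mono_left nhdsWithin_le_nhds
  choose ξ hξd hξ using hex
  refine ⟨fun z => ξ z 0, fun z₀ => ?_, fun z => by simpa using hξ z 0⟩
  obtain ⟨ε, hε, hεq⟩ := mem_nhdsWithin_iff.1 (hQ0 z₀ 0)
  have hr : 0 < ε / 2 := by positivity
  have hU : IsOpen {z | q z ≠ 0} := isOpen_ne_fun hq.continuous continuous_const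
  have hK : ∀ s ∈ sphere (0 : ℂ) (ε / 2), z₀ + s • (b - z₀) ∈ {z | q z ≠ 0} := fun s hs =>
    hεq ⟨by rw [mem_ball, mem_sphere.1 hs]; linarith, ne_of_mem_sphere hs hr.ne'⟩
  refine (differentiableAt_circleAverage_comp_line (w := fun z => p z / q z) hr.le hU
    (fun z hz => by
      simp only [div_eq_mul_inv]
      exact ((hp z).fun_mul ((hq z).fun_inv hz)).differentiableWithinAt) hK).congr_of_eventuallyEq ?_
  have hev : ∀ᶠ z in 𝓝 z₀, ∀ s ∈ sphere (0 : ℂ) (ε / 2), q (z + s • (b - z)) ≠ 0 :=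
    (isCompact_sphere _ _).eventually_forall_of_forall_eventually fun s hs =>
      (Continuous.continuousAt (f := fun x : E × ℂ => q (x.1 + x.2 • (b - x.1)))
        (hq.continuous.comp (by fun_prop))).eventually_ne (hK s hs)
  filter_upwards [hev] with z hz
  rw [← circleAverage_of_differentiable_on_off_countable (c := 0) (R := ε / 2) Set.countable_empty
    (hξd z).continuous.continuousOn fun s _ => (hξd z) s]
  refine Real.circleAverage_congr_sphere fun s hs => ?_
  rw [abs_of_pos hr] at hs
  rw [eq_div_iff (hz s hs), hξ]
end
end

section
open Filter Metric Topology Polynomial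

section
variable {E : Type*} [NormedAddCommGroup E] [NormedSpace ℂ E]

variable (E) in
/-- The algebra of entire functions on a complex normed space. -/
def entireFunctions : Subalgebra ℂ (E → ℂ) where
  carrier := {f | Differentiable ℂ f}
  mul_mem' hf hg := Differentiable.mul hf hg
  add_mem' hf hg := Differentiable.add hf hg
  algebraMap_mem' c := differentiable_const c

theorem mem_entireFunctions {f : E → ℂ} : f ∈ entireFunctions E ↔ Differentiable ℂ f := Iff.rfl

theorem exists_mul_ne_zero_of_differentiable {f g : E → ℂ} (hf : Differentiable ℂ f)
    (hg : Differentiable ℂ g) {a b : E} (ha : f a ≠ 0) (hb : g b ≠ 0) :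
    ∃ z, f z ≠ 0 ∧ g z ≠ 0 := by
  have h1 := eventually_ne_zero_of_differentiable (hf.comp_line b a) (s₁ := 0) (by simpa) 0
  have h2 := eventually_ne_zero_of_differentiable (hg.comp_line b a) (s₁ := 1) (by simpa) 0
  obtain ⟨s, hs⟩ := (h1.and h2).exists
  exact ⟨_, hs⟩

instance : IsDomain (entireFunctions E) := by
  have : NoZeroDivisors (entireFunctions E) := by
    refine ⟨fun {f g} hfg => ?_⟩
    by_contra! h
    obtain ⟨a, ha⟩ := Function.ne_iff.1 fun h0 => h.1 (Subtype.ext h0)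
    obtain ⟨b, hb⟩ := Function.ne_iff.1 fun h0 => h.2 (Subtype.ext h0)
    obtain ⟨z, h1, h2⟩ := exists_mul_ne_zero_of_differentiable f.2 g.2 ha hb
    exact mul_ne_zero h1 h2 (congrFun (congrArg Subtype.val hfg) z)
  exact NoZeroDivisors.to_isDomain _

/-- Evaluation of entire functions at a point. -/
def entireFunctions.evalHom (z : E) : entireFunctions E →ₐ[ℂ] ℂ :=
  (Pi.evalAlgHom ℂ (fun _ : E => ℂ) z).comp (entireFunctions E).val

@[simp]
theorem entireFunctions.evalHom_apply (z : E) (f : entireFunctions E) :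
    entireFunctions.evalHom z f = f.1 z := rfl

theorem norm_le_of_monic_root {P : (entireFunctions E)[X]} (hP : P.Monic) (hd : 1 ≤ P.natDegree)
    {z : E} {p q : ℂ} (h : ∑ i ∈ Finset.range (P.natDegree + 1),
      (P.coeff i).1 z * q ^ (P.natDegree - i) * p ^ i = 0) :
    ‖p‖ ≤ (∑ j ∈ Finset.Icc 1 P.natDegree, (P.natDegree * ‖(P.coeff (P.natDegree - j)).1 z‖) ^
      (1 / (j : ℝ))) * ‖q‖ := by
  rw [Finset.sum_range_succ] at h
  have h1 : (P.coeff P.natDegree).1 z = 1 := by rw [hP.coeff_natDegree]; rfl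
  rw [h1, Nat.sub_self, pow_zero, one_mul, one_mul] at h
  have h2 : ∑ i ∈ Finset.range P.natDegree, (P.coeff i).1 z * q ^ (P.natDegree - i) * p ^ i =
      ∑ j ∈ Finset.Icc 1 P.natDegree, (P.coeff (P.natDegree - j)).1 z * q ^ j *
        p ^ (P.natDegree - j) := by
    refine Finset.sum_bij' (fun i _ => P.natDegree - i) (fun j _ => P.natDegree - j) ?_ ?_ ?_ ?_ ?_
    all_goals intro i hi; simp only [Finset.mem_range, Finset.mem_Icc] at hi ⊢
    any_goals omega
    rw [show P.natDegree - (P.natDegree - i) = i by omega]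
  rw [h2, add_comm] at h
  rcases eq_or_ne q 0 with rfl | hq
  · rw [Finset.sum_eq_zero, add_zero] at h
    · rw [pow_eq_zero_iff (by omega)] at h
      simp [h]
    · intro j hj
      rw [zero_pow (by have := Finset.mem_Icc.1 hj; omega)]
      ring
  · have := norm_le_sum_rpow_of_root hd (x := p / q)
      (c := fun j => (P.coeff (P.natDegree - j)).1 z) ?_
    · rwa [norm_div, div_le_iff₀ (norm_pos_iff.2 hq)] at this
    · have h3 : (p / q) ^ P.natDegree + ∑ j ∈ Finset.Icc 1 P.natDegree,
          (P.coeff (P.natDegree - j)).1 z * (p / q) ^ (P.natDegree - j) =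
          (p ^ P.natDegree + ∑ j ∈ Finset.Icc 1 P.natDegree,
          (P.coeff (P.natDegree - j)).1 z * q ^ j * p ^ (P.natDegree - j)) / q ^ P.natDegree := by
        rw [add_div, div_pow, Finset.sum_div]
        congr 1
        refine Finset.sum_congr rfl fun j hj => ?_
        rw [eq_div_iff (pow_ne_zero _ hq), div_pow]
        have := Finset.mem_Icc.1 hj
        obtain ⟨m, hm⟩ := Nat.exists_eq_add_of_le this.2
        rw [hm, Nat.add_sub_cancel_left, pow_add]
        field_simp
      rw [h3, h, zero_div]

instance [FiniteDimensional ℂ E] : IsIntegrallyClosed (entireFunctions E) := by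
  rw [isIntegrallyClosed_iff (FractionRing (entireFunctions E))]
  intro x hx
  obtain ⟨p, q, hq, rfl⟩ := IsFractionRing.div_surjective (A := entireFunctions E) x
  obtain ⟨P, hP, hPx⟩ := hx
  have hinj := IsFractionRing.injective (entireFunctions E) (FractionRing (entireFunctions E))
  have hs := scaleRoots_eval₂_eq_zero_of_eval₂_div_eq_zero hinj hPx hq
  rw [eval₂_hom, map_eq_zero_iff _ hinj] at hs
  have hq0 := nonZeroDivisors.ne_zero hq
  have hd : 1 ≤ P.natDegree := by
    by_contra! h
    rw [Nat.lt_one_iff] at h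
    rw [hP.natDegree_eq_zero.1 h, eval₂_one] at hPx
    exact one_ne_zero hPx
  obtain ⟨b, hb⟩ := Function.ne_iff.1 fun h0 => hq0 (Subtype.ext h0)
  have hrel : ∀ z, ∑ i ∈ Finset.range (P.natDegree + 1),
      (P.coeff i).1 z * q.1 z ^ (P.natDegree - i) * p.1 z ^ i = 0 := by
    intro z
    have := congrArg (entireFunctions.evalHom z) hs
    rw [eval_eq_sum_range, natDegree_scaleRoots] at this
    simpa [coeff_scaleRoots] using this
  obtain ⟨h, hh, hhq⟩ := exists_differentiable_quotient (p := p.1) (q := q.1) p.2 q.2 hb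
    fun z => by
      let c : E → ℝ := fun z => ∑ j ∈ Finset.Icc 1 P.natDegree,
        (P.natDegree * ‖(P.coeff (P.natDegree - j)).1 z‖) ^ (1 / (j : ℝ))
      have hc : Continuous c := by
        refine continuous_finsetSum _ fun j _ => Continuous.rpow_const ?_ fun _ => Or.inr (by positivity)
        exact continuous_const.mul (mem_entireFunctions.1 (P.coeff (P.natDegree - j)).2).continuous.norm
      refine ⟨c z + 1, ?_⟩
      filter_upwards [hc.continuousAt.eventually_lt_const (lt_add_one (c z))] with x hx
      exact (norm_le_of_monic_root hP hd (hrel x)).trans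
        (mul_le_mul_of_nonneg_right hx.le (norm_nonneg _))
  refine ⟨⟨h, hh⟩, ?_⟩
  rw [eq_div_iff (by simpa [map_eq_zero_iff _ hinj] using hq0), ← map_mul]
  exact congrArg _ (Subtype.ext (funext hhq))

theorem exists_differentiable_exp_eq {t : E → ℂ} (ht : Differentiable ℂ t) (h0 : ∀ z, t z ≠ 0) :
    ∃ H : E → ℂ, Differentiable ℂ H ∧ ∀ z, Complex.exp (H z) = t z := by
  have hc : ContractibleSpace (Set.univ : Set E) :=
    (convex_univ (𝕜 := ℝ)).contractibleSpace Set.univ_nonempty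
  have : IsSimplyConnected (Set.univ : Set E) := SimplyConnectedSpace.ofContractible _
  obtain ⟨H, hH, hHt⟩ := Complex.exists_continuousOn_eqOn_exp_comp this isOpen_univ
    ht.continuous.continuousOn (by simpa using h0)
  rw [continuousOn_univ] at hH
  have hHt : ∀ z, Complex.exp (H z) = t z := fun z => hHt (Set.mem_univ z)
  refine ⟨H, fun z₀ => ?_, hHt⟩
  obtain ⟨L, hL, hLe⟩ : ∃ L : ℂ → ℂ, DifferentiableAt ℂ L (Complex.exp (H z₀)) ∧
      ∀ᶠ x in 𝓝 (H z₀), L (Complex.exp x) = x :=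
    ⟨_, ((Complex.hasStrictDerivAt_exp (H z₀)).to_localInverse
      (Complex.exp_ne_zero _)).hasDerivAt.differentiableAt,
      ((Complex.hasStrictDerivAt_exp (H z₀)).hasStrictFDerivAt_equiv
        (Complex.exp_ne_zero _)).eventually_left_inverse⟩
  rw [hHt z₀] at hL
  refine (hL.comp z₀ (ht z₀)).congr_of_eventuallyEq ?_
  filter_upwards [hH.continuousAt.eventually hLe] with z hz
  rw [Function.comp_apply, ← hHt z]
  exact hz.symm
end
end

section
open Filter Metric Topology Polynomial

/-- Entire functions have no nonconstant solutions of the Fermat cubic with `B` zero-free. -/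
theorem deriv_eq_zero_of_cube_add_cube_eq_one {A B : ℂ → ℂ} (hA : Differentiable ℂ A)
    (hB : Differentiable ℂ B) (hB0 : ∀ z, B z ≠ 0) (h : ∀ z, A z ^ 3 + B z ^ 3 = 1)
    (hnc : ∀ z₀, ¬∀ᶠ z in 𝓝 z₀, A z = A z₀) (z : ℂ) : deriv A z = 0 := by
  let S : Finset ℂ := (X ^ 3 - 1 : ℂ[X]).roots.toFinset
  have hS : ∀ x, x ∈ S ↔ x ^ 3 = 1 := by
    intro x
    have : (X ^ 3 - 1 : ℂ[X]) ≠ 0 := (monic_X_pow_sub_C (1 : ℂ) three_ne_zero).ne_zero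
    simp [S, this, sub_eq_zero]
  have hξ : Differentiable ℂ fun z => deriv A z / B z ^ 2 :=
    hA.deriv.div (hB.pow 2) fun z => pow_ne_zero 2 (hB0 z)
  have key := eq_zero_of_dominated (S := S) (δ := 1 / 3) (G := A)
    (B := fun g => ‖1 - g ^ 3‖ ^ (-2 / 3 : ℝ)) ⟨1, (hS 1).2 (one_pow 3)⟩ (by norm_num)
    (by norm_num) (fun g => by positivity) ?_ ?_ ?_ hA hξ hnc ?_ z
  · exact (div_eq_zero_iff.1 key).resolve_right (pow_ne_zero 2 (hB0 z))
  · refine ContinuousOn.rpow_const (by fun_prop) fun x hx => Or.inl ?_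
    rw [norm_ne_zero_iff, sub_ne_zero]
    exact fun h => hx ((hS x).2 h.symm)
  · intro b hb
    rw [hS] at hb
    refine ⟨1, ?_⟩
    have hc : ContinuousAt (fun g => ‖g ^ 2 + g * b + b ^ 2‖) b := by fun_prop
    have hb1 : ‖b‖ = 1 := by
      have := congrArg norm hb
      rw [norm_pow, norm_one] at this
      exact (pow_eq_one_iff_of_nonneg (norm_nonneg _) three_ne_zero).1 this
    have h1 : 1 < ‖b ^ 2 + b * b + b ^ 2‖ := by
      rw [show b ^ 2 + b * b + b ^ 2 = 3 * b ^ 2 by ring, norm_mul, norm_pow, hb1]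
      norm_num
    filter_upwards [nhdsWithin_le_nhds (hc.eventually_const_lt h1), self_mem_nhdsWithin]
      with g hg hgb
    have hpos : 0 < ‖g - b‖ := norm_pos_iff.2 (sub_ne_zero.2 hgb)
    rw [one_mul, show (1 / 3 - 1 : ℝ) = -2 / 3 by norm_num]
    refine Real.rpow_le_rpow_of_nonpos hpos ?_ (by norm_num)
    rw [← hb, show b ^ 3 - g ^ 3 = -((g - b) * (g ^ 2 + g * b + b ^ 2)) by ring, norm_neg, norm_mul]
    exact le_mul_of_one_le_right hpos.le hg.le
  · refine ⟨1, ?_⟩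
    filter_upwards [tendsto_norm_cocompact_atTop.eventually_ge_atTop 2] with g hg
    rw [one_mul, show (-1 - 1 / 3 : ℝ) = 2 * (-2 / 3) by norm_num, Real.rpow_mul (norm_nonneg g)]
    refine Real.rpow_le_rpow_of_nonpos (by positivity) ?_ (by norm_num)
    have := norm_sub_norm_le (g ^ 3) 1
    rw [norm_sub_rev, norm_pow, norm_one] at this
    rw [Real.rpow_two]
    nlinarith [sq_nonneg ‖g‖]
  · intro z _
    have h1 : ‖1 - A z ^ 3‖ ^ (-2 / 3 : ℝ) = (‖B z‖ ^ 2)⁻¹ := by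
      rw [← h z, add_sub_cancel_left, norm_pow, ← Real.rpow_natCast, ← Real.rpow_mul (norm_nonneg _),
        ← Real.rpow_two, ← Real.rpow_neg (norm_nonneg _)]
      norm_num
    rw [h1, norm_div, norm_pow, div_eq_inv_mul]

theorem eq_of_omits_two_values {G : ℂ → ℂ} (hG : Differentiable ℂ G) {α β : ℂ} (hαβ : α ≠ β)
    (hα : ∀ z, G z ≠ α) (hβ : ∀ z, G z ≠ β) (x y : ℂ) : G x = G y := by
  have hs : β - α ≠ 0 := sub_ne_zero.2 hαβ.symm
  obtain ⟨H, hH, hHe⟩ := exists_differentiable_exp_eq (t := fun z => (G z - α) / (β - α))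
    (by fun_prop) fun z => div_ne_zero (sub_ne_zero.2 (hα z)) hs
  obtain ⟨K, hK, hKe⟩ := exists_differentiable_exp_eq (t := fun z => 1 - (G z - α) / (β - α))
    (by fun_prop) fun z => by
      rw [sub_ne_zero, ne_comm, Ne, div_eq_one_iff_eq hs, sub_left_inj]
      exact hβ z
  let A := fun z => Complex.exp (H z / 3)
  have hA : Differentiable ℂ A := (hH.div_const 3).cexp
  have h3 : ∀ w, Complex.exp (w / 3) ^ 3 = Complex.exp w := fun w => by
    rw [← Complex.exp_nat_mul]
    congr 1
    push_cast
    ring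
  suffices hAc : A x = A y by
    have : Complex.exp (H x) = Complex.exp (H y) := by
      rw [← h3 (H x), ← h3 (H y)]
      exact congrArg (· ^ 3) hAc
    rw [hHe, hHe, div_left_inj' hs, sub_left_inj] at this
    exact this
  by_cases hnc : ∀ z₀, ¬∀ᶠ z in 𝓝 z₀, A z = A z₀
  · exact is_const_of_deriv_eq_zero hA (deriv_eq_zero_of_cube_add_cube_eq_one hA
      (B := fun z => Complex.exp (K z / 3)) (hK.div_const 3).cexp (fun z => Complex.exp_ne_zero _)
      (fun z => by rw [h3, h3, hHe, hKe, add_sub_cancel]) hnc) x y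
  · push Not at hnc
    obtain ⟨z₀, hz₀⟩ := hnc
    have := AnalyticOnNhd.eq_of_eventuallyEq (g := fun _ => A z₀) (fun z _ => hA.analyticAt z)
      (fun z _ => analyticAt_const) hz₀
    rw [this]

theorem eq_of_omits_two_values_of_normedSpace {E : Type*} [NormedAddCommGroup E] [NormedSpace ℂ E]
    {t : E → ℂ} (ht : Differentiable ℂ t) {α β : ℂ} (hαβ : α ≠ β)
    (hα : ∀ z, t z ≠ α) (hβ : ∀ z, t z ≠ β) (x y : E) : t x = t y := by
  simpa using eq_of_omits_two_values (ht.comp_line y x) hαβ (fun _ => hα _) (fun _ => hβ _) 0 1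
end

section
open Filter Metric Topology Polynomial IntermediateField

section
variable {F M : Type*} [Field F] [Field M] [Algebra F M]

theorem trdeg_adjoin_simple_le_one (x : M) : Algebra.trdeg F F⟮x⟯ ≤ 1 := by
  have : Algebra.IsAlgebraic (Algebra.adjoin F {AdjoinSimple.gen F x}) F⟮x⟯ := by
    refine ⟨fun y => ?_⟩
    obtain ⟨p, q, hy⟩ := adjoin_simple_generated x y
    have hm : ∀ r : F[X], aeval (AdjoinSimple.gen F x) r ∈ Algebra.adjoin F {AdjoinSimple.gen F x} :=
      fun r => aeval_mem_adjoin_singleton F _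
    by_cases hq : aeval (AdjoinSimple.gen F x) q = 0
    · rw [hy, hq, div_zero]
      exact isAlgebraic_zero
    · refine ⟨C ⟨_, hm q⟩ * X - C ⟨_, hm p⟩, fun h => hq ?_, ?_⟩
      · simpa using congrArg (fun r => algebraMap _ F⟮x⟯ (coeff r 1)) h
      · have h1 : algebraMap (Algebra.adjoin F {AdjoinSimple.gen F x}) F⟮x⟯ ⟨_, hm q⟩ =
          aeval (AdjoinSimple.gen F x) q := rfl
        have h2 : algebraMap (Algebra.adjoin F {AdjoinSimple.gen F x}) F⟮x⟯ ⟨_, hm p⟩ =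
          aeval (AdjoinSimple.gen F x) p := rfl
        rw [map_sub, map_mul, aeval_C, aeval_C, aeval_X, h1, h2, hy, mul_div_cancel₀ _ hq, sub_self]
  simpa using Algebra.IsAlgebraic.trdeg_le_cardinalMk F (A := F⟮x⟯) {AdjoinSimple.gen F x}

theorem exists_mvPolynomial_of_mem_adjoin_simple {x a b : M} (ha : a ∈ F⟮x⟯) (hb : b ∈ F⟮x⟯) :
    ∃ P : MvPolynomial (Fin 2) F, P ≠ 0 ∧ MvPolynomial.aeval ![a, b] P = 0 := by
  have h : ¬AlgebraicIndependent F ![(⟨a, ha⟩ : F⟮x⟯), ⟨b, hb⟩] := fun h => by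
    have := h.lift_cardinalMk_le_trdeg.trans
      (Cardinal.lift_le.2 (trdeg_adjoin_simple_le_one (F := F) x))
    simp at this
  rw [algebraicIndependent_iff] at h
  push Not at h
  obtain ⟨P, hP, hP0⟩ := h
  refine ⟨P, hP0, ?_⟩
  have := congrArg (F⟮x⟯).val hP
  rw [MvPolynomial.comp_aeval_apply, map_zero] at this
  have h2 : ![a, b] = fun i => F⟮x⟯.val (![⟨a, ha⟩, ⟨b, hb⟩] i) := by
    funext i
    fin_cases i <;> rfl
  rwa [h2]
end

section
variable {E : Type*} [NormedAddCommGroup E] [NormedSpace ℂ E]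

theorem eval_eq_zero_of_aeval_eq_zero (f g : entireFunctions E) {P : MvPolynomial (Fin 2) ℂ} :
    MvPolynomial.aeval ![algebraMap _ (FractionRing (entireFunctions E)) f, algebraMap _ _ g] P = 0 ↔
      ∀ z, MvPolynomial.eval (fun i => if i = 0 then f.1 z else g.1 z) P = 0 := by
  have h2 : ∀ z, entireFunctions.evalHom z (MvPolynomial.aeval ![f, g] P) =
      MvPolynomial.eval (fun i => if i = 0 then f.1 z else g.1 z) P := by
    intro z
    rw [MvPolynomial.comp_aeval_apply, MvPolynomial.aeval_eq_eval]
    congr 2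
    ext i
    fin_cases i <;> rfl
  have h1 : MvPolynomial.aeval
      ![algebraMap _ (FractionRing (entireFunctions E)) f, algebraMap _ _ g] P =
      algebraMap _ _ (MvPolynomial.aeval ![f, g] P) := by
    rw [← MvPolynomial.aeval_algebraMap_apply]
    congr 2
    ext i
    fin_cases i <;> rfl
  rw [h1, map_eq_zero_iff _ (IsFractionRing.injective _ _), Subtype.ext_iff, funext_iff]
  exact forall_congr' fun z => by rw [← h2 z]; rfl

theorem algebraMap_exp_mul (h : E → ℂ) (hh : Differentiable ℂ h) (k : ℤ) :
    algebraMap (entireFunctions E) (FractionRing (entireFunctions E))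
      ⟨fun z => Complex.exp (k * h z), mem_entireFunctions.2 (hh.const_mul _).cexp⟩ =
    algebraMap (entireFunctions E) (FractionRing (entireFunctions E))
      ⟨fun z => Complex.exp (h z), mem_entireFunctions.2 hh.cexp⟩ ^ k := by
  let φ : Multiplicative ℤ →* entireFunctions E :=
    { toFun := fun k => ⟨fun z => Complex.exp (k.toAdd * h z), mem_entireFunctions.2 (hh.const_mul _).cexp⟩
      map_one' := Subtype.ext (funext fun z => by simp)
      map_mul' := fun a b => Subtype.ext (funext fun z => by
        simp [add_mul, Complex.exp_add]) }
  have := map_zpow ((algebraMap (entireFunctions E)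
    (FractionRing (entireFunctions E))).toMonoidHom.comp φ) (Multiplicative.ofAdd 1) k
  rw [← ofAdd_zsmul] at this
  convert this using 2
  · simp [φ]
  · simp [φ]

theorem exists_relation_of_eval {f g h : E → ℂ} (hh : Differentiable ℂ h) {p q : ℂ[X]}
    (hf : ∀ z, f z = p.eval (h z)) (hg : ∀ z, g z = q.eval (h z)) :
    ∃ P : MvPolynomial (Fin 2) ℂ, P ≠ 0 ∧
      ∀ z, MvPolynomial.eval (fun i => if i = 0 then f z else g z) P = 0 := by
  let h' : entireFunctions E := ⟨h, hh⟩
  have hm : ∀ p : ℂ[X], algebraMap _ (FractionRing (entireFunctions E)) (aeval h' p) ∈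
      ℂ⟮algebraMap _ (FractionRing (entireFunctions E)) h'⟯ := fun p => by
    rw [← aeval_algebraMap_apply]
    exact algebra_adjoin_le_adjoin _ _ (aeval_mem_adjoin_singleton _ _)
  obtain ⟨P, hP, h0⟩ := exists_mvPolynomial_of_mem_adjoin_simple (hm p) (hm q)
  refine ⟨P, hP, fun z => ?_⟩
  have hz : ∀ p : ℂ[X], (aeval h' p).1 z = p.eval (h z) := fun p => by
    have := aeval_algHom_apply (entireFunctions.evalHom z) h' p
    simpa using this.symm
  have := (eval_eq_zero_of_aeval_eq_zero _ _).1 h0 z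
  rwa [hz, hz, ← hf, ← hg] at this

theorem exists_relation_of_exp {f g h : E → ℂ} (hh : Differentiable ℂ h) {N : ℕ} {a b : ℤ → ℂ}
    (hf : ∀ z, f z = ∑ k ∈ Finset.Icc (-(N : ℤ)) (N : ℤ), a k * Complex.exp ((k : ℂ) * h z))
    (hg : ∀ z, g z = ∑ k ∈ Finset.Icc (-(N : ℤ)) (N : ℤ), b k * Complex.exp ((k : ℂ) * h z)) :
    ∃ P : MvPolynomial (Fin 2) ℂ, P ≠ 0 ∧
      ∀ z, MvPolynomial.eval (fun i => if i = 0 then f z else g z) P = 0 := by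
  let e : ℤ → entireFunctions E := fun k =>
    ⟨fun z => Complex.exp (k * h z), mem_entireFunctions.2 (hh.const_mul _).cexp⟩
  let s : (ℤ → ℂ) → entireFunctions E := fun a => ∑ k ∈ Finset.Icc (-(N : ℤ)) N, a k • e k
  have hm : ∀ a, algebraMap _ (FractionRing (entireFunctions E)) (s a) ∈
      ℂ⟮algebraMap (entireFunctions E) (FractionRing (entireFunctions E))
        ⟨fun z => Complex.exp (h z), mem_entireFunctions.2 hh.cexp⟩⟯ := by
    intro a
    rw [map_sum]
    refine sum_mem fun k _ => ?_
    rw [Algebra.smul_def, map_mul, ← IsScalarTower.algebraMap_apply, algebraMap_exp_mul h hh k]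
    exact mul_mem (_root_.algebraMap_mem _ _) (zpow_mem (mem_adjoin_simple_self _ _) k)
  obtain ⟨P, hP, h0⟩ := exists_mvPolynomial_of_mem_adjoin_simple (hm a) (hm b)
  refine ⟨P, hP, fun z => ?_⟩
  have hz : ∀ a, (s a).1 z = ∑ k ∈ Finset.Icc (-(N : ℤ)) (N : ℤ), a k * Complex.exp (k * h z) := by
    intro a
    rw [← entireFunctions.evalHom_apply, map_sum]
    rfl
  have := (eval_eq_zero_of_aeval_eq_zero _ _).1 h0 z
  rwa [hz, hz, ← hf, ← hg] at this
end
end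

section
open Filter Metric Topology Polynomial IntermediateField

section
variable {F M : Type*} [Field F] [Field M] [Algebra F M]

theorem isAlgebraic_adjoin_simple_of_aeval_eq_zero {a b : M} (ha : Transcendental F a)
    {P : MvPolynomial (Fin 2) F} (hP : P ≠ 0) (h0 : MvPolynomial.aeval ![a, b] P = 0) :
    IsAlgebraic F⟮a⟯ b := by
  have h1 : IsAlgebraic (Algebra.adjoin F (Set.range fun _ : Unit => a)) b := by
    by_contra hb
    have hx : AlgebraicIndependent F fun _ : Unit => a :=
      (algebraicIndependent_unique_type_iff (x := fun _ : Unit => a)).2 ha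
    have hopt := (hx.option_iff_transcendental b).2 hb
    have h2 := hopt.comp ![some (), none] fun i j => by fin_cases i <;> fin_cases j <;> simp
    have h3 : (fun o : Option Unit => o.elim b fun _ : Unit => a) ∘ ![some (), none] = ![a, b] := by
      funext i
      fin_cases i <;> rfl
    rw [h3] at h2
    exact hP (algebraicIndependent_iff.1 h2 P h0)
  refine h1.tower_top_of_subalgebra_le (B := F⟮a⟯.toSubalgebra) ?_
  rw [Set.range_const]
  exact algebra_adjoin_le_adjoin _ _

theorem finiteDimensional_adjoin_simple {a b : M} (hab : IntermediateField.adjoin F {a, b} = ⊤)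
    (hb : IsAlgebraic F⟮a⟯ b) : FiniteDimensional F⟮a⟯ M := by
  have h1 : F⟮a⟯⟮b⟯ = ⊤ := by
    apply IntermediateField.restrictScalars_injective F
    rw [adjoin_simple_adjoin_simple, hab]
    rfl
  have h2 := adjoin.finiteDimensional hb.isIntegral
  rw [h1] at h2
  exact Module.Finite.equiv (topEquiv (F := F⟮a⟯) (E := M)).toLinearEquiv

theorem adjoin_pair_eq_top {a b : M} (ha : a ∈ IntermediateField.adjoin F {a, b})
    (hb : b ∈ IntermediateField.adjoin F {a, b}) :
    IntermediateField.adjoin F {(⟨a, ha⟩ : IntermediateField.adjoin F {a, b}), ⟨b, hb⟩} = ⊤ := by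
  apply IntermediateField.map_injective (IntermediateField.adjoin F {a, b}).val
  rw [adjoin_map, ← AlgHom.fieldRange_eq_map, fieldRange_val, Set.image_pair]
  rfl

/-- Membership in `integralOver F t` yields a root of a monic polynomial over any ring through
which `F[t]` factors. -/
theorem isIntegral_of_mem_integralOver {K A : Type*} [Field K] [Algebra F K] [CommRing A]
    [Algebra F A] [Algebra A M] [IsScalarTower F A M] {t x : K} (φ : K →ₐ[F] M) {τ : A}
    (hτ : algebraMap A M τ = φ t) (hx : x ∈ integralOver F t) : IsIntegral A (φ x) := by
  obtain ⟨P, hP, h0⟩ := mem_integralOver.1 hx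
  refine ⟨P.map (aeval τ).toRingHom, hP.map _, ?_⟩
  have h1 : (algebraMap A M).comp (aeval τ : F[X] →ₐ[F] A).toRingHom =
      (φ : K →+* M).comp (aeval t : F[X] →ₐ[F] K).toRingHom := by
    ext r
    · simp [← IsScalarTower.algebraMap_apply]
    · simpa using hτ
  rw [eval₂_map, h1]
  have h2 := congrArg φ h0
  rw [map_zero] at h2
  rw [← h2]
  exact (hom_eval₂ P (aeval t : F[X] →ₐ[F] K).toRingHom (φ : K →+* M) x).symm

theorem mem_integralOver_of_relation {K : Type*} [Field K] [Algebra F K] {t p : K} {d : ℕ}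
    {c : ℕ → F[X]}
    (h : p ^ d + ∑ j ∈ Finset.Icc 1 d, aeval t (c j) * p ^ (d - j) = 0) :
    p ∈ integralOver F t := by
  refine mem_integralOver.2 ⟨X ^ d + ∑ j ∈ Finset.Icc 1 d, C (c j) * X ^ (d - j), ?_, ?_⟩
  · refine monic_X_pow_add ?_
    refine (degree_sum_le _ _).trans_lt ((Finset.sup_lt_iff (WithBot.bot_lt_coe d)).2 fun j hj => ?_)
    refine (degree_C_mul_X_pow_le _ _).trans_lt ?_
    have := Finset.mem_Icc.1 hj
    exact WithBot.coe_lt_coe.2 (show d - j < d by omega)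
  · simpa [eval₂_finsetSum] using h
end
end

section
open Filter Metric Topology Polynomial IntermediateField

section
variable {E : Type*} [NormedAddCommGroup E] [NormedSpace ℂ E]

theorem entireFunctions.aeval_apply (τ : entireFunctions E) (p : ℂ[X]) (z : E) :
    (aeval τ p).1 z = p.eval (τ.1 z) := by
  have := aeval_algHom_apply (entireFunctions.evalHom z) τ p
  simpa using this.symm

theorem exists_eq_div_of_mem_adjoin_simple {f τ : entireFunctions E}
    (h : algebraMap _ (FractionRing (entireFunctions E)) f ∈
      ℂ⟮algebraMap _ (FractionRing (entireFunctions E)) τ⟯) :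
    ∃ r s : ℂ[X], ∀ z, s.eval (τ.1 z) ≠ 0 ∧ f.1 z = r.eval (τ.1 z) / s.eval (τ.1 z) := by
  have hinj := IsFractionRing.injective (entireFunctions E) (FractionRing (entireFunctions E))
  obtain ⟨r, s, hrs⟩ := mem_adjoin_simple_iff ℂ _ |>.1 h
  rw [aeval_algebraMap_apply, aeval_algebraMap_apply] at hrs
  by_cases hs : aeval τ s = 0
  · rw [hs, map_zero, div_zero, map_eq_zero_iff _ hinj] at hrs
    exact ⟨0, 1, fun z => by simp [hrs]⟩
  rw [eq_div_iff (by rwa [Ne, map_eq_zero_iff _ hinj]), ← map_mul] at hrs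
  have hfs := hinj hrs
  have hs0 : s ≠ 0 := by
    rintro rfl
    exact hs (map_zero _)
  let g := EuclideanDomain.gcd r s
  have hg : g ≠ 0 := fun h => hs0 (EuclideanDomain.gcd_eq_zero_iff.1 h).2
  obtain ⟨r', hr⟩ := EuclideanDomain.gcd_dvd_left r s
  obtain ⟨s', hs'⟩ := EuclideanDomain.gcd_dvd_right r s
  have hbez := EuclideanDomain.gcd_eq_gcd_ab r s
  have hco : r' * EuclideanDomain.gcdA r s + s' * EuclideanDomain.gcdB r s = 1 := by
    refine mul_left_cancel₀ hg ?_
    rw [mul_add, ← mul_assoc, ← mul_assoc, ← hr, ← hs', mul_one, ← hbez]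
  have hg' : aeval τ g ≠ 0 := fun h0 => hs (by rw [hs', map_mul]; exact mul_eq_zero_of_left h0 _)
  have hfs' : f * aeval τ s' = aeval τ r' := by
    refine mul_left_cancel₀ hg' ?_
    rw [mul_left_comm, ← map_mul, ← map_mul, ← hr, ← hs', hfs]
  refine ⟨r', s', fun z => ?_⟩
  have h1 : f.1 z * s'.eval (τ.1 z) = r'.eval (τ.1 z) := by
    rw [← entireFunctions.aeval_apply, ← entireFunctions.aeval_apply, ← hfs']
    rfl
  have h2 := congrArg (eval (τ.1 z)) hco
  simp only [eval_add, eval_mul, eval_one] at h2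
  have h3 : s'.eval (τ.1 z) ≠ 0 := by
    intro h0
    rw [h0, mul_zero] at h1
    rw [← h1, h0, zero_mul, zero_mul, add_zero] at h2
    exact zero_ne_one h2
  exact ⟨h3, (eq_div_iff h3).2 h1⟩

theorem exists_laurent_sum (r : ℂ[X]) (β c : ℂ) (m : ℕ) {N : ℕ} (hr : r.natDegree ≤ N)
    (hm : m ≤ N) : ∃ a : ℤ → ℂ, ∀ w : ℂ,
      r.eval (β + Complex.exp w) / (c * Complex.exp w ^ m) =
        ∑ k ∈ Finset.Icc (-(N : ℤ)) N, a k * Complex.exp (k * w) := by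
  let r' := r.comp (X + C β)
  have hdeg : r'.natDegree = r.natDegree := by simp [r', natDegree_comp]
  refine ⟨fun k => ∑ i ∈ Finset.range (r'.natDegree + 1),
    if (i : ℤ) - m = k then r'.coeff i / c else 0, fun w => ?_⟩
  have h1 : r.eval (β + Complex.exp w) = r'.eval (Complex.exp w) := by simp [r', add_comm]
  rw [h1, eval_eq_sum_range, Finset.sum_div]
  simp only [Finset.sum_mul, ite_mul, zero_mul]
  rw [Finset.sum_comm]
  refine Finset.sum_congr rfl fun i hi => ?_
  have hi := Finset.mem_range.1 hi
  rw [Finset.sum_ite_eq, if_pos (Finset.mem_Icc.2 ⟨by omega, by omega⟩), ← Complex.exp_nat_mul,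
    ← Complex.exp_nat_mul]
  push_cast
  rw [sub_mul, Complex.exp_sub]
  ring

theorem exists_polynomial_or_exp {f g τ : E → ℂ} (hτ : Differentiable ℂ τ) {x₀ y₀ : E}
    (hnc : τ x₀ ≠ τ y₀) {r s p q : ℂ[X]}
    (hf : ∀ z, s.eval (τ z) ≠ 0 ∧ f z = r.eval (τ z) / s.eval (τ z))
    (hg : ∀ z, q.eval (τ z) ≠ 0 ∧ g z = p.eval (τ z) / q.eval (τ z)) :
    ∃ h : E → ℂ, Differentiable ℂ h ∧
      ((∃ Pf Pg : Polynomial ℂ, (∀ z, f z = Pf.eval (h z)) ∧ (∀ z, g z = Pg.eval (h z))) ∨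
       (∃ (N : ℕ) (a b : ℤ → ℂ),
          (∀ z, f z = ∑ k ∈ Finset.Icc (-(N : ℤ)) (N : ℤ), a k * Complex.exp ((k : ℂ) * h z)) ∧
          (∀ z, g z = ∑ k ∈ Finset.Icc (-(N : ℤ)) (N : ℤ), b k * Complex.exp ((k : ℂ) * h z)))) := by
  have hsq : ∀ β ∈ s.roots + q.roots, ∀ z, τ z ≠ β := by
    rintro β hβ z rfl
    rcases Multiset.mem_add.1 hβ with h | h
    · exact (hf z).1 (isRoot_of_mem_roots h)
    · exact (hg z).1 (isRoot_of_mem_roots h)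
  have huniq : ∀ α ∈ s.roots + q.roots, ∀ β ∈ s.roots + q.roots, α = β := by
    intro α hα β hβ
    by_contra h
    exact hnc (eq_of_omits_two_values_of_normedSpace hτ h (hsq α hα) (hsq β hβ) x₀ y₀)
  obtain ⟨β, hβ, hβτ⟩ : ∃ β, (∀ α ∈ s.roots + q.roots, α = β) ∧
      (s.roots + q.roots = 0 ∨ ∀ z, τ z ≠ β) := by
    by_cases h0 : s.roots + q.roots = 0
    · exact ⟨0, by simp [h0], .inl h0⟩
    · obtain ⟨β, hβ⟩ := Multiset.exists_mem_of_ne_zero h0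
      exact ⟨β, fun α hα => huniq α hα β hβ, .inr (hsq β hβ)⟩
  have hsplit : ∀ u : ℂ[X], (∀ α ∈ u.roots, α = β) → ∀ x,
      u.eval x = u.leadingCoeff * (x - β) ^ u.roots.card := by
    intro u hu x
    conv_lhs => rw [(IsAlgClosed.splits u).eq_prod_roots, Multiset.eq_replicate_card.2 hu]
    simp
  have hs := hsplit s fun α hα => hβ α (Multiset.mem_add.2 (.inl hα))
  have hq := hsplit q fun α hα => hβ α (Multiset.mem_add.2 (.inr hα))
  rcases hβτ with h0 | hβτ
  · obtain ⟨h1, h2⟩ := add_eq_zero.1 h0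
    refine ⟨τ, hτ, .inl ⟨C s.leadingCoeff⁻¹ * r, C q.leadingCoeff⁻¹ * p, fun z => ?_, fun z => ?_⟩⟩
    · rw [(hf z).2, hs, h1]
      simp [div_eq_inv_mul]
    · rw [(hg z).2, hq, h2]
      simp [div_eq_inv_mul]
  · obtain ⟨H, hH, hHe⟩ := exists_differentiable_exp_eq (t := fun z => τ z - β) (by fun_prop)
      fun z => sub_ne_zero.2 (hβτ z)
    let N := r.natDegree + s.roots.card + (p.natDegree + q.roots.card)
    obtain ⟨a, ha⟩ := exists_laurent_sum r β s.leadingCoeff s.roots.card (N := N)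
      (by omega) (by omega)
    obtain ⟨b, hb⟩ := exists_laurent_sum p β q.leadingCoeff q.roots.card (N := N)
      (by omega) (by omega)
    refine ⟨H, hH, .inr ⟨N, a, b, fun z => ?_, fun z => ?_⟩⟩
    · rw [← ha, (hf z).2, hs, hHe, add_sub_cancel]
    · rw [← hb, (hg z).2, hq, hHe, add_sub_cancel]

theorem not_relation_of_entire {τ P : E → ℂ} (hτ : Differentiable ℂ τ) (hP : Differentiable ℂ P)
    {z₀ z₁ : E} (hP0 : P z₀ ≠ 0) (hz₁ : τ z₀ ≠ τ z₁) {d : ℕ} (hd : 1 ≤ d) {D : ℂ[X]} {N : ℕ → ℂ[X]}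
    (hD : D ≠ 0)
    (hrel : ∀ z, P z ^ d + ∑ j ∈ Finset.Icc 1 d,
      (N j).eval (τ z) * D.eval (τ z) ^ (j - 1) * P z ^ (d - j) = 0)
    (hfin : ∀ b : ℂ, ∃ (q : ℂ[X]) (a : ℕ → ℂ[X]), q.eval b ≠ 0 ∧
      ∀ j ∈ Finset.Icc 1 d, q ^ j * (X - C b) ^ (j - 1) * N j = a j * D)
    (hinf : ∀ j ∈ Finset.Icc 1 d, N j = 0 ∨ (N j).natDegree + j + 1 ≤ D.natDegree) : False := by
  have hG := hτ.comp_line z₁ z₀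
  have hQ := hP.comp_line z₁ z₀
  have h01 : τ (z₀ + (0 : ℂ) • (z₁ - z₀)) ≠ τ (z₀ + (1 : ℂ) • (z₁ - z₀)) := by simpa
  have key := mul_deriv_eq_zero_of_algebraic hd hD hG hQ ?_ (fun s => hrel _) hfin hinf
  · refine h01 (is_const_of_deriv_eq_zero hG (fun s => ?_) 0 1)
    by_contra hs
    obtain ⟨x, h1, h2⟩ := exists_mul_ne_zero_of_differentiable hQ hG.deriv (a := 0) (b := s)
      (by simpa) hs
    exact mul_ne_zero h1 h2 (key x)
  · intro s hs
    have := AnalyticOnNhd.eq_of_eventuallyEq (g := fun _ => τ (z₀ + s • (z₁ - z₀)))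
      (fun z _ => hG.analyticAt z) (fun z _ => analyticAt_const) hs
    exact h01 ((congrFun this 0).trans (congrFun this 1).symm)
end
end

section
open Filter Metric Topology Polynomial IntermediateField

theorem algHom_relation {R A B : Type*} [CommRing R] [CommRing A] [CommRing B] [Algebra R A]
    [Algebra R B] (φ : A →ₐ[R] B) (t p : A) (d : ℕ) (c : ℕ → R[X]) :
    φ (p ^ d + ∑ j ∈ Finset.Icc 1 d, aeval t (c j) * p ^ (d - j)) =
      φ p ^ d + ∑ j ∈ Finset.Icc 1 d, aeval (φ t) (c j) * φ p ^ (d - j) := by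
  simp [← aeval_algHom_apply]

theorem relation_of_algebraMap_eq {F M A : Type*} [Field F] [Field M] [Algebra F M] [CommRing A]
    [Algebra F A] [Algebra A M] [IsScalarTower F A M] (hinj : Function.Injective (algebraMap A M))
    {K : IntermediateField F M} {t p : K} {τ P : A} (hτ : algebraMap A M τ = t)
    (hP : algebraMap A M P = p) {d : ℕ} {c : ℕ → F[X]}
    (h : p ^ d + ∑ j ∈ Finset.Icc 1 d, aeval t (c j) * p ^ (d - j) = 0) :
    P ^ d + ∑ j ∈ Finset.Icc 1 d, aeval τ (c j) * P ^ (d - j) = 0 := by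
  apply hinj
  have h2 := congrArg K.val h
  have h3 := algHom_relation (IsScalarTower.toAlgHom F A M) τ P d c
  rw [algHom_relation, map_zero] at h2
  rw [IsScalarTower.coe_toAlgHom', hτ, hP] at h3
  rw [map_zero]
  exact h3.trans h2

section
variable {E : Type*} [NormedAddCommGroup E] [NormedSpace ℂ E]

theorem transcendental_algebraMap_of_ne {τ : entireFunctions E} {x y : E} (h : τ.1 x ≠ τ.1 y) :
    Transcendental ℂ (algebraMap _ (FractionRing (entireFunctions E)) τ) := by
  refine transcendental_of_not_mem_range fun c hc => h ?_
  rw [IsScalarTower.algebraMap_apply ℂ (entireFunctions E)] at hc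
  have := IsFractionRing.injective (entireFunctions E) (FractionRing (entireFunctions E)) hc
  rw [← this]
  rfl

theorem exists_ne_of_transcendental {τ : entireFunctions E}
    (h : Transcendental ℂ (algebraMap _ (FractionRing (entireFunctions E)) τ)) (x : E) :
    ∃ y, τ.1 x ≠ τ.1 y := by
  by_contra! hc
  refine h ?_
  have : τ = algebraMap ℂ (entireFunctions E) (τ.1 x) := Subtype.ext (funext fun y => (hc y).symm)
  rw [this, ← IsScalarTower.algebraMap_apply]
  exact isAlgebraic_algebraMap _

theorem exists_entire_generator [FiniteDimensional ℂ E]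
    (K : IntermediateField ℂ (FractionRing (entireFunctions E))) {t₀ : K} {τ₀ : entireFunctions E}
    (hτ₀ : algebraMap _ _ τ₀ = (t₀ : FractionRing (entireFunctions E)))
    (ht₀ : Transcendental ℂ t₀) [FiniteDimensional ℂ⟮t₀⟯ K] :
    ∃ (t : K) (τ : entireFunctions E), algebraMap _ _ τ = (t : FractionRing (entireFunctions E)) ∧
      Transcendental ℂ t ∧ ℂ⟮t⟯ = ⊤ := by
  let S : Set K := {t | Transcendental ℂ t ∧ FiniteDimensional ℂ⟮t⟯ K ∧
    ∃ τ : entireFunctions E, algebraMap _ _ τ = (t : FractionRing (entireFunctions E))}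
  obtain ⟨t, ⟨ht, hfd, τ, hτ⟩, hmin⟩ :=
    (measure fun t : K => Module.finrank ℂ⟮t⟯ K).wf.has_min S ⟨t₀, ht₀, ‹_›, τ₀, hτ₀⟩
  have hentire : ∀ x ∈ integralOver ℂ t, ∃ ξ : entireFunctions E,
      algebraMap _ _ ξ = (x : FractionRing (entireFunctions E)) := fun x hx =>
    (isIntegrallyClosed_iff _).1 inferInstance (isIntegral_of_mem_integralOver K.val hτ hx)
  refine ⟨t, τ, hτ, ht, finrank_eq_one_iff_eq_top.1 ?_⟩
  by_contra hne
  have hpos : 0 < Module.finrank ℂ⟮t⟯ K := Module.finrank_pos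
  have hd : 1 < Module.finrank ℂ⟮t⟯ K := by omega
  rcases exists_finrank_lt_or_relation ht hd with ⟨x, hx, hxt, hxf, hlt⟩ |
    ⟨D, N, p, hD, hp, hrel, hfin, hinf⟩
  · exact hmin x ⟨hxt, hxf, hentire x hx⟩ hlt
  · obtain ⟨P, hP⟩ := hentire p (mem_integralOver_of_relation hrel)
    have hinj := IsFractionRing.injective (entireFunctions E) (FractionRing (entireFunctions E))
    have hP0 : P ≠ 0 := by
      rintro rfl
      rw [map_zero] at hP
      exact hp (Subtype.ext hP.symm)
    obtain ⟨z₀, hz₀⟩ := Function.ne_iff.1 fun h0 => hP0 (Subtype.ext h0)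
    have hτt : Transcendental ℂ (algebraMap _ (FractionRing (entireFunctions E)) τ) := by
      rw [hτ]
      exact fun h => ht ((isAlgebraic_algHom_iff K.val K.val.injective).1 h)
    obtain ⟨z₁, hz₁⟩ := exists_ne_of_transcendental hτt z₀
    refine not_relation_of_entire τ.2 P.2 hz₀ hz₁ hd.le hD (fun z => ?_) hfin hinf
    have h1 := relation_of_algebraMap_eq hinj hτ hP hrel
    have h3 := congrArg (entireFunctions.evalHom z) h1
    rw [algHom_relation, map_zero] at h3
    simpa [aeval_algHom_apply, entireFunctions.aeval_apply] using h3

theorem exists_polynomial_or_exp_of_relation [FiniteDimensional ℂ E] {f g : E → ℂ}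
    (hf : Differentiable ℂ f) (hg : Differentiable ℂ g) {P : MvPolynomial (Fin 2) ℂ} (hP : P ≠ 0)
    (hrel : ∀ z, MvPolynomial.eval (fun i => if i = 0 then f z else g z) P = 0) :
    ∃ h : E → ℂ, Differentiable ℂ h ∧
      ((∃ Pf Pg : Polynomial ℂ, (∀ z, f z = Pf.eval (h z)) ∧ (∀ z, g z = Pg.eval (h z))) ∨
       (∃ (N : ℕ) (a b : ℤ → ℂ),
          (∀ z, f z = ∑ k ∈ Finset.Icc (-(N : ℤ)) (N : ℤ), a k * Complex.exp ((k : ℂ) * h z)) ∧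
          (∀ z, g z = ∑ k ∈ Finset.Icc (-(N : ℤ)) (N : ℤ), b k * Complex.exp ((k : ℂ) * h z)))) := by
  by_cases hc : ∀ x, f x = f 0
  · exact ⟨g, hg, .inl ⟨C (f 0), X, fun z => by simp [hc z], fun z => by simp⟩⟩
  push Not at hc
  obtain ⟨x₀, hx₀⟩ := hc
  let f' : entireFunctions E := ⟨f, hf⟩
  let g' : entireFunctions E := ⟨g, hg⟩
  let ι := algebraMap (entireFunctions E) (FractionRing (entireFunctions E))
  let K := IntermediateField.adjoin ℂ {ι f', ι g'}
  have hfK : ι f' ∈ K := subset_adjoin _ _ (by simp)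
  have hgK : ι g' ∈ K := subset_adjoin _ _ (by simp)
  have hft : Transcendental ℂ (⟨ι f', hfK⟩ : K) := fun h =>
    transcendental_algebraMap_of_ne (τ := f') hx₀ (h.algHom K.val)
  have h0 : MvPolynomial.aeval ![(⟨ι f', hfK⟩ : K), ⟨ι g', hgK⟩] P = 0 := by
    refine (map_eq_zero_iff K.val K.val.injective).1 ?_
    rw [MvPolynomial.comp_aeval_apply,
      ← (eval_eq_zero_of_aeval_eq_zero f' g' (P := P)).2 hrel]
    congr 2
    funext i
    fin_cases i <;> rfl
  have hfd := finiteDimensional_adjoin_simple (adjoin_pair_eq_top hfK hgK)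
    (isAlgebraic_adjoin_simple_of_aeval_eq_zero hft hP h0)
  obtain ⟨t, τ, hτ, ht, htop⟩ := exists_entire_generator K (τ₀ := f') rfl hft
  have hmem : ∀ u : entireFunctions E, ι u ∈ K → ι u ∈ ℂ⟮ι τ⟯ := by
    intro u hu
    have h1 : (⟨ι u, hu⟩ : K) ∈ ℂ⟮t⟯ := htop ▸ mem_top
    have h2 : K.val ⟨ι u, hu⟩ ∈ ℂ⟮t⟯.map K.val := ⟨_, h1, rfl⟩
    rw [adjoin_map, Set.image_singleton] at h2
    rw [show ι τ = K.val t from hτ]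
    exact h2
  obtain ⟨r, s, hrs⟩ := exists_eq_div_of_mem_adjoin_simple (hmem f' hfK)
  obtain ⟨p, q, hpq⟩ := exists_eq_div_of_mem_adjoin_simple (hmem g' hgK)
  have hτt : Transcendental ℂ (ι τ) := by
    rw [show ι τ = K.val t from hτ]
    exact fun h => ht ((isAlgebraic_algHom_iff K.val K.val.injective).1 h)
  obtain ⟨y₀, hy₀⟩ := exists_ne_of_transcendental hτt 0
  exact exists_polynomial_or_exp τ.2 hy₀ hrs hpq
end
end

/-- Theorem 5.1: two entire functions `f, g` on `ℂⁿ` are algebraically dependent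
over `ℂ` iff there is an entire function `h` with either `f, g ∈ ℂ[h]` or
`f, g ∈ ℂ[e^h, e^{-h}]` (Laurent polynomials in `e^h`). -/
theorem stmt_18 (n : ℕ) (f g : (Fin n → ℂ) → ℂ)
    (hf : Differentiable ℂ f) (hg : Differentiable ℂ g) :
    (∃ P : MvPolynomial (Fin 2) ℂ, P ≠ 0 ∧
      ∀ z, MvPolynomial.eval (fun i => if i = 0 then f z else g z) P = 0) ↔
    (∃ h : (Fin n → ℂ) → ℂ, Differentiable ℂ h ∧
      ((∃ Pf Pg : Polynomial ℂ,
          (∀ z, f z = Pf.eval (h z)) ∧ (∀ z, g z = Pg.eval (h z))) ∨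
       (∃ (N : ℕ) (a b : ℤ → ℂ),
          (∀ z, f z = ∑ k ∈ Finset.Icc (-(N : ℤ)) (N : ℤ),
            a k * Complex.exp ((k : ℂ) * h z)) ∧
          (∀ z, g z = ∑ k ∈ Finset.Icc (-(N : ℤ)) (N : ℤ),
            b k * Complex.exp ((k : ℂ) * h z))))) := by
  constructor
  · rintro ⟨P, hP, h⟩
    exact exists_polynomial_or_exp_of_relation hf hg hP h
  · rintro ⟨h, hh, ⟨p, q, hp, hq⟩ | ⟨N, a, b, ha, hb⟩⟩
    · exact exists_relation_of_eval hh hp hq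
    · exact exists_relation_of_exp hh ha hb
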